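/- arXiv:1404.2624 — 2 statements merged into one kernel-verified Lean document; each statement's English description precedes it below -/
import Mathlib

section
/- Let V ⊆ S² be a finite set with |V| ≥ 2. Then the number of edges of the weak Gabriel graph of V is at most (15/4)|V| − 6. -/
open scoped RealInnerProductSpace Classical

noncomputable section

abbrev Euc (d : ℕ) : Type := EuclideanSpace ℝ (Fin d)

/-- `{p, q}` is a double-normal pair of the finite point set `V`. -/
def IsDNPair {d : ℕ} (V : Finset (Euc d)) (p q : Euc d) : Prop :=
  p ∈ V ∧ q ∈ V ∧ p ≠ q ∧
    ∀ v ∈ V, 0 ≤ ⟪v - p, q - p⟫ ∧ 0 ≤ ⟪v - q, p - q⟫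

/-- `N(V)`: the number of (unordered) double-normal pairs of `V`. -/
def numDN {d : ℕ} (V : Finset (Euc d)) : ℕ :=
  ((V ×ˢ V).filter fun pq => IsDNPair V pq.1 pq.2).card / 2

/-- `{p, q}` is a strict double-normal pair of `V`. -/
def IsStrictDNPair {d : ℕ} (V : Finset (Euc d)) (p q : Euc d) : Prop :=
  IsDNPair V p q ∧
    ∀ v ∈ V, v ≠ p → v ≠ q → 0 < ⟪v - p, q - p⟫ ∧ 0 < ⟪v - q, p - q⟫

/-- `N'(V)`: the number of (unordered) strict double-normal pairs of `V`. -/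
def numStrictDN {d : ℕ} (V : Finset (Euc d)) : ℕ :=
  ((V ×ˢ V).filter fun pq => IsStrictDNPair V pq.1 pq.2).card / 2

/-- `{a, b}` is an edge of the weak Gabriel graph of `V ⊆ S²`: `a` and `b` are distinct,
non-antipodal, and no point of `V` lies in the open minor spherical cap with diameter `ab`. -/
def IsWeakGabrielEdge (V : Finset (Euc 3)) (a b : Euc 3) : Prop :=
  a ∈ V ∧ b ∈ V ∧ a ≠ b ∧ b ≠ -a ∧ ∀ v ∈ V, 0 ≤ ⟪v - a, v - b⟫

/-- The number of edges of the weak Gabriel graph of `V`. -/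
def numWeakGabriel (V : Finset (Euc 3)) : ℕ :=
  ((V ×ˢ V).filter fun pq => IsWeakGabrielEdge V pq.1 pq.2).card / 2

/-- `{a, b}` is an edge of the strict Gabriel graph of `V ⊆ S²`: `a` and `b` are distinct,
non-antipodal, and no point of `V \ {a, b}` lies in the closed minor spherical cap with
diameter `ab`. -/
def IsStrictGabrielEdge (V : Finset (Euc 3)) (a b : Euc 3) : Prop :=
  a ∈ V ∧ b ∈ V ∧ a ≠ b ∧ b ≠ -a ∧ ∀ v ∈ V, v ≠ a → v ≠ b → 0 < ⟪v - a, v - b⟫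

/-- The relative interior of the minor great-circular arc with endpoints `a`, `b`. -/
def arcInterior (a b : Euc 3) : Set (Euc 3) :=
  {x | ∃ lam mu : ℝ, 0 < lam ∧ 0 < mu ∧
    x = (‖lam • a + mu • b‖)⁻¹ • (lam • a + mu • b)}



def dt (a b : Euc 3) : ℝ := a 0 * b 0 + a 1 * b 1 + a 2 * b 2

def dd (a b c : Euc 3) : ℝ :=
  a 0 * (b 1 * c 2 - b 2 * c 1) + a 1 * (b 2 * c 0 - b 0 * c 2) + a 2 * (b 0 * c 1 - b 1 * c 0)

def cr (a b : Euc 3) : Euc 3 :=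
  !₂[a 1 * b 2 - a 2 * b 1, a 2 * b 0 - a 0 * b 2, a 0 * b 1 - a 1 * b 0]

theorem inner_dt (a b : Euc 3) : ⟪a, b⟫ = dt a b := by
  simp [PiLp.inner_apply, Fin.sum_univ_three, dt]; ring

theorem dt_cr (a b x : Euc 3) : dt (cr a b) x = dd a b x := by
  simp [dt, cr, dd]; ring

theorem dt_comm (a b : Euc 3) : dt a b = dt b a := by simp only [dt]; ring
theorem dt_sub (a b c : Euc 3) : dt a (b - c) = dt a b - dt a c := by
  simp only [dt, PiLp.sub_apply]; ring
theorem dt_add (a b c : Euc 3) : dt a (b + c) = dt a b + dt a c := by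
  simp only [dt, PiLp.add_apply]; ring
theorem dt_smul (a b : Euc 3) (r : ℝ) : dt a (r • b) = r * dt a b := by
  simp only [dt, PiLp.smul_apply, smul_eq_mul]; ring
theorem dt_neg (a b : Euc 3) : dt a (-b) = - dt a b := by
  simp only [dt, PiLp.neg_apply]; ring
theorem sub_dt (a b c : Euc 3) : dt (b - c) a = dt b a - dt c a := by
  simp only [dt, PiLp.sub_apply]; ring
theorem add_dt (a b c : Euc 3) : dt (b + c) a = dt b a + dt c a := by
  simp only [dt, PiLp.add_apply]; ring
theorem smul_dt (a b : Euc 3) (r : ℝ) : dt (r • b) a = r * dt b a := by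
  simp only [dt, PiLp.smul_apply, smul_eq_mul]; ring
theorem neg_dt (a b : Euc 3) : dt (-b) a = - dt b a := by
  simp only [dt, PiLp.neg_apply]; ring
theorem dt_self_nonneg (a : Euc 3) : 0 ≤ dt a a := by
  simp only [dt]; nlinarith [mul_self_nonneg (a 0), mul_self_nonneg (a 1), mul_self_nonneg (a 2)]
theorem ext3 {a b : Euc 3} (h0 : a 0 = b 0) (h1 : a 1 = b 1) (h2 : a 2 = b 2) : a = b := by
  ext i; fin_cases i <;> assumption
theorem dt_self_eq {a : Euc 3} (h : dt a a = 0) : a = 0 := by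
  simp only [dt] at h
  apply ext3 <;> simp only [PiLp.zero_apply] <;>
    nlinarith [sq_nonneg (a 0), sq_nonneg (a 1), sq_nonneg (a 2)]
theorem dt_self_pos {a : Euc 3} (h : a ≠ 0) : 0 < dt a a :=
  lt_of_le_of_ne (dt_self_nonneg a) (fun h' => h (dt_self_eq h'.symm))
theorem dd_swap (a b c : Euc 3) : dd b a c = - dd a b c := by simp only [dd]; ring
theorem dd_swap' (a b c : Euc 3) : dd a c b = - dd a b c := by simp only [dd]; ring
theorem dd_rot (a b c : Euc 3) : dd b c a = dd a b c := by simp only [dd]; ring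
theorem dd_self (a b : Euc 3) : dd a b b = 0 := by simp only [dd]; ring
theorem dd_self' (a b : Euc 3) : dd a b a = 0 := by simp only [dd]; ring
theorem dd_zero (a b : Euc 3) : dd a b 0 = 0 := by simp [dd]
theorem dd_add (a b x y : Euc 3) : dd a b (x + y) = dd a b x + dd a b y := by
  simp only [← dt_cr, dt_add]
theorem dd_smul (a b x : Euc 3) (r : ℝ) : dd a b (r • x) = r * dd a b x := by
  simp only [← dt_cr, dt_smul]

theorem cramer (a b c x y : Euc 3) :
    dd a b c * dt x y = dd x b c * dt a y + dd a x c * dt b y + dd a b x * dt c y := by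
  simp only [dd, dt]; ring

def Sph (V : Finset (Euc 3)) : Prop := ∀ v ∈ V, dt v v = 1

theorem noncol {a b c : Euc 3} (ha : dt a a = 1) (hb : dt b b = 1) (hc : dt c c = 1)
    (hab : a ≠ b) (hac : a ≠ c) (hbc : b ≠ c) : cr (b - a) (c - a) ≠ 0 := by
  intro h
  have h0 := congrArg (fun x : Euc 3 => x 0) h
  have h1 := congrArg (fun x : Euc 3 => x 1) h
  have h2 := congrArg (fun x : Euc 3 => x 2) h
  simp [cr] at h0 h1 h2
  have eab := dt_self_pos (sub_ne_zero.mpr hab)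
  have eac := dt_self_pos (sub_ne_zero.mpr hac)
  have ebc := dt_self_pos (sub_ne_zero.mpr hbc)
  -- |u|^2 (a.e) = (e.u)(a.u)
  have k1 : dt (c-a) (c-a) * dt a (b-a) = dt (b-a) (c-a) * dt a (c-a) := by
    simp only [dt, PiLp.sub_apply]
    linear_combination (a 1 * (c 2 - a 2) - a 2 * (c 1 - a 1)) * h0 + (a 2 * (c 0 - a 0) - a 0 * (c 2 - a 2)) * h1 + (a 0 * (c 1 - a 1) - a 1 * (c 0 - a 0)) * h2
  have k2 : dt (b-a) (b-a) * dt a (c-a) = dt (b-a) (c-a) * dt a (b-a) := by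
    simp only [dt, PiLp.sub_apply]
    linear_combination (-a 1 * (b 2 - a 2) + a 2 * (b 1 - a 1)) * h0 + (-a 2 * (b 0 - a 0) + a 0 * (b 2 - a 2)) * h1 + (-a 0 * (b 1 - a 1) + a 1 * (b 0 - a 0)) * h2
  simp only [dt_sub, sub_dt, dt_comm b a, dt_comm c a, dt_comm c b, ha, hb, hc] at *
  have m1 : (1 - dt a b) = (dt b c - dt a c - (dt a b - 1)) / 2 := by
    have : (1 - dt a c) ≠ 0 := by linarith
    apply mul_left_cancel₀ this; linear_combination -k1/2
  have m2 : (1 - dt a c) = (dt b c - dt a c - (dt a b - 1)) / 2 := by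
    have : (1 - dt a b) ≠ 0 := by linarith
    apply mul_left_cancel₀ this; linear_combination -k2/2
  linarith

def IsFace (V F : Finset (Euc 3)) : Prop :=
  3 ≤ F.card ∧ ∃ w : Euc 3, ∃ c : ℝ, w ≠ 0 ∧ (∀ x ∈ V, c ≤ dt w x) ∧
    F = V.filter (fun x => dt w x = c)

theorem IsFace.sub {V F : Finset (Euc 3)} (h : IsFace V F) : F ⊆ V := by
  obtain ⟨_, w, c, _, _, rfl⟩ := h
  exact Finset.filter_subset _ _

theorem face_char {V F : Finset (Euc 3)} (hS : Sph V) (hF : IsFace V F) {v p q : Euc 3}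
    (hv : v ∈ F) (hp : p ∈ F) (hq : q ∈ F) (hvp : v ≠ p) (hvq : v ≠ q) (hpq : p ≠ q) :
    F = V.filter (fun x => dd (p - v) (q - v) (x - v) = 0) ∧
    ((∀ x ∈ V, 0 ≤ dd (p - v) (q - v) (x - v)) ∨ (∀ x ∈ V, dd (p - v) (q - v) (x - v) ≤ 0)) := by
  have hsub := hF.sub
  have hN := noncol (hS v (hsub hv)) (hS p (hsub hp)) (hS q (hsub hq)) hvp hvq hpq
  obtain ⟨h3, w, c, hw, hpos, rfl⟩ := hF
  simp only [Finset.mem_filter] at hv hp hq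
  set N := cr (p - v) (q - v) with hNdef
  have hNN := dt_self_pos hN
  have e1 : dt (p - v) w = 0 := by rw [dt_comm, dt_sub]; linarith
  have e2 : dt (q - v) w = 0 := by rw [dt_comm, dt_sub]; linarith
  -- N.N * w.X = N.X * N.w
  have key : ∀ x, dt N N * dt w (x - v) = dd (p - v) (q - v) (x - v) * dt N w := by
    intro x
    have := cramer (p-v) (q-v) N (x - v) w
    rw [e1, e2, ← dt_cr (p-v) (q-v) N, ← hNdef, dt_comm _ w] at this
    linarith
  have hwN : dt N w ≠ 0 := by
    intro h
    apply hw
    apply dt_self_eq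
    have := cramer (p-v) (q-v) N w w
    rw [e1, e2, ← dt_cr (p-v) (q-v) N, ← hNdef, h] at this
    have : dt N N * dt w w = 0 := by linarith
    rcases mul_eq_zero.mp this with h | h
    · exact absurd h hNN.ne'
    · exact h
  refine ⟨?_, ?_⟩
  · apply Finset.filter_congr
    intro x hx
    have k := key x
    rw [dt_sub, hv.2] at k
    constructor
    · intro h
      rw [h, sub_self, mul_zero] at k
      rcases mul_eq_zero.mp k.symm with h | h
      · exact h
      · exact absurd h hwN
    · intro h
      rw [h, zero_mul] at k
      rcases mul_eq_zero.mp k with h | h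
      · exact absurd h hNN.ne'
      · linarith
  · have k2 : ∀ x ∈ V, 0 ≤ dd (p - v) (q - v) (x - v) * dt N w := by
      intro x hx
      rw [← key x, dt_sub, hv.2]
      exact mul_nonneg hNN.le (by linarith [hpos x hx])
    rcases lt_or_gt_of_ne hwN with h | h
    · right; intro x hx
      have := k2 x hx
      by_contra hc; push Not at hc
      nlinarith
    · left; intro x hx
      have := k2 x hx
      by_contra hc; push Not at hc
      nlinarith

theorem face_unique {V F F' : Finset (Euc 3)} (hS : Sph V) (hF : IsFace V F) (hF' : IsFace V F')
    {v p q : Euc 3} (hv : v ∈ F) (hp : p ∈ F) (hq : q ∈ F) (hv' : v ∈ F') (hp' : p ∈ F')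
    (hq' : q ∈ F') (hvp : v ≠ p) (hvq : v ≠ q) (hpq : p ≠ q) : F = F' := by
  rw [(face_char hS hF hv hp hq hvp hvq hpq).1, (face_char hS hF' hv' hp' hq' hvp hvq hpq).1]

theorem core {V : Finset (Euc 3)} {z v p r p' r' : Euc 3}
    (hp : p ∈ V) (hr : r ∈ V) (hp' : p' ∈ V) (hr' : r' ∈ V)
    (h1 : dt z p < dt z v) (h2 : dt z v < dt z r) (h1' : dt z p' < dt z v) (h2' : dt z v < dt z r')
    (H : ∀ x ∈ V, 0 ≤ dd (p - v) (r - v) (x - v))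
    (H' : ∀ x ∈ V, 0 ≤ dd (p' - v) (r' - v) (x - v)) :
    dd (p - v) (r - v) (p' - v) = 0 ∧ dd (p - v) (r - v) (r' - v) = 0 := by
  have A := H p' hp'
  have B := H r' hr'
  have A' := H' p hp
  have B' := H' r hr
  have a1 : dt z (p - v) < 0 := by rw [dt_sub]; linarith
  have a2 : 0 < dt z (r - v) := by rw [dt_sub]; linarith
  have a1' : dt z (p' - v) < 0 := by rw [dt_sub]; linarith
  have a2' : 0 < dt z (r' - v) := by rw [dt_sub]; linarith
  have hz : z ≠ 0 := by
    rintro rfl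
    simp [dt] at a1
  have hzz := dt_self_pos hz
  generalize p - v = e at *
  generalize r - v = u at *
  generalize p' - v = e' at *
  generalize r' - v = u' at *
  set R := dt z u • e - dt z e • u with hR
  set R' := dt z u' • e' - dt z e' • u' with hR'
  have zR : dt R z = 0 := by rw [hR, sub_dt, smul_dt, smul_dt, dt_comm e, dt_comm u]; ring
  have zR' : dt R' z = 0 := by rw [hR', sub_dt, smul_dt, smul_dt, dt_comm e', dt_comm u']; ring
  have c1 := cramer e R R' z z
  have c2 := cramer e' R' R z z
  rw [zR, zR'] at c1 c2
  have s1 : dd e R R' = - dt z e * (dt z u' * dd e u e' - dt z e' * dd e u u') := by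
    simp only [hR, hR', dd, PiLp.sub_apply, PiLp.smul_apply, smul_eq_mul]; ring
  have s2 : dd e' R' R = - dt z e' * (dt z u * dd e' u' e - dt z e * dd e' u' u) := by
    simp only [hR, hR', dd, PiLp.sub_apply, PiLp.smul_apply, smul_eq_mul]; ring
  have s3 : dd z R' R = - dd z R R' := dd_swap' _ _ _
  have q1 : 0 ≤ dt z u' * dd e u e' := mul_nonneg a2'.le A
  have q2 : 0 ≤ - dt z e' * dd e u u' := mul_nonneg (by linarith) B
  have q3 : 0 ≤ dt z u * dd e' u' e := mul_nonneg a2.le A'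
  have q4 : 0 ≤ - dt z e * dd e' u' u := mul_nonneg (by linarith) B'
  have t1 : 0 ≤ dd e R R' := by rw [s1]; apply mul_nonneg <;> linarith
  have t2 : 0 ≤ dd e' R' R := by rw [s2]; apply mul_nonneg <;> linarith
  have d1 : dd z R R' ≤ 0 := by
    by_contra hc; push Not at hc
    have := mul_nonneg t1 hzz.le
    rw [dt_comm e] at c1
    nlinarith
  have d2 : 0 ≤ dd z R R' := by
    by_contra hc; push Not at hc
    have := mul_nonneg t2 hzz.le
    rw [dt_comm e', s3] at c2
    nlinarith
  have d3 : dd z R R' = 0 := le_antisymm d1 d2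
  rw [d3] at c1
  have t3 : dd e R R' = 0 := by
    have : dd e R R' * dt z z = 0 := by linarith
    rcases mul_eq_zero.mp this with h | h
    · exact h
    · exact absurd h hzz.ne'
  rw [s1] at t3
  have t4 : dt z u' * dd e u e' - dt z e' * dd e u u' = 0 := by
    rcases mul_eq_zero.mp t3 with h | h
    · linarith
    · exact h
  constructor
  · have : dt z u' * dd e u e' = 0 := by linarith
    rcases mul_eq_zero.mp this with h | h
    · linarith
    · exact h
  · have : dt z e' * dd e u u' = 0 := by linarith
    rcases mul_eq_zero.mp this with h | h
    · linarith
    · exact h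


def Gb (V : Finset (Euc 3)) (a c : Euc 3) : Prop :=
  a ∈ V ∧ c ∈ V ∧ a ≠ c ∧ c ≠ -a ∧ ∀ x ∈ V, dt (a + c) x ≤ 1 + dt a c

def Zs (V : Finset (Euc 3)) (a c : Euc 3) : Finset (Euc 3) :=
  V.filter (fun x => dt (a + c) x = 1 + dt a c)

theorem Gb.symm {V : Finset (Euc 3)} {a c : Euc 3} (h : Gb V a c) : Gb V c a := by
  obtain ⟨h1, h2, h3, h4, h5⟩ := h
  refine ⟨h2, h1, h3.symm, ?_, ?_⟩
  · intro h; apply h4; rw [h, neg_neg]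
  · intro x hx; rw [add_comm, dt_comm c a]; exact h5 x hx

theorem Zs_symm (V : Finset (Euc 3)) (a c : Euc 3) : Zs V a c = Zs V c a := by
  simp only [Zs, add_comm a c, dt_comm a c]

theorem Gb_iff {V : Finset (Euc 3)} (hS : Sph V) (a c : Euc 3) :
    IsWeakGabrielEdge V a c ↔ Gb V a c := by
  unfold IsWeakGabrielEdge Gb
  refine and_congr_right fun ha => and_congr_right fun hc => and_congr_right fun _ =>
    and_congr_right fun _ => forall_congr' fun x => forall_congr' fun hx => ?_
  rw [inner_dt, dt_sub, sub_dt, sub_dt, add_dt, hS x hx, dt_comm x c]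
  constructor <;> intro h <;> linarith

theorem Gb.mem_left {V : Finset (Euc 3)} (hS : Sph V) {a c : Euc 3} (h : Gb V a c) :
    a ∈ Zs V a c := by
  simp only [Zs, Finset.mem_filter, add_dt, hS a h.1, dt_comm c a]
  exact ⟨h.1, trivial⟩

theorem Gb.mem_right {V : Finset (Euc 3)} (hS : Sph V) {a c : Euc 3} (h : Gb V a c) :
    c ∈ Zs V a c := by
  rw [Zs_symm]; exact h.symm.mem_left hS

theorem Gb.face {V : Finset (Euc 3)} {a c : Euc 3} (h : Gb V a c)
    (h3 : 3 ≤ (Zs V a c).card) : IsFace V (Zs V a c) := by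
  refine ⟨h3, -(a + c), -(1 + dt a c), ?_, ?_, ?_⟩
  · intro h0
    apply h.2.2.2.1
    have : a + c = 0 := neg_eq_zero.mp h0
    exact (neg_eq_of_add_eq_zero_right this).symm
  · intro x hx; rw [neg_dt]; linarith [h.2.2.2.2 x hx]
  · apply Finset.filter_congr
    intro x hx; rw [neg_dt, neg_inj]

theorem hull_edge {V : Finset (Euc 3)} (hS : Sph V) {v p : Euc 3} (h : Gb V v p)
    (h3 : (Zs V v p).card ≤ 3) : ∃ w : Euc 3, dt w (p - v) = 0 ∧
      ∀ x ∈ V, x ≠ v → x ≠ p → 0 < dt w (x - v) := by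
  have hvV := h.1
  have hpV := h.2.1
  have hg : ∀ x, dt (-(v + p)) (x - v) = 1 + dt v p - dt (v + p) x := by
    intro x
    rw [neg_dt, dt_sub, add_dt v v p, hS v hvV, dt_comm p v]; ring
  have hgp : dt (-(v + p)) (p - v) = 0 := by
    rw [hg, add_dt, hS p hpV]; ring
  have hg0 : ∀ x ∈ V, 0 ≤ dt (-(v + p)) (x - v) := by
    intro x hx; rw [hg]; linarith [h.2.2.2.2 x hx]
  have hgz : ∀ x ∈ V, dt (-(v + p)) (x - v) = 0 → x ∈ Zs V v p := by
    intro x hx h0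
    rw [hg] at h0
    simp only [Zs, Finset.mem_filter]
    exact ⟨hx, by linarith⟩
  by_cases hx0 : ∃ x0 ∈ Zs V v p, x0 ≠ v ∧ x0 ≠ p
  · obtain ⟨x0, hx0, hxv, hxp⟩ := hx0
    have hx0V : x0 ∈ V := (Finset.mem_filter.mp hx0).1
    have hZ : ∀ x ∈ Zs V v p, x = v ∨ x = p ∨ x = x0 := by
      intro x hx
      by_contra hc
      push Not at hc
      have hsub : ({x, v, p, x0} : Finset (Euc 3)) ⊆ Zs V v p := by
        intro y hy
        simp only [Finset.mem_insert, Finset.mem_singleton] at hy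
        rcases hy with rfl | rfl | rfl | rfl
        · exact hx
        · exact h.mem_left hS
        · exact h.mem_right hS
        · exact hx0
      have hc4 : ({x, v, p, x0} : Finset (Euc 3)).card = 4 := by
        rw [Finset.card_insert_of_notMem, Finset.card_insert_of_notMem,
          Finset.card_insert_of_notMem, Finset.card_singleton]
        · simpa using hxp.symm
        · simp only [Finset.mem_insert, Finset.mem_singleton, not_or]
          exact ⟨h.2.2.1, hxv.symm⟩
        · simp only [Finset.mem_insert, Finset.mem_singleton, not_or]
          exact hc
      have := Finset.card_le_card hsub
      omega
    set e := p - v with he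
    set X := x0 - v with hX
    set n := dt e e • X - dt X e • e with hn
    have hne : dt n e = 0 := by
      rw [hn, sub_dt, smul_dt, smul_dt]; ring
    have hnX : 0 < dt n X := by
      have := dt_self_pos (noncol (hS v hvV) (hS p hpV) (hS x0 hx0V) h.2.2.1 hxv.symm hxp.symm)
      have k : dt n X = dt (cr e X) (cr e X) := by
        rw [hn, sub_dt, smul_dt, smul_dt]
        simp [dt, cr]; ring
      rw [k]; exact this
    have hev : ∀ x ∈ V, ∀ᶠ ε : ℝ in nhdsWithin 0 (Set.Ioi 0),
        (x ≠ v → x ≠ p → 0 < dt (-(v + p) + ε • n) (x - v)) := by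
      intro x hx
      by_cases hxz : dt (-(v + p)) (x - v) = 0
      · rcases hZ x (hgz x hx hxz) with h1 | h1 | h1
        · exact Filter.Eventually.of_forall fun ε h2 => absurd h1 h2
        · exact Filter.Eventually.of_forall fun ε _ h2 => absurd h1 h2
        · filter_upwards [self_mem_nhdsWithin] with ε hε _ _
          rw [add_dt, smul_dt, hxz, zero_add, h1]
          exact mul_pos hε hnX
      · have hpos : 0 < dt (-(v + p)) (x - v) := lt_of_le_of_ne (hg0 x hx) (Ne.symm hxz)
        have hcont : Filter.Tendsto (fun ε : ℝ => dt (-(v + p)) (x - v) + ε * dt n (x - v))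
            (nhds 0) (nhds (dt (-(v + p)) (x - v) + 0 * dt n (x - v))) := by
          apply Continuous.tendsto; fun_prop
        rw [zero_mul, add_zero] at hcont
        have := (hcont.mono_left (nhdsWithin_le_nhds (s := Set.Ioi 0))).eventually (lt_mem_nhds hpos)
        filter_upwards [this] with ε hε _ _
        rw [add_dt, smul_dt]; exact hε
    obtain ⟨ε, hε⟩ := ((Filter.eventually_all_finset V).mpr hev).exists
    refine ⟨-(v + p) + ε • n, ?_, hε⟩
    rw [add_dt, smul_dt, hgp, hne]; ring
  · push Not at hx0
    refine ⟨-(v + p), hgp, ?_⟩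
    intro x hx hxv hxp
    refine lt_of_le_of_ne (hg0 x hx) ?_
    intro h0
    exact hxp (hx0 x (hgz x hx h0.symm) hxv)

def LF (V : Finset (Euc 3)) (v p : Euc 3) (F : Finset (Euc 3)) : Prop :=
  IsFace V F ∧ v ∈ F ∧ p ∈ F ∧
    ∀ x ∈ F, x ≠ v → x ≠ p → ∀ y ∈ V, 0 ≤ dd (p - v) (x - v) (y - v)

theorem LF_exists {V : Finset (Euc 3)} (hS : Sph V) {v p : Euc 3} (h : Gb V v p)
    (h3 : (Zs V v p).card ≤ 3) (hV : 3 ≤ V.card) : ∃ F, LF V v p F := by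
  obtain ⟨w, hw0, hw⟩ := hull_edge hS h h3
  have hvV := h.1
  have hpV := h.2.1
  have hne : ((V.erase v).erase p).Nonempty := by
    rw [← Finset.card_pos, Finset.card_erase_of_mem, Finset.card_erase_of_mem hvV]
    · omega
    · exact Finset.mem_erase.mpr ⟨h.2.2.1.symm, hpV⟩
  obtain ⟨q, hq, hmax⟩ := Finset.exists_max_image ((V.erase v).erase p)
    (fun x => dd w (p - v) (x - v) / dt w (x - v)) hne
  simp only [Finset.mem_erase] at hq hmax
  obtain ⟨hqp, hqv, hqV⟩ := hq
  have hgq := hw q hqV hqv hqp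
  have hww : 0 < dt w w := by
    apply dt_self_pos
    rintro rfl
    simp [dt] at hgq
  have hw0' : dt (p - v) w = 0 := by rw [dt_comm]; exact hw0
  have hpos : ∀ x ∈ V, 0 ≤ dd (p - v) (q - v) (x - v) := by
    intro x hx
    by_cases hxv : x = v
    · rw [hxv, sub_self, dd_zero]
    by_cases hxp : x = p
    · rw [hxp, dd_self']
    have hgx := hw x hx hxv hxp
    have hm := hmax x ⟨hxp, hxv, hx⟩
    rw [div_le_div_iff₀ hgx hgq] at hm
    have c := cramer w (p - v) (q - v) (x - v) w
    rw [hw0', dt_comm _ w, dt_comm (q - v) w, ← dd_rot (x - v)] at c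
    by_contra hc
    push Not at hc
    nlinarith
  have hN := noncol (hS v hvV) (hS p hpV) (hS q hqV) h.2.2.1 (Ne.symm hqv) (Ne.symm hqp)
  have hF : IsFace V (V.filter (fun x => dd (p - v) (q - v) (x - v) = 0)) := by
    refine ⟨?_, cr (p - v) (q - v), dt (cr (p - v) (q - v)) v, hN, ?_, ?_⟩
    · have hsub : ({v, p, q} : Finset (Euc 3)) ⊆
          V.filter (fun x => dd (p - v) (q - v) (x - v) = 0) := by
        intro y hy
        simp only [Finset.mem_insert, Finset.mem_singleton] at hy
        rw [Finset.mem_filter]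
        rcases hy with rfl | rfl | rfl
        · exact ⟨hvV, by rw [sub_self, dd_zero]⟩
        · exact ⟨hpV, dd_self' _ _⟩
        · exact ⟨hqV, dd_self _ _⟩
      have := Finset.card_le_card hsub
      rwa [Finset.card_eq_three.mpr ⟨v, p, q, h.2.2.1, Ne.symm hqv, Ne.symm hqp, rfl⟩] at this
    · intro x hx
      have := hpos x hx
      rw [← dt_cr, dt_sub] at this
      linarith
    · apply Finset.filter_congr
      intro x hx
      rw [← dt_cr, dt_sub, sub_eq_zero]
  refine ⟨_, hF, ?_, ?_, ?_⟩
  · exact Finset.mem_filter.mpr ⟨hvV, by rw [sub_self, dd_zero]⟩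
  · exact Finset.mem_filter.mpr ⟨hpV, dd_self' _ _⟩
  · intro x hx hxv hxp y hy
    obtain ⟨hxV, hx0⟩ := Finset.mem_filter.mp hx
    have hgx := hw x hxV hxv hxp
    have c := cramer (p - v) (q - v) (x - v) (y - v) w
    rw [hx0, hw0', dd_swap' (p - v) (x - v) (y - v), dt_comm _ w, dt_comm (q-v) w, dt_comm (x - v) w] at c
    have := hpos y hy
    by_contra hc
    push Not at hc
    nlinarith

def NC (V : Finset (Euc 3)) : Prop :=
  ∀ a ∈ V, ∀ b ∈ V, ∀ c ∈ V, a ≠ b → a ≠ c → b ≠ c → ∃ x ∈ V, dd (b - a) (c - a) (x - a) ≠ 0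

theorem LF_inj {V F : Finset (Euc 3)} (hN : NC V) {v p p' : Euc 3}
    (h : LF V v p F) (h' : LF V v p' F) (hv : v ≠ p) (hv' : v ≠ p') : p = p' := by
  by_contra hne
  have sub := h.1.sub
  obtain ⟨x, hx, hx0⟩ := hN v (sub h.2.1) p (sub h.2.2.1) p' (sub h'.2.2.1) hv hv' hne
  have a := h.2.2.2 p' h'.2.2.1 hv'.symm (Ne.symm hne) x hx
  have b := h'.2.2.2 p h.2.2.1 hv.symm hne x hx
  rw [dd_swap] at b
  exact hx0 (le_antisymm (by linarith) a)

theorem LF_exit {V F F' : Finset (Euc 3)} (hS : Sph V) (hN : NC V) {z v p p' r r' : Euc 3}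
    (h : LF V v p F) (h' : LF V v p' F') (hp : dt z p < dt z v) (hp' : dt z p' < dt z v)
    (hr : r ∈ F) (hr' : r' ∈ F') (hrv : dt z v < dt z r) (hrv' : dt z v < dt z r') : p = p' := by
  have ne : ∀ {a b : Euc 3}, dt z a < dt z b → a ≠ b := by
    rintro a b hab rfl; exact lt_irrefl _ hab
  have sub := h.1.sub
  have sub' := h'.1.sub
  have H := h.2.2.2 r hr (ne hrv).symm (ne (hp.trans hrv)).symm
  have H' := h'.2.2.2 r' hr' (ne hrv').symm (ne (hp'.trans hrv')).symm
  obtain ⟨c1, c2⟩ := core (sub h.2.2.1) (sub hr) (sub' h'.2.2.1) (sub' hr') hp hrv hp' hrv' H H'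
  have e := (face_char hS h.1 h.2.1 h.2.2.1 hr (ne hp).symm (ne hrv) (ne (hp.trans hrv))).1
  have m1 : p' ∈ F := by rw [e]; exact Finset.mem_filter.mpr ⟨sub' h'.2.2.1, c1⟩
  have m2 : r' ∈ F := by rw [e]; exact Finset.mem_filter.mpr ⟨sub' hr', c2⟩
  have := face_unique hS h.1 h'.1 h.2.1 m1 m2 h'.2.1 h'.2.2.1 hr' (ne hp').symm (ne hrv')
    (ne (hp'.trans hrv'))
  subst this
  exact LF_inj hN h h' (ne hp).symm (ne hp').symm

theorem mid_unique {V F F' : Finset (Euc 3)} (hS : Sph V) {z v p p' r r' : Euc 3}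
    (h : IsFace V F) (h' : IsFace V F') (hv : v ∈ F) (hv' : v ∈ F') (hpF : p ∈ F) (hpF' : p' ∈ F')
    (hp : dt z p < dt z v) (hp' : dt z p' < dt z v)
    (hr : r ∈ F) (hr' : r' ∈ F') (hrv : dt z v < dt z r) (hrv' : dt z v < dt z r')
    (H : ∀ x ∈ V, 0 ≤ dd (p - v) (r - v) (x - v))
    (H' : ∀ x ∈ V, 0 ≤ dd (p' - v) (r' - v) (x - v)) : F = F' := by
  have ne : ∀ {a b : Euc 3}, dt z a < dt z b → a ≠ b := by
    rintro a b hab rfl; exact lt_irrefl _ hab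
  have sub := h.sub
  have sub' := h'.sub
  obtain ⟨c1, c2⟩ := core (sub hpF) (sub hr) (sub' hpF') (sub' hr') hp hrv hp' hrv' H H'
  have e := (face_char hS h hv hpF hr (ne hp).symm (ne hrv) (ne (hp.trans hrv))).1
  have m1 : p' ∈ F := by rw [e]; exact Finset.mem_filter.mpr ⟨sub' hpF', c1⟩
  have m2 : r' ∈ F := by rw [e]; exact Finset.mem_filter.mpr ⟨sub' hr', c2⟩
  exact face_unique hS h h' hv m1 m2 hv' hpF' hr' (ne hp').symm (ne hrv')
    (ne (hp'.trans hrv'))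

def faces (V : Finset (Euc 3)) : Finset (Finset (Euc 3)) := V.powerset.filter (IsFace V)

theorem mem_faces {V F : Finset (Euc 3)} : F ∈ faces V ↔ IsFace V F := by
  simp only [faces, Finset.mem_filter, Finset.mem_powerset]
  exact ⟨fun h => h.2, fun h => ⟨h.sub, h⟩⟩

def IsMid (z v : Euc 3) (F : Finset (Euc 3)) : Prop :=
  v ∈ F ∧ (∃ p ∈ F, dt z p < dt z v) ∧ (∃ r ∈ F, dt z v < dt z r)

theorem mid_le_two {V : Finset (Euc 3)} (hS : Sph V) (z v : Euc 3) :
    ((faces V).filter (IsMid z v)).card ≤ 2 := by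
  have ne : ∀ {a b : Euc 3}, dt z a < dt z b → a ≠ b := by
    rintro a b hab rfl; exact lt_irrefl _ hab
  set A := (faces V).filter (fun F => v ∈ F ∧ ∃ p ∈ F, ∃ r ∈ F, dt z p < dt z v ∧ dt z v < dt z r ∧
    ∀ x ∈ V, 0 ≤ dd (p - v) (r - v) (x - v)) with hA
  set B := (faces V).filter (fun F => v ∈ F ∧ ∃ p ∈ F, ∃ r ∈ F, dt z p < dt z v ∧ dt z v < dt z r ∧
    ∀ x ∈ V, dd (p - v) (r - v) (x - v) ≤ 0) with hB
  have hsub : (faces V).filter (IsMid z v) ⊆ A ∪ B := by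
    intro F hF
    rw [Finset.mem_filter] at hF
    obtain ⟨hF, hv, ⟨p, hp, hpv⟩, ⟨r, hr, hrv⟩⟩ := hF
    rw [Finset.mem_union, hA, hB, Finset.mem_filter, Finset.mem_filter]
    rcases (face_char hS (mem_faces.mp hF) hv hp hr (ne hpv).symm (ne hrv) (ne (hpv.trans hrv))).2
      with h | h
    · left; exact ⟨hF, hv, p, hp, r, hr, hpv, hrv, h⟩
    · right; exact ⟨hF, hv, p, hp, r, hr, hpv, hrv, h⟩
  have cA : A.card ≤ 1 := by
    rw [Finset.card_le_one]
    intro F hF F' hF'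
    rw [hA, Finset.mem_filter] at hF hF'
    obtain ⟨hF, hv, p, hp, r, hr, hpv, hrv, h⟩ := hF
    obtain ⟨hF', hv', p', hp', r', hr', hpv', hrv', h'⟩ := hF'
    exact mid_unique hS (mem_faces.mp hF) (mem_faces.mp hF') hv hv' hp hp' hpv hpv' hr hr' hrv hrv'
      h h'
  have cB : B.card ≤ 1 := by
    rw [Finset.card_le_one]
    intro F hF F' hF'
    rw [hB, Finset.mem_filter] at hF hF'
    obtain ⟨hF, hv, p, hp, r, hr, hpv, hrv, h⟩ := hF
    obtain ⟨hF', hv', p', hp', r', hr', hpv', hrv', h'⟩ := hF'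
    refine mid_unique (z := -z) hS (mem_faces.mp hF) (mem_faces.mp hF') hv hv' hr hr' ?_ ?_ hp hp'
      ?_ ?_ ?_ ?_
    any_goals (simp only [neg_dt]; linarith)
    · intro x hx; rw [dd_swap]; linarith [h x hx]
    · intro x hx; rw [dd_swap]; linarith [h' x hx]
  calc _ ≤ (A ∪ B).card := Finset.card_le_card hsub
    _ ≤ A.card + B.card := Finset.card_union_le _ _
    _ ≤ 2 := by omega


theorem ext_dt {a b : Euc 3} (h : ∀ y, dt a y = dt b y) : a = b := by
  have : dt (a - b) (a - b) = 0 := by rw [sub_dt, h]; ring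
  exact sub_eq_zero.mp (dt_self_eq this)

def RD (V : Finset (Euc 3)) (v : Euc 3) (F : Finset (Euc 3)) (p q c : Euc 3) : Prop :=
  Gb V v c ∧ F = Zs V v c ∧ p ∈ F ∧ q ∈ F ∧ p ≠ v ∧ q ≠ v ∧ p ≠ q ∧ dt (p - v) (q - v) = 0

def InS (v p q s : Euc 3) : Prop :=
  ∃ α β l : ℝ, 0 < α ∧ 0 < β ∧ α • (p - v) + β • (q - v) = s + l • v

theorem Gb.npos {V : Finset (Euc 3)} (hS : Sph V) {v c : Euc 3} (h : Gb V v c) :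
    0 < dt (v + c) v := by
  have h1 : v + c ≠ 0 := by
    intro h0
    exact h.2.2.2.1 (neg_eq_of_add_eq_zero_right h0).symm
  have := dt_self_pos h1
  rw [dt_add, add_dt v, add_dt c, hS v h.1, hS c h.2.1, dt_comm c v] at this
  rw [add_dt, hS v h.1, dt_comm c v]; linarith

theorem Gb.nle {V : Finset (Euc 3)} (hS : Sph V) {v c : Euc 3} (h : Gb V v c) :
    ∀ x ∈ V, dt (v + c) (x - v) ≤ 0 := by
  intro x hx
  have := h.2.2.2.2 x hx
  rw [dt_sub, add_dt v v, hS v h.1, dt_comm c v]; linarith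

theorem Gb.nzero {V : Finset (Euc 3)} (hS : Sph V) {v c : Euc 3} (h : Gb V v c) {x : Euc 3}
    (hx : x ∈ V) : x ∈ Zs V v c ↔ dt (v + c) (x - v) = 0 := by
  rw [dt_sub, add_dt v v, hS v h.1, dt_comm c v]
  simp only [Zs, Finset.mem_filter, hx, true_and]
  constructor <;> intro h <;> linarith

theorem RD.face {V F : Finset (Euc 3)} (hS : Sph V) {v p q c : Euc 3} (h : RD V v F p q c) :
    IsFace V F := by
  obtain ⟨hG, rfl, hp, hq, hpv, hqv, hpq, _⟩ := h
  apply hG.face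
  have hsub : ({v, p, q} : Finset (Euc 3)) ⊆ Zs V v c := by
    intro y hy
    simp only [Finset.mem_insert, Finset.mem_singleton] at hy
    rcases hy with rfl | rfl | rfl
    · exact hG.mem_left hS
    · exact hp
    · exact hq
  have := Finset.card_le_card hsub
  rwa [Finset.card_eq_three.mpr ⟨v, p, q, hpv.symm, hqv.symm, hpq, rfl⟩] at this

/-- interior direction of `F` lying on plane of `F'` forces equality -/
theorem RD.eq {V F F' : Finset (Euc 3)} (hS : Sph V) {v p q c p' q' c' : Euc 3}
    (h : RD V v F p q c) (h' : RD V v F' p' q' c') {α β : ℝ} (hα : 0 < α) (hβ : 0 < β)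
    (h0 : dt (v + c') (α • (p - v) + β • (q - v)) = 0) : F = F' := by
  have hf := h.face hS
  have hf' := h'.face hS
  obtain ⟨hG, hZ, hp, hq, hpv, hqv, hpq, _⟩ := h
  obtain ⟨hG', hZ', hp', hq', hpv', hqv', hpq', _⟩ := h'
  have hpV := hf.sub hp
  have hqV := hf.sub hq
  have a := hG'.nle hS p hpV
  have b := hG'.nle hS q hqV
  rw [dt_add, dt_smul, dt_smul] at h0
  have a0 : dt (v + c') (p - v) = 0 := by nlinarith
  have b0 : dt (v + c') (q - v) = 0 := by nlinarith
  have m1 : p ∈ F' := by rw [hZ']; exact (hG'.nzero hS hpV).mpr a0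
  have m2 : q ∈ F' := by rw [hZ']; exact (hG'.nzero hS hqV).mpr b0
  exact face_unique hS hf hf' (by rw [hZ]; exact hG.mem_left hS) hp hq
    (by rw [hZ']; exact hG'.mem_left hS) m1 m2 hpv.symm hqv.symm hpq

theorem RD.orth {V F : Finset (Euc 3)} (hS : Sph V) {v p q c : Euc 3} (h : RD V v F p q c) :
    dt (v + c) (p - v) = 0 ∧ dt (v + c) (q - v) = 0 := by
  have hf := h.face hS
  obtain ⟨hG, hZ, hp, hq, _⟩ := h
  exact ⟨(hG.nzero hS (hf.sub hp)).mp (hZ ▸ hp), (hG.nzero hS (hf.sub hq)).mp (hZ ▸ hq)⟩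

theorem RD.nle {V F F' : Finset (Euc 3)} (hS : Sph V) {v p q c p' q' c' : Euc 3}
    (h : RD V v F p q c) (h' : RD V v F' p' q' c') {α β : ℝ} (hα : 0 < α) (hβ : 0 < β) :
    dt (v + c') (α • (p - v) + β • (q - v)) ≤ 0 := by
  have hf := h.face hS
  have a := h'.1.nle hS p (hf.sub h.2.2.1)
  have b := h'.1.nle hS q (hf.sub h.2.2.2.1)
  rw [dt_add, dt_smul, dt_smul]
  nlinarith

theorem InS_unique {V F F' : Finset (Euc 3)} (hS : Sph V) {v p q c p' q' c' s : Euc 3}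
    (h : RD V v F p q c) (h' : RD V v F' p' q' c') (hs : InS v p q s) (hs' : InS v p' q' s) :
    F = F' := by
  obtain ⟨α, β, l, hα, hβ, hY⟩ := hs
  obtain ⟨α', β', l', hα', hβ', hY'⟩ := hs'
  have n1 := h.1.npos hS
  have n2 := h'.1.npos hS
  have e1 : dt (v + c) (α • (p - v) + β • (q - v)) = 0 := by
    rw [dt_add, dt_smul, dt_smul, (h.orth hS).1, (h.orth hS).2]; ring
  have e2 : dt (v + c') (α' • (p' - v) + β' • (q' - v)) = 0 := by
    rw [dt_add, dt_smul, dt_smul, (h'.orth hS).1, (h'.orth hS).2]; ring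
  have f1 := h'.nle hS h hα' hβ'
  have f2 := h.nle hS h' hα hβ
  apply h.eq hS h' hα hβ
  rw [hY] at e1 f2 ⊢
  rw [hY'] at e2 f1
  rw [dt_add, dt_smul] at *
  have : l' ≤ l := by
    by_contra hc; push Not at hc; nlinarith
  have : l ≤ l' := by
    by_contra hc; push Not at hc; nlinarith
  have : l = l' := by linarith
  rw [this]; exact e2

theorem InS_first {V F F' : Finset (Euc 3)} (hS : Sph V) {v p q c p' q' c' : Euc 3} {k : ℝ}
    (h : RD V v F p q c) (h' : RD V v F' p' q' c') (hs : InS v p' q' (p - v - k • v)) :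
    F' = F ∧ ∃ α β : ℝ, 0 < α ∧ 0 < β ∧ α • (p' - v) + β • (q' - v) = p - v := by
  obtain ⟨α, β, l, hα, hβ, hY⟩ := hs
  have n1 := h.1.npos hS
  have n2 := h'.1.npos hS
  have e1 : dt (v + c') (α • (p' - v) + β • (q' - v)) = 0 := by
    rw [dt_add, dt_smul, dt_smul, (h'.orth hS).1, (h'.orth hS).2]; ring
  have f1 := h'.nle hS h hα hβ
  have f2 := h'.1.nle hS p ((h.face hS).sub h.2.2.1)
  have g := (h.orth hS).1
  have hY2 : α • (p' - v) + β • (q' - v) = (p - v) + (l - k) • v := by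
    rw [hY]; module
  have hl : l - k = 0 := by
    rw [hY2, dt_add, dt_smul] at e1 f1
    rw [g] at f1
    apply le_antisymm
    · by_contra hc; push Not at hc; nlinarith
    · by_contra hc; push Not at hc; nlinarith
  rw [hl, zero_smul, add_zero] at hY2
  refine ⟨h'.eq hS h hα hβ ?_, α, β, hα, hβ, hY2⟩
  rw [hY2, g]

theorem InS_aux {v p q N t : Euc 3} {α β T d μ : ℝ} (hα : 0 < α) (hβ : 0 < β) (hT : 0 < T)
    (hE : p ≠ v) (hEU : dt (p - v) (q - v) = 0) (hN1 : dt N (p - v) = 0) (hN2 : dt N (q - v) = 0)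
    (hNv : 0 < dt N v) (h : T • (α • (p - v) + β • (q - v)) = d • t + μ • v) :
    InS v p q t ∨ InS v p q (-t) := by
  have hd : d ≠ 0 := by
    rintro rfl
    have h1 := congrArg (dt N) h
    simp only [dt_add, dt_smul, hN1, hN2] at h1
    have hμ : μ = 0 := by
      have : μ * dt N v = 0 := by linarith
      rcases mul_eq_zero.mp this with h | h
      · exact h
      · exact absurd h hNv.ne'
    have h2 := congrArg (dt (p - v)) h
    have hEE := dt_self_pos (sub_ne_zero.mpr hE)
    simp only [dt_add (p - v), dt_smul, hEU, hμ] at h2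
    have : 0 < T * (α * dt (p - v) (p - v)) := by positivity
    linarith
  rcases lt_or_gt_of_ne hd with hd | hd
  · right
    refine ⟨T / (-d) * α, T / (-d) * β, μ / (-d), mul_pos (div_pos hT (by linarith)) hα,
      mul_pos (div_pos hT (by linarith)) hβ, ?_⟩
    have : (T / (-d) * α) • (p - v) + (T / (-d) * β) • (q - v) =
      (-d)⁻¹ • (T • (α • (p - v) + β • (q - v))) := by
      rw [div_eq_inv_mul]; module
    rw [this, h, div_eq_inv_mul, smul_add, smul_smul, smul_smul]
    congr 1
    have : (-d)⁻¹ * d = -1 := by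
      have : d ≠ 0 := hd.ne
      field_simp
    rw [this]; simp
  · left
    refine ⟨T / d * α, T / d * β, μ / d, mul_pos (div_pos hT (by linarith)) hα,
      mul_pos (div_pos hT (by linarith)) hβ, ?_⟩
    have : (T / d * α) • (p - v) + (T / d * β) • (q - v) =
      d⁻¹ • (T • (α • (p - v) + β • (q - v))) := by
      rw [div_eq_inv_mul]; module
    rw [this, h, div_eq_inv_mul, smul_add, smul_smul, smul_smul]
    congr 1
    have : d⁻¹ * d = 1 := by
      have : d ≠ 0 := hd.ne'
      field_simp
    rw [this]; simp

theorem decomp {v t : Euc 3} (hv : dt v v = 1) (ht : dt v t = 0) (Y y : Euc 3) :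
    dt t t * dt Y y = dt t t * dt Y v * dt v y + dt Y t * dt t y
      + dt Y (cr v t) * dt (cr v t) y := by
  have c := cramer v t (cr v t) Y y
  have i1 : dd v t (cr v t) = dt v v * dt t t - dt v t * dt v t := by simp [dd, dt, cr]; ring
  have i2 : dd Y t (cr v t) = dt Y v * dt t t - dt Y t * dt v t := by simp [dd, dt, cr]; ring
  have i3 : dd v Y (cr v t) = dt v v * dt Y t - dt v t * dt Y v := by simp [dd, dt, cr]; ring
  rw [i1, i2, i3, ← dt_cr v t Y, hv, ht, dt_comm _ Y] at c
  linarith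

theorem InS_exists {v p q N t : Euc 3} (hv : dt v v = 1) (hp : dt p p = 1) (hq : dt q q = 1)
    (ht : dt v t = 0) (ht0 : t ≠ 0) (hE : p ≠ v) (hU : q ≠ v) (hEU : dt (p - v) (q - v) = 0)
    (hN1 : dt N (p - v) = 0) (hN2 : dt N (q - v) = 0) (hNv : 0 < dt N v) :
    (InS v p q t ∨ InS v p q (-t)) ∨ (InS v p q (cr v t) ∨ InS v p q (-(cr v t))) := by
  have hT := dt_self_pos ht0
  have v1 : dt (p - v) v < 0 := by
    have := dt_self_pos (sub_ne_zero.mpr hE)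
    rw [dt_sub, sub_dt, sub_dt, hp, hv, dt_comm v p] at this
    rw [sub_dt, hv]; linarith
  have v2 : dt v (q - v) < 0 := by
    have := dt_self_pos (sub_ne_zero.mpr hU)
    rw [dt_sub, sub_dt, sub_dt, hq, hv, dt_comm q v] at this
    rw [dt_sub, hv]; linarith
  have key : dt (p - v) t * dt t (q - v) + dt (p - v) (cr v t) * dt (cr v t) (q - v) < 0 := by
    have := decomp hv ht (p - v) (q - v)
    rw [hEU] at this
    have h1 : 0 < dt (p - v) v * dt v (q - v) := mul_pos_of_neg_of_neg v1 v2
    nlinarith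
  have fin : ∀ t' : Euc 3, dt (p - v) t' * dt t' (q - v) < 0 →
      ∃ α β : ℝ, 0 < α ∧ 0 < β ∧ dt (α • (p - v) + β • (q - v)) t' = 0 := by
    intro t' h
    rw [dt_comm t'] at h
    rcases mul_neg_iff.mp h with ⟨h1, h2⟩ | ⟨h1, h2⟩
    · refine ⟨- dt (q - v) t', dt (p - v) t', by linarith, h1, ?_⟩
      rw [add_dt, smul_dt, smul_dt]; ring
    · refine ⟨dt (q - v) t', - dt (p - v) t', by linarith, by linarith, ?_⟩
      rw [add_dt, smul_dt, smul_dt]; ring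
  have dec : ∀ Y : Euc 3, dt t t • Y = (dt t t * dt Y v) • v + dt Y t • t
      + dt Y (cr v t) • cr v t := by
    intro Y
    apply ext_dt
    intro y
    simp only [add_dt, smul_dt]
    exact decomp hv ht Y y
  by_cases h1 : dt (p - v) t * dt t (q - v) < 0
  · right
    obtain ⟨α, β, hα, hβ, h⟩ := fin t h1
    refine InS_aux hα hβ hT hE hEU hN1 hN2 hNv
      (d := dt (α • (p - v) + β • (q - v)) (cr v t))
      (μ := dt t t * dt (α • (p - v) + β • (q - v)) v) ?_
    rw [dec (α • (p - v) + β • (q - v)), h]; module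
  · left
    obtain ⟨α, β, hα, hβ, h⟩ := fin (cr v t) (by linarith)
    refine InS_aux hα hβ hT hE hEU hN1 hN2 hNv
      (d := dt (α • (p - v) + β • (q - v)) t)
      (μ := dt t t * dt (α • (p - v) + β • (q - v)) v) ?_
    rw [dec (α • (p - v) + β • (q - v)), h]; module

theorem rect_le_three {V : Finset (Euc 3)} (hS : Sph V) (v : Euc 3) (S : Finset (Finset (Euc 3)))
    (hR : ∀ F ∈ S, ∃ p q c, RD V v F p q c) : S.card ≤ 3 := by
  rcases S.eq_empty_or_nonempty with rfl | ⟨F1, hF1⟩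
  · simp
  choose! P Q C hRD using hR
  have h1 := hRD F1 hF1
  have hvV := h1.1.1
  have hv := hS v hvV
  set t := P F1 - v - dt v (P F1 - v) • v with ht
  have hvt : dt v t = 0 := by rw [ht, dt_sub, dt_smul, hv]; ring
  have ht0 : t ≠ 0 := by
    intro h0
    have e : P F1 - v = dt v (P F1 - v) • v := sub_eq_zero.mp h0
    have o := (h1.orth hS).1
    rw [e, dt_smul] at o
    have z : dt v (P F1 - v) = 0 := by
      rcases mul_eq_zero.mp o with h | h
      · exact h
      · exact absurd h (h1.1.npos hS).ne'
    rw [z, zero_smul] at e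
    exact h1.2.2.2.2.1 (sub_eq_zero.mp e)
  have uniq : ∀ s, (S.filter (fun F => InS v (P F) (Q F) s)).card ≤ 1 := by
    intro s
    rw [Finset.card_le_one]
    intro F hF F' hF'
    rw [Finset.mem_filter] at hF hF'
    exact InS_unique hS (hRD F hF.1) (hRD F' hF'.1) hF.2 hF'.2
  have nofirst : ∀ F ∈ S, ¬ InS v (P F) (Q F) t := by
    intro F hF hs
    obtain ⟨rfl, α, β, hα, hβ, h⟩ := InS_first hS h1 (hRD F hF) hs
    have h2 := congrArg (dt (Q F - v)) h
    have h3 := (hRD F hF).2.2.2.2.2.2.2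
    have h4 := dt_self_pos (sub_ne_zero.mpr (hRD F hF).2.2.2.2.2.1)
    rw [dt_add, dt_smul, dt_smul, dt_comm (Q F - v) (P F - v), h3] at h2
    have := mul_pos hβ h4
    linarith
  have hsub : S ⊆ S.filter (fun F => InS v (P F) (Q F) (-t)) ∪
      (S.filter (fun F => InS v (P F) (Q F) (cr v t)) ∪
       S.filter (fun F => InS v (P F) (Q F) (-(cr v t)))) := by
    intro F hF
    have hr := hRD F hF
    have sub := (hr.face hS).sub
    have := InS_exists (t := t) hv (hS _ (sub hr.2.2.1)) (hS _ (sub hr.2.2.2.1)) hvt ht0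
      hr.2.2.2.2.1 hr.2.2.2.2.2.1 hr.2.2.2.2.2.2.2 (hr.orth hS).1 (hr.orth hS).2 (hr.1.npos hS)
    simp only [Finset.mem_union, Finset.mem_filter, hF, true_and]
    rcases this with (h | h) | h
    · exact absurd h (nofirst F hF)
    · exact Or.inl h
    · exact Or.inr h
  have a := Finset.card_le_card hsub
  have b := Finset.card_union_le (S.filter (fun F => InS v (P F) (Q F) (-t)))
      (S.filter (fun F => InS v (P F) (Q F) (cr v t)) ∪
       S.filter (fun F => InS v (P F) (Q F) (-(cr v t))))
  have c := Finset.card_union_le (S.filter (fun F => InS v (P F) (Q F) (cr v t)))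
       (S.filter (fun F => InS v (P F) (Q F) (-(cr v t))))
  have := uniq (-t)
  have := uniq (cr v t)
  have := uniq (-(cr v t))
  omega


theorem coplanar_deg {V : Finset (Euc 3)} (hS : Sph V) {w : Euc 3} {k : ℝ} (hw : w ≠ 0)
    (hk : ∀ x ∈ V, dt w x = k) {v : Euc 3} (hv : v ∈ V) :
    (V.filter (fun p => Gb V v p)).card ≤ 3 := by
  have hww := dt_self_pos hw
  set S := V.filter (fun p => Gb V v p) with hSd
  set A := S.filter (fun p => ∀ y, dt w w * dt (v + p) y = dt w (v + p) * dt w y) with hA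
  set B := S.filter (fun p => ¬ ∀ y, dt w w * dt (v + p) y = dt w (v + p) * dt w y) with hB
  have hAB : S.card = A.card + B.card := by
    rw [hA, hB, Finset.card_filter_add_card_filter_not]
  have cA : A.card ≤ 1 := by
    rw [Finset.card_le_one]
    intro p hp q hq
    rw [hA, Finset.mem_filter, hSd, Finset.mem_filter] at hp hq
    have : v + p = v + q := by
      apply ext_dt
      intro y
      have a := hp.2 y
      have b := hq.2 y
      rw [dt_add, hk v hv, hk p hp.1.1] at a
      rw [dt_add, hk v hv, hk q hq.1.1] at b
      exact mul_left_cancel₀ hww.ne' (a.trans b.symm)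
    exact add_left_cancel this
  have cB : B.card ≤ 2 := by
    by_contra hc
    push Not at hc
    rw [Finset.two_lt_card] at hc
    obtain ⟨p1, h1, p2, h2, p3, h3, h12, h13, h23⟩ := hc
    rw [hB, Finset.mem_filter, hSd, Finset.mem_filter] at h1 h2 h3
    have wE : ∀ p ∈ V, dt w (p - v) = 0 := by
      intro p hp; rw [dt_sub, hk p hp, hk v hv, sub_self]
    have nz : ∀ p q, p ∈ V → q ∈ V → v ≠ p → v ≠ q → p ≠ q → dd w (p - v) (q - v) ≠ 0 := by
      intro p q hp hq hvp hvq hpq h0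
      have hN := dt_self_pos (noncol (hS v hv) (hS p hp) (hS q hq) hvp hvq hpq)
      have id : dt (cr (p - v) (q - v)) (cr (p - v) (q - v)) * dt w w =
          dd w (p - v) (q - v) ^ 2 + dt w (p - v) * (dt (q - v) (q - v) * dt w (p - v) -
            dt (p - v) (q - v) * dt w (q - v)) + dt w (q - v) * (dt (p - v) (p - v) * dt w (q - v)
            - dt (p - v) (q - v) * dt w (p - v)) := by
        generalize p - v = e
        generalize q - v = u
        simp [dt, cr, dd]; ring
      rw [h0, wE p hp, wE q hq] at id
      have := mul_pos hN hww
      linarith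
    have sg : ∀ p, p ∈ V → Gb V v p →
        (¬ ∀ y, dt w w * dt (v + p) y = dt w (v + p) * dt w y) →
        ∃ m : ℝ, ∀ q ∈ V, q ≠ v → q ≠ p → dd w (p - v) (q - v) * m < 0 := by
      intro p hp hG hn
      have E0 := dt_self_pos (sub_ne_zero.mpr hG.2.2.1.symm)
      have i1 : dd w (p - v) (cr w (p - v)) = dt w w * dt (p - v) (p - v) := by
        have : dd w (p - v) (cr w (p - v)) = dt w w * dt (p - v) (p - v)
          - dt w (p - v) * dt w (p - v) := by simp [dd, dt, cr]; ring
        rw [this, wE p hp]; ring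
      have i2 : ∀ Y, dd Y (p - v) (cr w (p - v)) = dt Y w * dt (p - v) (p - v) := by
        intro Y
        have : dd Y (p - v) (cr w (p - v)) = dt Y w * dt (p - v) (p - v)
          - dt Y (p - v) * dt w (p - v) := by simp [dd, dt, cr]; ring
        rw [this, wE p hp]; ring
      have o : dt (v + p) (p - v) = 0 := (hG.nzero hS hp).mp (hG.mem_right hS)
      have hm0 : dt (cr w (p - v)) (v + p) ≠ 0 := by
        intro h0
        apply hn
        intro y
        have c := cramer w (p - v) (cr w (p - v)) (v + p) y
        have i3 : dd w (v + p) (cr w (p - v)) = dt w w * dt (v + p) (p - v) -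
          dt w (p - v) * dt w (v + p) := by simp [dd, dt, cr]; ring
        rw [i1, i2, i3, o, wE p hp, ← dt_cr w (p - v) (v + p), h0, dt_comm (v + p) w] at c
        apply mul_left_cancel₀ E0.ne'
        linarith
      refine ⟨dt (cr w (p - v)) (v + p), ?_⟩
      intro q hq hqv hqp
      have c := cramer w (p - v) (cr w (p - v)) (q - v) (v + p)
      rw [i1, i2, dt_comm (p - v) (v + p), o, dt_comm (q - v) w, wE q hq] at c
      have nle := hG.nle hS q hq
      rw [dt_comm] at nle
      have nn : dd w (p - v) (q - v) * dt (cr w (p - v)) (v + p) ≠ 0 :=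
        mul_ne_zero (nz p q hp hq hG.2.2.1 (Ne.symm hqv) (Ne.symm hqp)) hm0
      refine lt_of_le_of_ne ?_ nn
      have := mul_pos hww E0
      nlinarith
    obtain ⟨⟨h1V, h1G⟩, h1n⟩ := h1
    obtain ⟨⟨h2V, h2G⟩, h2n⟩ := h2
    obtain ⟨⟨h3V, h3G⟩, h3n⟩ := h3
    obtain ⟨m1, k1⟩ := sg p1 h1V h1G h1n
    obtain ⟨m2, k2⟩ := sg p2 h2V h2G h2n
    obtain ⟨m3, k3⟩ := sg p3 h3V h3G h3n
    have v1 := h1G.2.2.1.symm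
    have v2 := h2G.2.2.1.symm
    have v3 := h3G.2.2.1.symm
    have a12 := k1 p2 h2V v2 h12.symm
    have a13 := k1 p3 h3V v3 h13.symm
    have a21 := k2 p1 h1V v1 h12
    have a23 := k2 p3 h3V v3 h23.symm
    have a31 := k3 p1 h1V v1 h13
    have a32 := k3 p2 h2V v2 h23
    rw [dd_swap' w (p1 - v) (p2 - v)] at a21
    rw [dd_swap' w (p1 - v) (p3 - v)] at a31
    rw [dd_swap' w (p2 - v) (p3 - v)] at a32
    generalize dd w (p1 - v) (p2 - v) = x at *
    generalize dd w (p1 - v) (p3 - v) = y at *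
    generalize dd w (p2 - v) (p3 - v) = z at *
    rcases mul_neg_iff.mp a12 with ⟨_, _⟩ | ⟨_, _⟩ <;>
    rcases mul_neg_iff.mp a13 with ⟨_, _⟩ | ⟨_, _⟩ <;>
    rcases mul_neg_iff.mp a21 with ⟨_, _⟩ | ⟨_, _⟩ <;>
    rcases mul_neg_iff.mp a23 with ⟨_, _⟩ | ⟨_, _⟩ <;>
    rcases mul_neg_iff.mp a31 with ⟨_, _⟩ | ⟨_, _⟩ <;>
    rcases mul_neg_iff.mp a32 with ⟨_, _⟩ | ⟨_, _⟩ <;> linarith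
  omega

theorem exists_z (V : Finset (Euc 3)) : ∃ z : Euc 3, ∀ x ∈ V, ∀ y ∈ V, dt z x = dt z y → x = y := by
  obtain ⟨f, hf⟩ := Module.exists_dual_forall_apply_ne_zero (K := ℝ) (M := Euc 3)
    (ι := {xy : V × V // xy.1 ≠ xy.2}) (fun i => (i.1.1 : Euc 3) - i.1.2)
    (fun i h => i.2 (Subtype.ext (sub_eq_zero.mp h)))
  refine ⟨!₂[f (EuclideanSpace.single 0 1), f (EuclideanSpace.single 1 1),
    f (EuclideanSpace.single 2 1)], ?_⟩
  have hz : ∀ x : Euc 3, dt (!₂[f (EuclideanSpace.single 0 1), f (EuclideanSpace.single 1 1),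
    f (EuclideanSpace.single 2 1)]) x = f x := by
    intro x
    have hx : x = x 0 • EuclideanSpace.single 0 1 + x 1 • EuclideanSpace.single 1 1 +
        x 2 • EuclideanSpace.single 2 1 := by
      apply ext3 <;> simp
    conv_rhs => rw [hx]
    simp only [map_add, map_smul, dt, smul_eq_mul]
    simp; ring
  intro x hx y hy h
  rw [hz, hz] at h
  by_contra hne
  apply hf ⟨(⟨x, hx⟩, ⟨y, hy⟩), by simpa using hne⟩
  simp [h]

def FTop (z v : Euc 3) (F : Finset (Euc 3)) : Prop := v ∈ F ∧ ∀ x ∈ F, dt z x ≤ dt z v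

def InnerPt (V : Finset (Euc 3)) (z v : Euc 3) : Prop :=
  (∃ p ∈ V, dt z p < dt z v) ∧ (∃ r ∈ V, dt z v < dt z r)

theorem down_le {V : Finset (Euc 3)} (hS : Sph V) (hN : NC V) (hV : 3 ≤ V.card) (z v : Euc 3)
    (S : Finset (Euc 3))
    (hSd : ∀ p ∈ S, Gb V v p ∧ dt z p < dt z v ∧ (Zs V v p).card ≤ 3) :
    S.card ≤ ((faces V).filter (FTop z v)).card + (if InnerPt V z v then 1 else 0) := by
  have hex : ∀ p ∈ S, ∃ F, LF V v p F := fun p hp =>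
    LF_exists hS (hSd p hp).1 (hSd p hp).2.2 hV
  choose! φ hφ using hex
  set A := S.filter (fun p => FTop z v (φ p)) with hA
  set B := S.filter (fun p => ¬ FTop z v (φ p)) with hB
  have hAB : S.card = A.card + B.card := by
    rw [hA, hB, Finset.card_filter_add_card_filter_not]
  have cA : A.card ≤ ((faces V).filter (FTop z v)).card := by
    apply Finset.card_le_card_of_injOn φ
    · intro p hp
      have hp' := Finset.mem_filter.mp (Finset.mem_coe.mp hp)
      exact Finset.mem_coe.mpr (Finset.mem_filter.mpr ⟨mem_faces.mpr (hφ p hp'.1).1, hp'.2⟩)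
    · intro p hp q hq hpq
      have hp' := (Finset.mem_filter.mp (Finset.mem_coe.mp hp)).1
      have hq' := (Finset.mem_filter.mp (Finset.mem_coe.mp hq)).1
      have h1 := hφ p hp'
      have h2 := hφ q hq'
      simp only [hpq] at h1
      exact LF_inj hN h1 h2 (hSd p hp').1.2.2.1 (hSd q hq').1.2.2.1
  have up : ∀ p ∈ B, ∃ r ∈ φ p, dt z v < dt z r := by
    intro p hp
    rw [hB, Finset.mem_filter] at hp
    have := hp.2
    unfold FTop at this
    push Not at this
    exact this (hφ p hp.1).2.1
  have cB : B.card ≤ if InnerPt V z v then 1 else 0 := by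
    split_ifs with hI
    · rw [Finset.card_le_one]
      intro p hp q hq
      obtain ⟨r, hr, hrv⟩ := up p hp
      obtain ⟨r', hr', hrv'⟩ := up q hq
      have hp := (Finset.mem_filter.mp hp).1
      have hq := (Finset.mem_filter.mp hq).1
      exact LF_exit hS hN (hφ p hp) (hφ q hq) (hSd p hp).2.1 (hSd q hq).2.1 hr hr' hrv hrv'
    · rw [Nat.le_zero, Finset.card_eq_zero, Finset.eq_empty_iff_forall_notMem]
      intro p hp
      apply hI
      obtain ⟨r, hr, hrv⟩ := up p hp
      have hp := (Finset.mem_filter.mp hp).1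
      exact ⟨⟨p, (hSd p hp).1.2.1, (hSd p hp).2.1⟩, ⟨r, (hφ p hp).1.sub hr, hrv⟩⟩
  omega

theorem sum_innerPt {V : Finset (Euc 3)} (hV : 3 ≤ V.card) {z : Euc 3}
    (hz : ∀ x ∈ V, ∀ y ∈ V, dt z x = dt z y → x = y) :
    ∑ v ∈ V, (if InnerPt V z v then 1 else 0) ≤ V.card - 2 := by
  rw [← Finset.card_filter]
  have hne : V.Nonempty := Finset.card_pos.mp (by omega)
  obtain ⟨m, hm, hmax⟩ := Finset.exists_max_image V (dt z) hne
  obtain ⟨b, hb, hmin⟩ := Finset.exists_min_image V (dt z) hne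
  have hmb : b ≠ m := by
    rintro rfl
    have : V.card ≤ 1 := by
      rw [Finset.card_le_one]
      intro x hx y hy
      apply hz x hx y hy
      have := hmax x hx
      have := hmax y hy
      have := hmin x hx
      have := hmin y hy
      linarith
    omega
  have hsub : V.filter (fun v => InnerPt V z v) ⊆ (V.erase m).erase b := by
    intro v hv
    rw [Finset.mem_filter] at hv
    obtain ⟨hv, ⟨p, hp, hpv⟩, ⟨r, hr, hrv⟩⟩ := hv
    rw [Finset.mem_erase, Finset.mem_erase]
    refine ⟨?_, ?_, hv⟩
    · rintro rfl; linarith [hmin p hp]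
    · rintro rfl; linarith [hmax r hr]
  have := Finset.card_le_card hsub
  rw [Finset.card_erase_of_mem (Finset.mem_erase.mpr ⟨hmb, hb⟩), Finset.card_erase_of_mem hm] at this
  omega

theorem sum_top {V : Finset (Euc 3)} {z : Euc 3}
    (hz : ∀ x ∈ V, ∀ y ∈ V, dt z x = dt z y → x = y) :
    ∑ v ∈ V, ((faces V).filter (FTop z v)).card ≤ (faces V).card := by
  have := Finset.sum_card_bipartiteAbove_eq_sum_card_bipartiteBelow (s := V) (t := faces V)
    (FTop z)
  unfold Finset.bipartiteAbove Finset.bipartiteBelow at this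
  rw [this, Finset.card_eq_sum_ones]
  apply Finset.sum_le_sum
  intro F hF
  rw [Finset.card_le_one]
  intro x hx y hy
  rw [Finset.mem_filter] at hx hy
  exact hz x hx.1 y hy.1 (le_antisymm (hy.2.2 x hx.2.1) (hx.2.2 y hy.2.1))

theorem sum_face {V : Finset (Euc 3)} (hS : Sph V) (hV : 3 ≤ V.card) {z : Euc 3}
    (hz : ∀ x ∈ V, ∀ y ∈ V, dt z x = dt z y → x = y) :
    ∑ F ∈ faces V, F.card ≤ 2 * (faces V).card + 2 * (V.card - 2) := by
  have h1 : ∀ F ∈ faces V, F.card ≤ 2 + (V.filter (fun v => IsMid z v F)).card := by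
    intro F hF
    have hF := mem_faces.mp hF
    have hne : F.Nonempty := Finset.card_pos.mp (by have := hF.1; omega)
    obtain ⟨m, hm, hmax⟩ := Finset.exists_max_image F (dt z) hne
    obtain ⟨b, hb, hmin⟩ := Finset.exists_min_image F (dt z) hne
    have hsub : F ⊆ {m, b} ∪ V.filter (fun v => IsMid z v F) := by
      intro x hx
      rw [Finset.mem_union, Finset.mem_filter]
      by_cases h1 : x = m
      · left; simp [h1]
      by_cases h2 : x = b
      · left; simp [h2]
      right
      refine ⟨hF.sub hx, hx, ⟨b, hb, lt_of_le_of_ne (hmin x hx) ?_⟩,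
        ⟨m, hm, lt_of_le_of_ne (hmax x hx) ?_⟩⟩
      · intro h; exact h2 (hz b (hF.sub hb) x (hF.sub hx) h).symm
      · intro h; exact h1 (hz x (hF.sub hx) m (hF.sub hm) h)
    have a := Finset.card_le_card hsub
    have b' := Finset.card_union_le ({m, b} : Finset (Euc 3)) (V.filter (fun v => IsMid z v F))
    have c : ({m, b} : Finset (Euc 3)).card ≤ 2 := Finset.card_le_two
    omega
  have h2 : ∑ v ∈ V, ((faces V).filter (IsMid z v)).card =
      ∑ F ∈ faces V, (V.filter (fun v => IsMid z v F)).card := by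
    convert Finset.sum_card_bipartiteAbove_eq_sum_card_bipartiteBelow (s := V) (t := faces V)
      (IsMid z)
    all_goals (ext; simp [Finset.bipartiteAbove, Finset.bipartiteBelow])
  have h3 : ∑ v ∈ V, ((faces V).filter (IsMid z v)).card ≤
      ∑ v ∈ V, 2 * (if InnerPt V z v then 1 else 0) := by
    apply Finset.sum_le_sum
    intro v hv
    split_ifs with hI
    · exact mid_le_two hS z v
    · rw [mul_zero, Nat.le_zero, Finset.card_eq_zero, Finset.eq_empty_iff_forall_notMem]
      intro F hF
      rw [Finset.mem_filter, mem_faces] at hF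
      obtain ⟨hF, _, ⟨p, hp, hpv⟩, ⟨r, hr, hrv⟩⟩ := hF
      exact hI ⟨⟨p, hF.sub hp, hpv⟩, ⟨r, hF.sub hr, hrv⟩⟩
  rw [← Finset.mul_sum] at h3
  have h4 := sum_innerPt hV hz
  have h5 := Finset.sum_le_sum h1
  rw [Finset.sum_add_distrib, Finset.sum_const, smul_eq_mul, ← h2] at h5
  omega

def IsRect (V F : Finset (Euc 3)) : Prop :=
  F.card = 4 ∧ ∃ a b c d, Gb V a c ∧ Gb V b d ∧ Zs V a c = F ∧ Zs V b d = F ∧ a ≠ b ∧ a ≠ d ∧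
    a + c = b + d

theorem diam_eq {V : Finset (Euc 3)} (hS : Sph V) {a b c d : Euc 3} (h : Gb V a c)
    (h' : Gb V b d) (he : Zs V a c = Zs V b d) : a + c = b + d := by
  have m1 := h.mem_left hS
  have m2 := h.mem_right hS
  have m3 := h'.mem_left hS
  have m4 := h'.mem_right hS
  rw [he] at m1 m2
  rw [← he] at m3 m4
  simp only [Zs, Finset.mem_filter] at m1 m2 m3 m4
  have : dt ((a + c) - (b + d)) ((a + c) - (b + d)) = 0 := by
    have e1 := m1.2
    have e2 := m2.2
    have e3 := m3.2
    have e4 := m4.2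
    have sa := hS a h.1
    have sb := hS b h'.1
    have sc := hS c h.2.1
    have sd := hS d h'.2.1
    simp only [dt_sub, sub_dt, dt_add, add_dt, sa, sb, sc, sd, dt_comm b a, dt_comm c a,
      dt_comm d a, dt_comm c b, dt_comm d b, dt_comm d c] at *
    linarith
  exact sub_eq_zero.mp (dt_self_eq this)

theorem IsRect.RD {V F : Finset (Euc 3)} (hS : Sph V) (h : IsRect V F) {v : Euc 3} (hv : v ∈ F) :
    ∃ p q c, RD V v F p q c := by
  obtain ⟨h4, a, b, c, d, hac, hbd, hF, hF', hab, had, hs⟩ := h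
  have aF : a ∈ F := hF ▸ hac.mem_left hS
  have cF : c ∈ F := hF ▸ hac.mem_right hS
  have bF : b ∈ F := hF' ▸ hbd.mem_left hS
  have dF : d ∈ F := hF' ▸ hbd.mem_right hS
  have hcb : c ≠ b := by
    rintro rfl
    rw [add_comm] at hs
    exact had (add_left_cancel hs)
  have hcd : c ≠ d := by
    rintro rfl
    exact hab (add_right_cancel hs)
  have sub : ({a, b, c, d} : Finset (Euc 3)) ⊆ F := by
    intro y hy
    simp only [Finset.mem_insert, Finset.mem_singleton] at hy
    rcases hy with rfl | rfl | rfl | rfl <;> assumption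
  have hc4 : ({a, b, c, d} : Finset (Euc 3)).card = 4 := by
    rw [Finset.card_insert_of_notMem, Finset.card_insert_of_notMem,
      Finset.card_insert_of_notMem, Finset.card_singleton]
    · simpa using hcd
    · simp only [Finset.mem_insert, Finset.mem_singleton, not_or]
      exact ⟨hcb.symm, hbd.2.2.1⟩
    · simp only [Finset.mem_insert, Finset.mem_singleton, not_or]
      exact ⟨hab, hac.2.2.1, had⟩
  have hFe := Finset.eq_of_subset_of_card_le sub (by omega)
  have orth : ∀ {x y u : Euc 3}, Gb V x y → u ∈ Zs V x y → dt (x - u) (y - u) = 0 := by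
    intro x y u hG hu
    rw [Zs, Finset.mem_filter] at hu
    have e := hu.2
    have su := hS u hu.1
    simp only [dt_sub, sub_dt, add_dt, su, dt_comm u x] at *
    rw [dt_comm u y]; linarith
  rw [← hFe] at hv
  simp only [Finset.mem_insert, Finset.mem_singleton] at hv
  rcases hv with rfl | rfl | rfl | rfl
  · exact ⟨b, d, c, hac, hF.symm, bF, dF, hab.symm, had.symm, hbd.2.2.1, orth hbd (hF' ▸ aF)⟩
  · exact ⟨a, c, d, hbd, hF'.symm, aF, cF, hab, hcb, hac.2.2.1, orth hac (hF ▸ bF)⟩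
  · exact ⟨b, d, a, hac.symm, by rw [Zs_symm, hF], bF, dF, hcb.symm, hcd.symm, hbd.2.2.1,
      orth hbd (hF' ▸ cF)⟩
  · exact ⟨a, c, b, hbd.symm, by rw [Zs_symm, hF'], aF, cF, had, hcd, hac.2.2.1,
      orth hac (hF ▸ dF)⟩

theorem rect_count {V : Finset (Euc 3)} (hS : Sph V) :
    4 * ((faces V).filter (IsRect V)).card ≤ 3 * V.card := by
  have h2 : ∑ v ∈ V, (((faces V).filter (IsRect V)).filter (fun F => v ∈ F)).card =
      ∑ F ∈ (faces V).filter (IsRect V), (V.filter (fun v => v ∈ F)).card := by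
    convert Finset.sum_card_bipartiteAbove_eq_sum_card_bipartiteBelow (s := V)
      (t := (faces V).filter (IsRect V)) (fun v F => v ∈ F)
    all_goals (ext; simp [Finset.bipartiteAbove, Finset.bipartiteBelow])
  have h3 : ∑ v ∈ V, (((faces V).filter (IsRect V)).filter (fun F => v ∈ F)).card ≤ ∑ v ∈ V, 3 := by
    apply Finset.sum_le_sum
    intro v hv
    apply rect_le_three hS v
    intro F hF
    rw [Finset.mem_filter, Finset.mem_filter] at hF
    exact hF.1.2.RD hS hF.2
  have h4 : ∑ F ∈ (faces V).filter (IsRect V), 4 ≤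
      ∑ F ∈ (faces V).filter (IsRect V), (V.filter (fun v => v ∈ F)).card := by
    apply Finset.sum_le_sum
    intro F hF
    rw [Finset.mem_filter, mem_faces] at hF
    rw [← hF.2.1]
    apply Finset.card_le_card
    intro x hx
    exact Finset.mem_filter.mpr ⟨hF.1.sub hx, hx⟩
  rw [Finset.sum_const, smul_eq_mul] at h3 h4
  omega

theorem diam_count {V F : Finset (Euc 3)} (hS : Sph V) (z : Euc 3) (D : Finset (Euc 3 × Euc 3))
    (hD : ∀ e ∈ D, Gb V e.1 e.2 ∧ dt z e.2 < dt z e.1 ∧ 4 ≤ (Zs V e.1 e.2).card ∧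
      Zs V e.1 e.2 = F) (h3 : 3 ≤ F.card) :
    D.card + 3 ≤ F.card + if IsRect V F then 1 else 0 := by
  rcases D.eq_empty_or_nonempty with rfl | ⟨e0, he0⟩
  · simp; omega
  have hF4 : 4 ≤ F.card := by
    have := (hD e0 he0).2.2
    rw [this.2] at this; exact this.1
  have heq : ∀ e ∈ D, ∀ e' ∈ D, e.1 + e.2 = e'.1 + e'.2 := by
    intro e he e' he'
    exact diam_eq hS (hD e he).1 (hD e' he').1 ((hD e he).2.2.2.trans (hD e' he').2.2.2.symm)
  have i1 : (D.image Prod.fst).card = D.card := by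
    apply Finset.card_image_of_injOn
    intro e he e' he' h
    have := heq e he e' he'
    rw [h] at this
    exact Prod.ext h (add_left_cancel this)
  have i2 : (D.image Prod.snd).card = D.card := by
    apply Finset.card_image_of_injOn
    intro e he e' he' h
    have := heq e he e' he'
    rw [h] at this
    exact Prod.ext (add_right_cancel this) h
  have cross : ∀ e ∈ D, ∀ e' ∈ D, e.1 ≠ e'.2 := by
    intro e he e' he' h
    have := heq e he e' he'
    rw [h, add_comm] at this
    have h2 := add_right_cancel this
    have a := (hD e he).2.1
    have b := (hD e' he').2.1
    rw [h, h2] at a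
    linarith
  have hdis : Disjoint (D.image Prod.fst) (D.image Prod.snd) := by
    rw [Finset.disjoint_left]
    intro x hx hy
    obtain ⟨e, he, rfl⟩ := Finset.mem_image.mp hx
    obtain ⟨e', he', h⟩ := Finset.mem_image.mp hy
    exact cross e he e' he' h.symm
  have hsub : D.image Prod.fst ∪ D.image Prod.snd ⊆ F := by
    intro x hx
    rcases Finset.mem_union.mp hx with hx | hx
    · obtain ⟨e, he, rfl⟩ := Finset.mem_image.mp hx
      rw [← (hD e he).2.2.2]; exact (hD e he).1.mem_left hS
    · obtain ⟨e, he, rfl⟩ := Finset.mem_image.mp hx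
      rw [← (hD e he).2.2.2]; exact (hD e he).1.mem_right hS
  have hc := Finset.card_le_card hsub
  rw [Finset.card_union_of_disjoint hdis, i1, i2] at hc
  split_ifs with hR
  · omega
  · by_cases h2 : 1 < D.card
    · by_cases h4 : F.card = 4
      · exfalso
        apply hR
        obtain ⟨e, he, e', he', hne⟩ := Finset.one_lt_card.mp h2
        refine ⟨h4, e.1, e'.1, e.2, e'.2, (hD e he).1, (hD e' he').1, (hD e he).2.2.2,
          (hD e' he').2.2.2, ?_, cross e he e' he', heq e he e' he'⟩
        intro h
        have := heq e he e' he'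
        rw [h] at this
        exact hne (Prod.ext h (add_left_cancel this))
      · omega
    · omega

theorem nc_bound {V : Finset (Euc 3)} (hS : Sph V) (hN : NC V) (hV : 3 ≤ V.card) {z : Euc 3}
    (hz : ∀ x ∈ V, ∀ y ∈ V, dt z x = dt z y → x = y) :
    4 * ((V ×ˢ V).filter (fun e => Gb V e.1 e.2 ∧ dt z e.2 < dt z e.1)).card + 24
      ≤ 15 * V.card := by
  set D := (V ×ˢ V).filter (fun e => Gb V e.1 e.2 ∧ dt z e.2 < dt z e.1) with hD
  set A := D.filter (fun e => (Zs V e.1 e.2).card ≤ 3) with hA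
  set B := D.filter (fun e => ¬ (Zs V e.1 e.2).card ≤ 3) with hB
  have hAB : D.card = A.card + B.card := by
    rw [hA, hB, Finset.card_filter_add_card_filter_not]
  have memD : ∀ e ∈ D, Gb V e.1 e.2 ∧ dt z e.2 < dt z e.1 := fun e he =>
    (Finset.mem_filter.mp he).2
  have cA : A.card ≤ (faces V).card + (V.card - 2) := by
    have h1 := Finset.card_eq_sum_card_fiberwise (s := A) (t := V) (f := Prod.fst) (by
      intro e he
      have := Finset.mem_filter.mp (Finset.mem_coe.mp he)
      exact (memD e this.1).1.1)
    have h2 : ∑ v ∈ V, (A.filter (fun e => e.1 = v)).card ≤ ∑ v ∈ V,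
        (((faces V).filter (FTop z v)).card + (if InnerPt V z v then 1 else 0)) := by
      apply Finset.sum_le_sum
      intro v hv
      have i : ((A.filter (fun e => e.1 = v)).image Prod.snd).card =
          (A.filter (fun e => e.1 = v)).card := by
        apply Finset.card_image_of_injOn
        intro e he e' he' h
        have h1 := (Finset.mem_filter.mp (Finset.mem_coe.mp he)).2
        have h2 := (Finset.mem_filter.mp (Finset.mem_coe.mp he')).2
        exact Prod.ext (h1.trans h2.symm) h
      rw [← i]
      apply down_le hS hN hV z v
      intro p hp
      obtain ⟨e, he, rfl⟩ := Finset.mem_image.mp hp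
      obtain ⟨hf, rfl⟩ := Finset.mem_filter.mp he
      obtain ⟨hg, h3⟩ := Finset.mem_filter.mp hf
      exact ⟨(memD e hg).1, (memD e hg).2, h3⟩
    rw [Finset.sum_add_distrib] at h2
    have h3 := sum_innerPt hV hz
    have h4 := sum_top hz
    rw [h1]
    omega
  have cB : B.card + 3 * (faces V).card ≤ ∑ F ∈ faces V, F.card +
      ((faces V).filter (IsRect V)).card := by
    have h1 := Finset.card_eq_sum_card_fiberwise (s := B) (t := faces V)
      (f := fun e => Zs V e.1 e.2) (by
      intro e he
      have := Finset.mem_filter.mp (Finset.mem_coe.mp he)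
      exact mem_faces.mpr ((memD e this.1).1.face (by have := this.2; omega)))
    have h2 : ∑ F ∈ faces V, ((B.filter (fun e => Zs V e.1 e.2 = F)).card + 3) ≤
        ∑ F ∈ faces V, (F.card + if IsRect V F then 1 else 0) := by
      apply Finset.sum_le_sum
      intro F hF
      apply diam_count hS z _ _ (mem_faces.mp hF).1
      intro e he
      obtain ⟨he, hF⟩ := Finset.mem_filter.mp he
      obtain ⟨he, h3⟩ := Finset.mem_filter.mp he
      exact ⟨(memD e he).1, (memD e he).2, by omega, hF⟩
    have h7 : ((faces V).filter (IsRect V)).card = ∑ F ∈ faces V, if IsRect V F then 1 else 0 := by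
      convert Finset.card_filter (IsRect V) (faces V)
    have h8 : B.card = ∑ F ∈ faces V, (B.filter (fun e => Zs V e.1 e.2 = F)).card := by
      convert h1
    rw [Finset.sum_add_distrib, Finset.sum_add_distrib, Finset.sum_const, smul_eq_mul,
      ← h7, ← h8] at h2
    omega
  have h5 := sum_face hS hV hz
  have h6 := rect_count hS
  omega

/-- The weak Gabriel graph of a set of `n ≥ 2` points on the unit sphere has at most
`(15/4)n - 6` edges. -/
theorem weakGabriel_upper_bound (V : Finset (Euc 3)) (hV : ∀ v ∈ V, ‖v‖ = 1)
    (hcard : 2 ≤ V.card) :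
    (numWeakGabriel V : ℝ) ≤ 15 / 4 * V.card - 6 := by
  have hS : Sph V := by
    intro v hv
    rw [← inner_dt, real_inner_self_eq_norm_sq, hV v hv]; norm_num
  have key : 4 * numWeakGabriel V + 24 ≤ 15 * V.card := by
    unfold numWeakGabriel
    have hE : ((V ×ˢ V).filter fun pq => IsWeakGabrielEdge V pq.1 pq.2) =
        (V ×ˢ V).filter (fun e => Gb V e.1 e.2) := by
      apply Finset.filter_congr
      intro e _; exact Gb_iff hS _ _
    rw [hE]
    obtain ⟨z, hz⟩ := exists_z V
    rcases Nat.lt_or_ge V.card 3 with h2 | h3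
    · have hsub : (V ×ˢ V).filter (fun e => Gb V e.1 e.2) ⊆ V.offDiag := by
        intro e he
        rw [Finset.mem_filter] at he
        exact Finset.mem_offDiag.mpr ⟨he.2.1, he.2.2.1, he.2.2.2.1⟩
      have := Finset.card_le_card hsub
      rw [Finset.offDiag_card] at this
      have h2 : V.card = 2 := by omega
      rw [h2] at this ⊢
      omega
    by_cases hN : NC V
    · have hb := nc_bound hS hN h3 hz
      set D := (V ×ˢ V).filter (fun e => Gb V e.1 e.2 ∧ dt z e.2 < dt z e.1) with hD
      have hsub : (V ×ˢ V).filter (fun e => Gb V e.1 e.2) ⊆ D ∪ D.image Prod.swap := by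
        intro e he
        rw [Finset.mem_filter, Finset.mem_product] at he
        obtain ⟨⟨h1, h2⟩, hG⟩ := he
        rw [Finset.mem_union]
        rcases lt_trichotomy (dt z e.2) (dt z e.1) with h | h | h
        · left
          exact Finset.mem_filter.mpr ⟨Finset.mem_product.mpr ⟨h1, h2⟩, hG, h⟩
        · exact absurd (hz _ h2 _ h1 h).symm hG.2.2.1
        · right
          refine Finset.mem_image.mpr ⟨e.swap, ?_, Prod.swap_swap e⟩
          exact Finset.mem_filter.mpr ⟨Finset.mem_product.mpr ⟨h2, h1⟩, hG.symm, h⟩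
      have a := Finset.card_le_card hsub
      have b := Finset.card_union_le D (D.image Prod.swap)
      have c : (D.image Prod.swap).card ≤ D.card := Finset.card_image_le
      omega
    · unfold NC at hN
      push Not at hN
      obtain ⟨a, ha, b, hb, c, hc, hab, hac, hbc, h0⟩ := hN
      have hw := noncol (hS a ha) (hS b hb) (hS c hc) hab hac hbc
      have hk : ∀ x ∈ V, dt (cr (b - a) (c - a)) x = dt (cr (b - a) (c - a)) a := by
        intro x hx
        have := h0 x hx
        rw [← dt_cr, dt_sub] at this
        linarith
      have h1 := Finset.card_eq_sum_card_fiberwise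
        (s := (V ×ˢ V).filter (fun e => Gb V e.1 e.2)) (t := V) (f := Prod.fst) (by
        intro e he
        have := Finset.mem_filter.mp (Finset.mem_coe.mp he)
        exact this.2.1)
      have h2 : ∑ v ∈ V, (((V ×ˢ V).filter (fun e => Gb V e.1 e.2)).filter
          (fun e => e.1 = v)).card ≤ ∑ v ∈ V, 3 := by
        apply Finset.sum_le_sum
        intro v hv
        refine le_trans ?_ (coplanar_deg hS hw hk hv)
        apply Finset.card_le_card_of_injOn Prod.snd
        · intro e he
          obtain ⟨hf, rfl⟩ := Finset.mem_filter.mp (Finset.mem_coe.mp he)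
          obtain ⟨_, hG⟩ := Finset.mem_filter.mp hf
          exact Finset.mem_coe.mpr (Finset.mem_filter.mpr ⟨hG.2.1, hG⟩)
        · intro e he e' he' h
          have h1 := (Finset.mem_filter.mp (Finset.mem_coe.mp he)).2
          have h2 := (Finset.mem_filter.mp (Finset.mem_coe.mp he')).2
          exact Prod.ext (h1.trans h2.symm) h
      rw [← h1, Finset.sum_const, smul_eq_mul] at h2
      omega
  have : (4 * numWeakGabriel V + 24 : ℝ) ≤ 15 * V.card := by exact_mod_cast key
  linarith
end
end

section
/- Let V ⊆ S² be a finite set such that the origin lies in the interior of conv V, every point of V is an extreme point of conv V, every 2-dimensional exposed face of conv V is either a rectangle or a triangle, and every point of V belongs to exactly 3 rectangular 2-dimensional exposed faces. Then the weak Gabriel graph of V has exactly (15/4)|V| − 6 edges. -/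
open scoped RealInnerProductSpace Classical

noncomputable section

/-- `F` is an exposed face of `P` (cut out by a nonzero linear functional). -/
def IsExpFace (P F : Set (Euc 3)) : Prop :=
  ∃ u : Euc 3, u ≠ 0 ∧ F = {p ∈ P | ∀ x ∈ P, ⟪x, u⟫ ≤ ⟪p, u⟫}

/-- `F` is a 2-dimensional exposed face of `P`. -/
def IsTwoDimExpFace (P F : Set (Euc 3)) : Prop :=
  IsExpFace P F ∧ Module.finrank ℝ (vectorSpan ℝ F) = 2

/-- `F` is a rectangle: the convex hull of four distinct points `w, x, y, z` with
`w + y = x + z` and `⟪x - w, z - w⟫ = 0`. -/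
def IsRectangle (F : Set (Euc 3)) : Prop :=
  ∃ w x y z : Euc 3, w ≠ x ∧ w ≠ y ∧ w ≠ z ∧ x ≠ y ∧ x ≠ z ∧ y ≠ z ∧
    w + y = x + z ∧ ⟪x - w, z - w⟫ = 0 ∧ F = convexHull ℝ {w, x, y, z}

/-- `F` is a triangle: the convex hull of three affinely independent points. -/
def IsTriangle (F : Set (Euc 3)) : Prop :=
  ∃ a b c : Euc 3, AffineIndependent ℝ ![a, b, c] ∧ F = convexHull ℝ {a, b, c}

/-- `F` is an acute triangle: the convex hull of three affinely independent points,
all of whose angles are acute. -/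
def IsAcuteTriangle (F : Set (Euc 3)) : Prop :=
  ∃ a b c : Euc 3, AffineIndependent ℝ ![a, b, c] ∧
    0 < ⟪b - a, c - a⟫ ∧ 0 < ⟪a - b, c - b⟫ ∧ 0 < ⟪a - c, b - c⟫ ∧
    F = convexHull ℝ {a, b, c}


namespace WG

def cr (a b : Euc 3) : Euc 3 :=
  !₂[a 1 * b 2 - a 2 * b 1, a 2 * b 0 - a 0 * b 2, a 0 * b 1 - a 1 * b 0]

def dt (a b c : Euc 3) : ℝ := ⟪cr a b, c⟫

theorem inner3 (x y : Euc 3) : ⟪x, y⟫ = x 0 * y 0 + x 1 * y 1 + x 2 * y 2 := by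
  simp [PiLp.inner_apply, Fin.sum_univ_three]
  ring

@[simp] theorem cr0 (a b : Euc 3) : cr a b 0 = a 1 * b 2 - a 2 * b 1 := by simp [cr]
@[simp] theorem cr1 (a b : Euc 3) : cr a b 1 = a 2 * b 0 - a 0 * b 2 := by simp [cr]
@[simp] theorem cr2 (a b : Euc 3) : cr a b 2 = a 0 * b 1 - a 1 * b 0 := by simp [cr]

theorem ext3 {x y : Euc 3} (h0 : x 0 = y 0) (h1 : x 1 = y 1) (h2 : x 2 = y 2) : x = y := by
  ext i; fin_cases i <;> assumption

theorem expand (a b c h : Euc 3) :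
    dt a b c • h = ⟪h, a⟫ • cr b c + ⟪h, b⟫ • cr c a + ⟪h, c⟫ • cr a b := by
  apply ext3 <;> simp [dt, inner3] <;> ring

theorem dt_rot (a b c : Euc 3) : dt b c a = dt a b c := by
  simp [dt, inner3]; ring
theorem dt_swap (a b c : Euc 3) : dt b a c = - dt a b c := by
  simp [dt, inner3]; ring
theorem dt_swap' (a b c : Euc 3) : dt a c b = - dt a b c := by
  simp [dt, inner3]; ring
theorem dt_l (a b : Euc 3) : dt a b a = 0 := by
  simp [dt, inner3]; ring
theorem dt_r (a b : Euc 3) : dt a b b = 0 := by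
  simp [dt, inner3]; ring
theorem dt_s (a b : Euc 3) : dt a a b = 0 := by
  simp [dt, inner3]; ring
theorem cr_anti (a b : Euc 3) : cr b a = - cr a b := by
  apply ext3 <;> simp <;> ring

theorem eq_zero_of_three {a b c h : Euc 3} (hd : dt a b c ≠ 0) (ha : ⟪h, a⟫ = 0)
    (hb : ⟪h, b⟫ = 0) (hc : ⟪h, c⟫ = 0) : h = 0 := by
  have := expand a b c h
  rw [ha, hb, hc] at this
  simpa [hd] using this

theorem eq_of_three {a b c u u' : Euc 3} (hd : dt a b c ≠ 0) (ha : ⟪u, a⟫ = ⟪u', a⟫)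
    (hb : ⟪u, b⟫ = ⟪u', b⟫) (hc : ⟪u, c⟫ = ⟪u', c⟫) : u = u' := by
  rw [← sub_eq_zero]
  apply eq_zero_of_three hd <;> rw [inner_sub_left, sub_eq_zero] <;> assumption

theorem dt_cr (a b : Euc 3) (h : cr a b ≠ 0) : dt a b (cr a b) ≠ 0 := by
  unfold dt
  rwa [ne_eq, inner_self_eq_zero]

theorem line {a b h : Euc 3} (hc : cr a b ≠ 0) (ha : ⟪h, a⟫ = 0) (hb : ⟪h, b⟫ = 0) :
    ∃ t : ℝ, h = t • cr a b := by
  have := expand a b (cr a b) h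
  rw [ha, hb] at this
  refine ⟨(dt a b (cr a b))⁻¹ * ⟪h, cr a b⟫, ?_⟩
  rw [mul_smul, eq_inv_smul_iff₀ (dt_cr a b hc), this]
  simp

theorem gram (a b x y : Euc 3) : dt a b x * dt a b y =
    ⟪a, a⟫ * (⟪b, b⟫ * ⟪x, y⟫ - ⟪b, y⟫ * ⟪x, b⟫) - ⟪a, b⟫ * (⟪a, b⟫ * ⟪x, y⟫ - ⟪b, y⟫ * ⟪x, a⟫)
    + ⟪a, y⟫ * (⟪a, b⟫ * ⟪x, b⟫ - ⟪b, b⟫ * ⟪x, a⟫) := by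
  simp only [dt, inner3, cr0, cr1, cr2]; ring

theorem cr_self_inner (a b : Euc 3) : ⟪cr a b, cr a b⟫ = ⟪a, a⟫ * ⟪b, b⟫ - ⟪a, b⟫ ^ 2 := by
  simp only [inner3, cr0, cr1, cr2]; ring

theorem cr_inner_l (a b : Euc 3) : ⟪cr a b, a⟫ = 0 := dt_l a b
theorem cr_inner_r (a b : Euc 3) : ⟪cr a b, b⟫ = 0 := dt_r a b

theorem cr_ne_of_dt {a b c : Euc 3} (h : dt a b c ≠ 0) : cr a b ≠ 0 := by
  intro h0; apply h; simp [dt, h0]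

def Pol (V : Finset (Euc 3)) (u : Euc 3) : Prop := ∀ v ∈ V, ⟪u, v⟫ ≤ 1

def T (V : Finset (Euc 3)) (u : Euc 3) : Finset (Euc 3) := V.filter fun v => ⟪u, v⟫ = 1

theorem mem_T {V : Finset (Euc 3)} {u v : Euc 3} : v ∈ T V u ↔ v ∈ V ∧ ⟪u, v⟫ = 1 := by
  simp [T]

def IsF (V : Finset (Euc 3)) (u : Euc 3) : Prop :=
  Pol V u ∧ ∃ a ∈ T V u, ∃ b ∈ T V u, ∃ c ∈ T V u, 0 < dt a b c

theorem exists_pos {V : Finset (Euc 3)}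
    (ho : (0 : Euc 3) ∈ interior (convexHull ℝ (V : Set (Euc 3)))) {d : Euc 3} (hd : d ≠ 0) :
    ∃ v ∈ V, 0 < ⟪d, v⟫ := by
  by_contra! hcon
  have hsub : convexHull ℝ (V : Set (Euc 3)) ⊆ {x | ⟪d, x⟫ ≤ 0} := by
    apply convexHull_min
    · intro v hv; exact hcon v (by simpa using hv)
    · exact convex_halfSpace_le (f := fun x : Euc 3 => ⟪d, x⟫)
        ⟨fun x y => inner_add_right _ _ _, fun c x => by simp [inner_smul_right]⟩ 0
  have hnb := mem_interior_iff_mem_nhds.1 ho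
  have hcont : Filter.Tendsto (fun t : ℝ => t • d) (nhdsWithin 0 (Set.Ioi 0)) (nhds 0) := by
    have : Continuous (fun t : ℝ => t • d) := by fun_prop
    have h := this.tendsto 0
    simp only [zero_smul] at h
    exact h.mono_left nhdsWithin_le_nhds
  have h1 := hcont.eventually hnb
  have h2 : ∀ᶠ t : ℝ in nhdsWithin 0 (Set.Ioi 0), 0 < t := eventually_mem_nhdsWithin
  obtain ⟨t, ht1, ht2⟩ := (h1.and h2).exists
  have h3 := hsub ht1
  simp only [Set.mem_ofPred_eq, inner_smul_right] at h3
  have : 0 < ⟪d, d⟫ := real_inner_self_pos.2 hd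
  nlinarith [mul_pos ht2 this]

theorem neighbor {V : Finset (Euc 3)} (hp : ∀ d : Euc 3, d ≠ 0 → ∃ v ∈ V, 0 < ⟪d, v⟫)
    {u d : Euc 3} (hu : Pol V u) (hd : d ≠ 0) :
    ∃ t : ℝ, 0 ≤ t ∧ Pol V (u + t • d) ∧ ∃ c ∈ T V (u + t • d), 0 < ⟪d, c⟫ := by
  obtain ⟨v0, hv0, hv0'⟩ := hp d hd
  obtain ⟨c, hc, hmin⟩ := Finset.exists_min_image (V.filter fun v => 0 < ⟪d, v⟫)
    (fun v => (1 - ⟪u, v⟫) / ⟪d, v⟫) ⟨v0, by simp [hv0, hv0']⟩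
  simp only [Finset.mem_filter] at hc hmin
  have ht : 0 ≤ (1 - ⟪u, c⟫) / ⟪d, c⟫ := div_nonneg (by linarith [hu c hc.1]) hc.2.le
  refine ⟨(1 - ⟪u, c⟫) / ⟪d, c⟫, ht, ?_, c, ?_, hc.2⟩
  · intro v hv
    rw [inner_add_left, real_inner_smul_left]
    rcases le_or_gt ⟪d, v⟫ 0 with h | h
    · nlinarith [hu v hv]
    · have := hmin v ⟨hv, h⟩
      rw [le_div_iff₀ h] at this
      linarith
  · rw [mem_T, inner_add_left, real_inner_smul_left, div_mul_cancel₀ _ hc.2.ne']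
    exact ⟨hc.1, by ring⟩

theorem finiteF (V : Finset (Euc 3)) : {u | IsF V u}.Finite := by
  apply Set.Finite.of_injOn (f := fun u => T V u) (t := (V.powerset : Set (Finset (Euc 3))))
  · intro u _
    exact Finset.mem_coe.2 (Finset.mem_powerset.2 (Finset.filter_subset _ _))
  · rintro u ⟨_, a, ha, b, hb, c, hc, h⟩ u' _ he
    simp only at he
    have ha' := ha; have hb' := hb; have hc' := hc
    rw [he] at ha' hb' hc'
    rw [mem_T] at *
    exact eq_of_three h.ne' (by rw [ha.2, ha'.2]) (by rw [hb.2, hb'.2]) (by rw [hc.2, hc'.2])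
  · exact Finset.finite_toSet _

def FF (V : Finset (Euc 3)) : Finset (Euc 3) := (finiteF V).toFinset

theorem mem_FF {V : Finset (Euc 3)} {u : Euc 3} : u ∈ FF V ↔ IsF V u := by simp [FF]

/-- Uniqueness of the face on the positive side of `ab`. -/
theorem K_unique {V : Finset (Euc 3)} {u1 u2 a b c1 c2 : Euc 3} (h1 : Pol V u1) (h2 : Pol V u2)
    (ha1 : a ∈ T V u1) (hb1 : b ∈ T V u1) (ha2 : a ∈ T V u2) (hb2 : b ∈ T V u2)
    (hc1 : c1 ∈ T V u1) (hc2 : c2 ∈ T V u2) (hd1 : 0 < dt a b c1) (hd2 : 0 < dt a b c2) :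
    u1 = u2 := by
  rw [mem_T] at *
  obtain ⟨t, ht⟩ := line (h := u2 - u1) (cr_ne_of_dt hd1.ne')
    (by rw [inner_sub_left, ha1.2, ha2.2, sub_self]) (by rw [inner_sub_left, hb1.2, hb2.2, sub_self])
  have e1 : ⟪u2 - u1, c1⟫ = t * dt a b c1 := by rw [ht, real_inner_smul_left, dt]
  have e2 : ⟪u2 - u1, c2⟫ = t * dt a b c2 := by rw [ht, real_inner_smul_left, dt]
  rw [inner_sub_left, hc1.2] at e1
  rw [inner_sub_left, hc2.2] at e2
  have i1 := h2 c1 hc1.1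
  have i2 := h1 c2 hc2.1
  have : t ≤ 0 := by by_contra! h; nlinarith [mul_pos h hd1]
  have : 0 ≤ t := by by_contra! h; nlinarith [mul_pos_of_neg_of_neg h (neg_lt_zero.2 hd2)]
  have : t = 0 := by linarith
  rw [this, zero_smul, sub_eq_zero] at ht
  exact ht.symm

def Flag (V : Finset (Euc 3)) (u a b : Euc 3) : Prop :=
  a ∈ T V u ∧ b ∈ T V u ∧ a ≠ b ∧ ∀ c ∈ T V u, c = a ∨ c = b ∨ 0 < dt a b c

/-- positive third point -/
theorem Flag.third {V : Finset (Euc 3)} {u a b : Euc 3} (hu : IsF V u) (h : Flag V u a b) :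
    ∃ c ∈ T V u, 0 < dt a b c := by
  obtain ⟨_, p, hp, q, hq, r, hr, hd⟩ := hu
  by_contra! hcon
  have key : ∀ c ∈ T V u, c = a ∨ c = b := by
    intro c hc
    rcases h.2.2.2 c hc with h1 | h1 | h1
    · exact Or.inl h1
    · exact Or.inr h1
    · exact absurd h1 (not_lt.2 (hcon c hc))
  rcases key p hp with rfl | rfl <;> rcases key q hq with rfl | rfl <;>
    rcases key r hr with rfl | rfl <;> simp [dt_l, dt_r, dt_s] at hd

theorem Flag.reverse {V : Finset (Euc 3)} (hp : ∀ d : Euc 3, d ≠ 0 → ∃ v ∈ V, 0 < ⟪d, v⟫)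
    {u a b : Euc 3} (hu : IsF V u) (h : Flag V u a b) :
    ∃ t : ℝ, 0 < t ∧ IsF V (u - t • cr a b) ∧ Flag V (u - t • cr a b) b a := by
  obtain ⟨c0, hc0, hd0⟩ := h.third hu
  have hcr := cr_ne_of_dt hd0.ne'
  obtain ⟨t, ht0, hpol, c, hc, hcd⟩ := neighbor hp hu.1 (d := - cr a b) (neg_ne_zero.2 hcr)
  have e : u + t • (- cr a b) = u - t • cr a b := by rw [smul_neg, sub_eq_add_neg]
  rw [e] at hpol hc
  rw [inner_neg_left] at hcd
  have htight : ∀ x ∈ V, ⟪u - t • cr a b, x⟫ = ⟪u, x⟫ - t * dt a b x := by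
    intro x _; rw [inner_sub_left, real_inner_smul_left, dt]
  obtain ⟨ha, hb, hab, hall⟩ := h
  have hcV := (mem_T.1 hc).1
  have htpos : 0 < t := by
    rcases ht0.eq_or_lt with h0 | h0
    · subst h0
      simp only [zero_smul, sub_zero] at hc
      rcases hall c hc with rfl | rfl | h1
      · have := cr_inner_l c b; linarith
      · have := cr_inner_r a c; linarith
      · unfold dt at h1; linarith
    · exact h0
  have ha' : a ∈ T V (u - t • cr a b) := by
    rw [mem_T] at ha ⊢; refine ⟨ha.1, ?_⟩; rw [htight a ha.1, dt_l, ha.2]; ring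
  have hb' : b ∈ T V (u - t • cr a b) := by
    rw [mem_T] at hb ⊢; refine ⟨hb.1, ?_⟩; rw [htight b hb.1, dt_r, hb.2]; ring
  refine ⟨t, htpos, ⟨hpol, b, hb', a, ha', c, hc, ?_⟩, hb', ha', hab.symm, ?_⟩
  · rw [dt_swap]; exact hcd
  · intro x hx
    have hxV := (mem_T.1 hx).1
    have hx1 := (mem_T.1 hx).2
    rw [htight x hxV] at hx1
    have := hu.1 x hxV
    have hle : dt a b x ≤ 0 := by
      by_contra! h'; nlinarith [mul_pos htpos h']
    rcases hle.eq_or_lt with h0 | h0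
    · have : x ∈ T V u := by rw [mem_T]; exact ⟨hxV, by rw [h0] at hx1; linarith⟩
      rcases hall x this with h1 | h1 | h1
      · exact Or.inr (Or.inl h1)
      · exact Or.inl h1
      · linarith
    · right; right; rw [dt_swap]; linarith

theorem rect_dts {w x y z : Euc 3} (h : w + y = x + z) :
    dt x y w = dt w x z ∧ dt w x y = dt w x z ∧ dt w y x = - dt w x z ∧ dt w y z = dt w x z := by
  obtain rfl : y = x + z - w := by rw [← h]; abel
  refine ⟨?_, ?_, ?_, ?_⟩ <;> simp [dt, inner3] <;> ring

def FL (V : Finset (Euc 3)) (u : Euc 3) : Finset (Euc 3 × Euc 3) :=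
  (T V u ×ˢ T V u).filter fun p => Flag V u p.1 p.2

def K (V : Finset (Euc 3)) (u a b : Euc 3) : Prop :=
  a ∈ T V u ∧ b ∈ T V u ∧ ∃ c ∈ T V u, 0 < dt a b c

def KL (V : Finset (Euc 3)) (u : Euc 3) : Finset (Euc 3 × Euc 3) :=
  (T V u ×ˢ T V u).filter fun p => K V u p.1 p.2

theorem mem_FL {V : Finset (Euc 3)} {u a b : Euc 3} : (a, b) ∈ FL V u ↔ Flag V u a b := by
  simp only [FL, Finset.mem_filter, Finset.mem_product]
  exact ⟨fun h => h.2, fun h => ⟨⟨h.1, h.2.1⟩, h⟩⟩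

theorem mem_KL {V : Finset (Euc 3)} {u a b : Euc 3} : (a, b) ∈ KL V u ↔ K V u a b := by
  simp only [KL, Finset.mem_filter, Finset.mem_product]
  exact ⟨fun h => h.2, fun h => ⟨⟨h.1, h.2.1⟩, h⟩⟩

def Tri (V : Finset (Euc 3)) (u a b c : Euc 3) : Prop := T V u = {a, b, c} ∧ 0 < dt a b c

def Rect (V : Finset (Euc 3)) (u w x y z : Euc 3) : Prop :=
  T V u = {w, x, y, z} ∧ 0 < dt w x z ∧ w + y = x + z ∧ ⟪x - w, z - w⟫ = 0

theorem Tri.ne {V : Finset (Euc 3)} {u a b c : Euc 3} (h : Tri V u a b c) :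
    a ≠ b ∧ a ≠ c ∧ b ≠ c := by
  have := h.2
  refine ⟨?_, ?_, ?_⟩ <;> rintro rfl <;> simp [dt_l, dt_r, dt_s] at this

theorem Tri.rot {V : Finset (Euc 3)} {u a b c : Euc 3} (h : Tri V u a b c) : Tri V u b c a := by
  refine ⟨?_, by rw [dt_rot]; exact h.2⟩
  rw [h.1]; ext x; simp; tauto

theorem Tri.flag {V : Finset (Euc 3)} {u a b c : Euc 3} (h : Tri V u a b c) : Flag V u a b := by
  refine ⟨by simp [h.1], by simp [h.1], h.ne.1, ?_⟩
  intro x hx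
  rw [h.1] at hx
  simp only [Finset.mem_insert, Finset.mem_singleton] at hx
  rcases hx with rfl | rfl | rfl
  · simp
  · simp
  · exact Or.inr (Or.inr h.2)

theorem Tri.notflag {V : Finset (Euc 3)} {u a b c : Euc 3} (h : Tri V u a b c) :
    ¬ Flag V u b a := by
  rintro ⟨_, _, _, h4⟩
  have h1 := h4 c (by simp [h.1])
  have := h.2
  rcases h1 with h1 | h1 | h1
  · exact h.ne.2.2 h1.symm
  · exact h.ne.2.1 h1.symm
  · rw [dt_swap] at h1; linarith

theorem Tri.k {V : Finset (Euc 3)} {u a b c : Euc 3} (h : Tri V u a b c) : K V u a b := by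
  exact ⟨by simp [h.1], by simp [h.1], c, by simp [h.1], h.2⟩

theorem Tri.notk {V : Finset (Euc 3)} {u a b c : Euc 3} (h : Tri V u a b c) :
    ¬ K V u b a := by
  rintro ⟨_, _, x, hx, h4⟩
  rw [h.1] at hx
  have := h.2
  simp only [Finset.mem_insert, Finset.mem_singleton] at hx
  rw [dt_swap] at h4
  rcases hx with rfl | rfl | rfl
  · simp [dt_l] at h4
  · simp [dt_r] at h4
  · linarith

theorem notk_self {V : Finset (Euc 3)} {u a : Euc 3} : ¬ K V u a a := by
  rintro ⟨_, _, x, hx, h4⟩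
  simp [dt_s] at h4

theorem notflag_self {V : Finset (Euc 3)} {u a : Euc 3} : ¬ Flag V u a a := by
  rintro ⟨_, _, x, hx⟩
  exact x rfl

theorem Tri.FL_eq {V : Finset (Euc 3)} {u a b c : Euc 3} (h : Tri V u a b c) :
    FL V u = {(a, b), (b, c), (c, a)} := by
  ext ⟨p, q⟩
  rw [mem_FL]
  simp only [Finset.mem_insert, Finset.mem_singleton, Prod.mk.injEq]
  constructor
  · intro hf
    have hp := hf.1; have hq := hf.2.1
    rw [h.1] at hp hq
    simp only [Finset.mem_insert, Finset.mem_singleton] at hp hq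
    have n1 := h.notflag
    have n2 := h.rot.notflag
    have n3 := h.rot.rot.notflag
    rcases hp with rfl | rfl | rfl <;> rcases hq with rfl | rfl | rfl <;>
      first
      | exact absurd hf notflag_self
      | exact absurd hf (by assumption)
      | simp
  · rintro (⟨rfl, rfl⟩ | ⟨rfl, rfl⟩ | ⟨rfl, rfl⟩)
    · exact h.flag
    · exact h.rot.flag
    · exact h.rot.rot.flag

theorem Tri.KL_eq {V : Finset (Euc 3)} {u a b c : Euc 3} (h : Tri V u a b c) :
    KL V u = {(a, b), (b, c), (c, a)} := by
  ext ⟨p, q⟩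
  rw [mem_KL]
  simp only [Finset.mem_insert, Finset.mem_singleton, Prod.mk.injEq]
  constructor
  · intro hf
    have hp := hf.1; have hq := hf.2.1
    rw [h.1] at hp hq
    simp only [Finset.mem_insert, Finset.mem_singleton] at hp hq
    have n1 := h.notk
    have n2 := h.rot.notk
    have n3 := h.rot.rot.notk
    rcases hp with rfl | rfl | rfl <;> rcases hq with rfl | rfl | rfl <;>
      first
      | exact absurd hf notk_self
      | exact absurd hf (by assumption)
      | simp
  · rintro (⟨rfl, rfl⟩ | ⟨rfl, rfl⟩ | ⟨rfl, rfl⟩)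
    · exact h.k
    · exact h.rot.k
    · exact h.rot.rot.k

theorem Rect.ne {V : Finset (Euc 3)} {u w x y z : Euc 3} (h : Rect V u w x y z) :
    w ≠ x ∧ w ≠ y ∧ w ≠ z ∧ x ≠ y ∧ x ≠ z ∧ y ≠ z := by
  have h2 := h.2.1
  obtain ⟨h3, h4, h5, h6⟩ := rect_dts h.2.2.1
  clear h
  refine ⟨?_, ?_, ?_, ?_, ?_, ?_⟩ <;> rintro rfl <;> simp only [dt_l, dt_r, dt_s] at * <;> linarith

theorem Rect.rot {V : Finset (Euc 3)} {u w x y z : Euc 3} (h : Rect V u w x y z) :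
    Rect V u x y z w := by
  have hd : dt x y w = dt w x z := by
    have := rect_dts h.2.2.1; tauto
  refine ⟨?_, by rw [hd]; exact h.2.1, by rw [← h.2.2.1]; abel, ?_⟩
  · rw [h.1]; ext x; simp; tauto
  · have e : y - x = z - w := by rw [sub_eq_sub_iff_add_eq_add, add_comm, h.2.2.1, add_comm]
    rw [e, ← neg_sub x w, inner_neg_right, real_inner_comm, h.2.2.2, neg_zero]

theorem Rect.flag {V : Finset (Euc 3)} {u w x y z : Euc 3} (h : Rect V u w x y z) :
    Flag V u w x := by
  refine ⟨by simp [h.1], by simp [h.1], h.ne.1, ?_⟩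
  intro c hx
  have hd : dt w x y = dt w x z := by
    have := rect_dts h.2.2.1; tauto
  rw [h.1] at hx
  simp only [Finset.mem_insert, Finset.mem_singleton] at hx
  rcases hx with rfl | rfl | rfl | rfl
  · simp
  · simp
  · rw [hd]; exact Or.inr (Or.inr h.2.1)
  · exact Or.inr (Or.inr h.2.1)

theorem Rect.notflag {V : Finset (Euc 3)} {u w x y z : Euc 3} (h : Rect V u w x y z) :
    ¬ Flag V u x w := by
  rintro ⟨_, _, _, h4⟩
  have h1 := h4 z (by simp [h.1])
  have := h.2.1
  rcases h1 with h1 | h1 | h1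
  · exact h.ne.2.2.2.2.1 h1.symm
  · exact h.ne.2.2.1 h1.symm
  · rw [dt_swap] at h1; linarith

theorem Rect.notflag' {V : Finset (Euc 3)} {u w x y z : Euc 3} (h : Rect V u w x y z) :
    ¬ Flag V u w y := by
  rintro ⟨_, _, _, h4⟩
  have h1 := h4 x (by simp [h.1])
  have := h.2.1
  have hd : dt w y x = - dt w x z := by
    have := rect_dts h.2.2.1; tauto
  rcases h1 with h1 | h1 | h1
  · exact h.ne.1 h1.symm
  · exact h.ne.2.2.2.1 h1
  · linarith

theorem Rect.k {V : Finset (Euc 3)} {u w x y z : Euc 3} (h : Rect V u w x y z) : K V u w x := by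
  exact ⟨by simp [h.1], by simp [h.1], z, by simp [h.1], h.2.1⟩

theorem Rect.k' {V : Finset (Euc 3)} {u w x y z : Euc 3} (h : Rect V u w x y z) : K V u w y := by
  have hd : dt w y z = dt w x z := by
    have := rect_dts h.2.2.1; tauto
  exact ⟨by simp [h.1], by simp [h.1], z, by simp [h.1], by rw [hd]; exact h.2.1⟩

theorem Rect.notk {V : Finset (Euc 3)} {u w x y z : Euc 3} (h : Rect V u w x y z) :
    ¬ K V u x w := by
  rintro ⟨_, _, c, hx, h4⟩
  rw [h.1] at hx
  have := h.2.1
  have hd : dt w x y = dt w x z := by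
    have := rect_dts h.2.2.1; tauto
  simp only [Finset.mem_insert, Finset.mem_singleton] at hx
  rw [dt_swap] at h4
  rcases hx with rfl | rfl | rfl | rfl
  · simp [dt_l] at h4
  · simp [dt_r] at h4
  · linarith
  · linarith

theorem Rect.FL_eq {V : Finset (Euc 3)} {u w x y z : Euc 3} (h : Rect V u w x y z) :
    FL V u = {(w, x), (x, y), (y, z), (z, w)} := by
  ext ⟨p, q⟩
  rw [mem_FL]
  simp only [Finset.mem_insert, Finset.mem_singleton, Prod.mk.injEq]
  constructor
  · intro hf
    have hp := hf.1; have hq := hf.2.1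
    rw [h.1] at hp hq
    simp only [Finset.mem_insert, Finset.mem_singleton] at hp hq
    have n1 := h.notflag
    have n2 := h.rot.notflag
    have n3 := h.rot.rot.notflag
    have n4 := h.rot.rot.rot.notflag
    have m1 := h.notflag'
    have m2 := h.rot.notflag'
    have m3 := h.rot.rot.notflag'
    have m4 := h.rot.rot.rot.notflag'
    rcases hp with rfl | rfl | rfl | rfl <;> rcases hq with rfl | rfl | rfl | rfl <;>
      first
      | exact absurd hf notflag_self
      | exact absurd hf (by assumption)
      | simp
  · rintro (⟨rfl, rfl⟩ | ⟨rfl, rfl⟩ | ⟨rfl, rfl⟩ | ⟨rfl, rfl⟩)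
    · exact h.flag
    · exact h.rot.flag
    · exact h.rot.rot.flag
    · exact h.rot.rot.rot.flag

theorem Rect.KL_eq {V : Finset (Euc 3)} {u w x y z : Euc 3} (h : Rect V u w x y z) :
    KL V u = {(w, x), (x, y), (y, z), (z, w), (w, y), (x, z), (y, w), (z, x)} := by
  ext ⟨p, q⟩
  rw [mem_KL]
  simp only [Finset.mem_insert, Finset.mem_singleton, Prod.mk.injEq]
  constructor
  · intro hf
    have hp := hf.1; have hq := hf.2.1
    rw [h.1] at hp hq
    simp only [Finset.mem_insert, Finset.mem_singleton] at hp hq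
    have n1 := h.notk
    have n2 := h.rot.notk
    have n3 := h.rot.rot.notk
    have n4 := h.rot.rot.rot.notk
    rcases hp with rfl | rfl | rfl | rfl <;> rcases hq with rfl | rfl | rfl | rfl <;>
      first
      | exact absurd hf notk_self
      | exact absurd hf (by assumption)
      | simp
  · rintro (⟨rfl, rfl⟩ | ⟨rfl, rfl⟩ | ⟨rfl, rfl⟩ | ⟨rfl, rfl⟩ | ⟨rfl, rfl⟩ | ⟨rfl, rfl⟩ |
      ⟨rfl, rfl⟩ | ⟨rfl, rfl⟩)
    · exact h.k
    · exact h.rot.k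
    · exact h.rot.rot.k
    · exact h.rot.rot.rot.k
    · exact h.k'
    · exact h.rot.k'
    · exact h.rot.rot.k'
    · exact h.rot.rot.rot.k'

theorem Tri.cards {V : Finset (Euc 3)} {u a b c : Euc 3} (h : Tri V u a b c) :
    (T V u).card = 3 ∧ (FL V u).card = 3 ∧ (KL V u).card = 3 := by
  obtain ⟨h1, h2, h3⟩ := h.ne
  rw [h.FL_eq, h.KL_eq, h.1]
  have h1' := h1.symm; have h2' := h2.symm; have h3' := h3.symm
  refine ⟨?_, ?_, ?_⟩ <;> simp [Finset.card_insert_of_notMem, *]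

theorem Rect.cards {V : Finset (Euc 3)} {u w x y z : Euc 3} (h : Rect V u w x y z) :
    (T V u).card = 4 ∧ (FL V u).card = 4 ∧ (KL V u).card = 8 := by
  obtain ⟨h1, h2, h3, h4, h5, h6⟩ := h.ne
  rw [h.FL_eq, h.KL_eq, h.1]
  have h1' := h1.symm; have h2' := h2.symm; have h3' := h3.symm
  have h4' := h4.symm; have h5' := h5.symm; have h6' := h6.symm
  refine ⟨?_, ?_, ?_⟩ <;> simp [Finset.card_insert_of_notMem, *]

theorem down_of_top {V : Finset (Euc 3)} (hp : ∀ d : Euc 3, d ≠ 0 → ∃ v ∈ V, 0 < ⟪d, v⟫)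
    {g u a b : Euc 3} (hg : ∀ u, IsF V u → ∀ u', IsF V u' → u ≠ u' → ⟪g, u⟫ ≠ ⟪g, u'⟫)
    (hu : IsF V u) (hf : Flag V u a b)
    (ht : ∀ u', IsF V u' → a ∈ T V u' → b ∈ T V u' → ⟪g, u'⟫ ≤ ⟪g, u⟫) : 0 < ⟪g, cr a b⟫ := by
  obtain ⟨t, ht0, hu', hf'⟩ := hf.reverse hp hu
  obtain ⟨c0, hc0, hd0⟩ := hf.third hu
  have hcr := cr_ne_of_dt hd0.ne'
  have h1 := ht _ hu' hf'.2.1 hf'.1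
  have h2 := hg _ hu' _ hu (by
    intro h
    rw [sub_eq_self, smul_eq_zero] at h
    rcases h with h | h
    · exact ht0.ne' h
    · exact hcr h)
  rw [inner_sub_right, real_inner_smul_right] at h1 h2
  by_contra! h
  rcases h.eq_or_lt with h0 | h0
  · apply h2; rw [h0]; ring
  · nlinarith [mul_pos_of_neg_of_neg h0 (neg_lt_zero.2 ht0)]

theorem down_ne {V : Finset (Euc 3)} (hp : ∀ d : Euc 3, d ≠ 0 → ∃ v ∈ V, 0 < ⟪d, v⟫)
    {g u a b : Euc 3} (hg : ∀ u, IsF V u → ∀ u', IsF V u' → u ≠ u' → ⟪g, u⟫ ≠ ⟪g, u'⟫)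
    (hu : IsF V u) (hf : Flag V u a b) : ⟪g, cr a b⟫ ≠ 0 := by
  obtain ⟨t, ht0, hu', hf'⟩ := hf.reverse hp hu
  obtain ⟨c0, hc0, hd0⟩ := hf.third hu
  have hcr := cr_ne_of_dt hd0.ne'
  have h2 := hg _ hu' _ hu (by
    intro h
    rw [sub_eq_self, smul_eq_zero] at h
    rcases h with h | h
    · exact ht0.ne' h
    · exact hcr h)
  rw [inner_sub_right, real_inner_smul_right] at h2
  intro h; apply h2; rw [h]; ring

def TopAt (V : Finset (Euc 3)) (g u v : Euc 3) : Prop :=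
  ∀ u', IsF V u' → v ∈ T V u' → ⟪g, u'⟫ ≤ ⟪g, u⟫

def Top (V : Finset (Euc 3)) (g u : Euc 3) : Prop := ∀ u', IsF V u' → ⟪g, u'⟫ ≤ ⟪g, u⟫

theorem expand_inner {a b c : Euc 3} (g h : Euc 3) : dt a b c * ⟪g, h⟫ =
    ⟪h, a⟫ * ⟪g, cr b c⟫ + ⟪h, b⟫ * ⟪g, cr c a⟫ + ⟪h, c⟫ * ⟪g, cr a b⟫ := by
  rw [← real_inner_smul_right, expand]
  simp only [inner_add_right, real_inner_smul_right]

theorem le_of_tight {V : Finset (Euc 3)} {u u' a : Euc 3} (ha : a ∈ T V u) (hu' : IsF V u') :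
    ⟪u' - u, a⟫ ≤ 0 := by
  rw [mem_T] at ha
  rw [inner_sub_left, ha.2]
  linarith [hu'.1 a ha.1]

theorem corner {V : Finset (Euc 3)} (hp : ∀ d : Euc 3, d ≠ 0 → ∃ v ∈ V, 0 < ⟪d, v⟫)
    {g u a b c : Euc 3} (hg : ∀ u, IsF V u → ∀ u', IsF V u' → u ≠ u' → ⟪g, u⟫ ≠ ⟪g, u'⟫)
    (hu : IsF V u) (hf : Flag V u a b) (hf' : Flag V u c a) (hd : 0 < dt a b c) :
    TopAt V g u a ↔ 0 < ⟪g, cr a b⟫ ∧ 0 < ⟪g, cr c a⟫ := by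
  constructor
  · intro h
    exact ⟨down_of_top hp hg hu hf fun u' h1 h2 _ => h u' h1 h2,
      down_of_top hp hg hu hf' fun u' h1 _ h2 => h u' h1 h2⟩
  · rintro ⟨h1, h2⟩ u' hu' ha
    have e := expand_inner (a := a) (b := b) (c := c) g (u' - u)
    have eb := le_of_tight hf.2.1 hu'
    have ec := le_of_tight hf'.1 hu'
    have ea : ⟪u' - u, a⟫ = 0 := by
      rw [inner_sub_left, (mem_T.1 ha).2, (mem_T.1 hf.1).2, sub_self]
    rw [ea, inner_sub_right] at e
    have := mul_nonneg_of_nonpos_of_nonpos eb (neg_nonpos.2 h2.le)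
    have := mul_nonneg_of_nonpos_of_nonpos ec (neg_nonpos.2 h1.le)
    by_contra! hlt
    nlinarith [mul_pos hd (sub_pos.2 hlt)]

theorem Tri.top_iff {V : Finset (Euc 3)} (hp : ∀ d : Euc 3, d ≠ 0 → ∃ v ∈ V, 0 < ⟪d, v⟫)
    {g u a b c : Euc 3} (hg : ∀ u, IsF V u → ∀ u', IsF V u' → u ≠ u' → ⟪g, u⟫ ≠ ⟪g, u'⟫)
    (hu : IsF V u) (h : Tri V u a b c) :
    Top V g u ↔ 0 < ⟪g, cr a b⟫ ∧ 0 < ⟪g, cr b c⟫ ∧ 0 < ⟪g, cr c a⟫ := by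
  constructor
  · intro ht
    exact ⟨down_of_top hp hg hu h.flag fun u' h1 _ _ => ht u' h1,
      down_of_top hp hg hu h.rot.flag fun u' h1 _ _ => ht u' h1,
      down_of_top hp hg hu h.rot.rot.flag fun u' h1 _ _ => ht u' h1⟩
  · rintro ⟨h1, h2, h3⟩ u' hu'
    have e := expand_inner (a := a) (b := b) (c := c) g (u' - u)
    have ea := le_of_tight h.flag.1 hu'
    have eb := le_of_tight h.rot.flag.1 hu'
    have ec := le_of_tight h.rot.rot.flag.1 hu'
    rw [inner_sub_right] at e
    have := mul_nonneg_of_nonpos_of_nonpos ea (neg_nonpos.2 h2.le)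
    have := mul_nonneg_of_nonpos_of_nonpos eb (neg_nonpos.2 h3.le)
    have := mul_nonneg_of_nonpos_of_nonpos ec (neg_nonpos.2 h1.le)
    by_contra! hlt
    nlinarith [mul_pos h.2 (sub_pos.2 hlt)]

theorem rect_rel {w x y z : Euc 3} (h : w + y = x + z) (g : Euc 3) :
    ⟪g, cr w x⟫ + ⟪g, cr y z⟫ = ⟪g, cr x y⟫ + ⟪g, cr z w⟫ ∧
    ⟪g, cr x z⟫ = ⟪g, cr x y⟫ - ⟪g, cr w x⟫ := by
  obtain rfl : y = x + z - w := by rw [← h]; abel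
  constructor <;> simp [inner3] <;> ring

theorem Rect.top_iff {V : Finset (Euc 3)} (hp : ∀ d : Euc 3, d ≠ 0 → ∃ v ∈ V, 0 < ⟪d, v⟫)
    {g u w x y z : Euc 3} (hg : ∀ u, IsF V u → ∀ u', IsF V u' → u ≠ u' → ⟪g, u⟫ ≠ ⟪g, u'⟫)
    (hu : IsF V u) (h : Rect V u w x y z) :
    Top V g u ↔ 0 < ⟪g, cr w x⟫ ∧ 0 < ⟪g, cr x y⟫ ∧ 0 < ⟪g, cr y z⟫ ∧ 0 < ⟪g, cr z w⟫ := by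
  constructor
  · intro ht
    exact ⟨down_of_top hp hg hu h.flag fun u' h1 _ _ => ht u' h1,
      down_of_top hp hg hu h.rot.flag fun u' h1 _ _ => ht u' h1,
      down_of_top hp hg hu h.rot.rot.flag fun u' h1 _ _ => ht u' h1,
      down_of_top hp hg hu h.rot.rot.rot.flag fun u' h1 _ _ => ht u' h1⟩
  · rintro ⟨h1, h2, h3, h4⟩ u' hu'
    have e := expand_inner (a := w) (b := x) (c := z) g (u' - u)
    have ew := le_of_tight h.flag.1 hu'
    have ex := le_of_tight h.rot.flag.1 hu'
    have ey := le_of_tight h.rot.rot.flag.1 hu'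
    have ez := le_of_tight h.rot.rot.rot.flag.1 hu'
    have es : ⟪u' - u, w⟫ + ⟪u' - u, y⟫ = ⟪u' - u, x⟫ + ⟪u' - u, z⟫ := by
      rw [← inner_add_right, ← inner_add_right, h.2.2.1]
    obtain ⟨r1, r2⟩ := rect_rel h.2.2.1 g
    rw [inner_sub_right, r2] at e
    generalize ⟪u' - u, w⟫ = p at *
    generalize ⟪u' - u, x⟫ = q at *
    generalize ⟪u' - u, y⟫ = s at *
    generalize ⟪u' - u, z⟫ = r at *
    generalize ⟪g, cr w x⟫ = s1 at *
    generalize ⟪g, cr x y⟫ = s2 at *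
    generalize ⟪g, cr y z⟫ = s3 at *
    generalize ⟪g, cr z w⟫ = s4 at *
    have key : p * (s2 - s1) + q * s4 + r * s1 ≤ 0 := by
      rcases le_total s1 s2 with hs | hs
      · have := mul_nonneg_of_nonpos_of_nonpos ew (neg_nonpos.2 (sub_nonneg.2 hs))
        have := mul_nonneg_of_nonpos_of_nonpos ex (neg_nonpos.2 h4.le)
        have := mul_nonneg_of_nonpos_of_nonpos ez (neg_nonpos.2 h1.le)
        nlinarith
      · have := mul_nonneg_of_nonpos_of_nonpos ey (neg_nonpos.2 (sub_nonneg.2 hs))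
        have := mul_nonneg_of_nonpos_of_nonpos ez (neg_nonpos.2 h2.le)
        have := mul_nonneg_of_nonpos_of_nonpos ex (neg_nonpos.2 h3.le)
        obtain rfl : p = q + r - s := by linarith
        obtain rfl : s4 = s1 + s3 - s2 := by linarith
        nlinarith
    by_contra! hlt
    nlinarith [mul_pos h.2.1 (sub_pos.2 hlt)]

def Good (V : Finset (Euc 3)) (u : Euc 3) : Prop :=
  (∃ a b c, Tri V u a b c) ∨ (∃ w x y z, Rect V u w x y z)

theorem neg_hg {V : Finset (Euc 3)} {g : Euc 3}
    (hg : ∀ u, IsF V u → ∀ u', IsF V u' → u ≠ u' → ⟪g, u⟫ ≠ ⟪g, u'⟫) :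
    ∀ u, IsF V u → ∀ u', IsF V u' → u ≠ u' → ⟪-g, u⟫ ≠ ⟪-g, u'⟫ := by
  intro u hu u' hu' hne
  rw [inner_neg_left, inner_neg_left, ne_eq, neg_inj]
  exact hg u hu u' hu' hne

theorem euler_local {V : Finset (Euc 3)} (hp : ∀ d : Euc 3, d ≠ 0 → ∃ v ∈ V, 0 < ⟪d, v⟫)
    {g u : Euc 3} (hg : ∀ u, IsF V u → ∀ u', IsF V u' → u ≠ u' → ⟪g, u⟫ ≠ ⟪g, u'⟫)
    (hu : IsF V u) (h : Good V u) :
    (1 : ℤ) - ((FL V u).filter fun p => 0 < ⟪g, cr p.1 p.2⟫).card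
      + ((T V u).filter fun v => TopAt V g u v).card
      = (if Top V g u then 1 else 0) + (if Top V (-g) u then 1 else 0) := by
  rcases h with ⟨a, b, c, h⟩ | ⟨w, x, y, z, h⟩
  · obtain ⟨h1, h2, h3⟩ := h.ne
    rw [h.top_iff hp hg hu, h.top_iff hp (neg_hg hg) hu, h.FL_eq, h.1, Finset.card_filter,
      Finset.card_filter]
    have n1 := down_ne hp hg hu h.flag
    have n2 := down_ne hp hg hu h.rot.flag
    have n3 := down_ne hp hg hu h.rot.rot.flag
    have t1 := corner hp hg hu h.flag h.rot.rot.flag h.2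
    have t2 := corner hp hg hu h.rot.flag h.flag h.rot.2
    have t3 := corner hp hg hu h.rot.rot.flag h.rot.flag h.rot.rot.2
    rw [Finset.sum_insert (by simp [h1, h2, h3, h1.symm, h2.symm, h3.symm]),
      Finset.sum_insert (by simp [h1, h2, h3, h1.symm, h2.symm, h3.symm]), Finset.sum_singleton,
      Finset.sum_insert (by simp [h1, h2, h3, h1.symm, h2.symm, h3.symm]),
      Finset.sum_insert (by simp [h1, h2, h3, h1.symm, h2.symm, h3.symm]), Finset.sum_singleton]
    simp only [t1, t2, t3, inner_neg_left, neg_pos]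
    clear t1 t2 t3
    generalize ⟪g, cr a b⟫ = s1 at *
    generalize ⟪g, cr b c⟫ = s2 at *
    generalize ⟪g, cr c a⟫ = s3 at *
    rcases n1.lt_or_gt with i1 | i1 <;> rcases n2.lt_or_gt with i2 | i2 <;>
      rcases n3.lt_or_gt with i3 | i3 <;> simp [i1, i2, i3, i1.le, i2.le, i3.le, i1.not_gt, i2.not_gt, i3.not_gt]
  · obtain ⟨h1, h2, h3, h4, h5, h6⟩ := h.ne
    rw [h.top_iff hp hg hu, h.top_iff hp (neg_hg hg) hu, h.FL_eq, h.1, Finset.card_filter,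
      Finset.card_filter]
    have n1 := down_ne hp hg hu h.flag
    have n2 := down_ne hp hg hu h.rot.flag
    have n3 := down_ne hp hg hu h.rot.rot.flag
    have n4 := down_ne hp hg hu h.rot.rot.rot.flag
    have t1 := corner hp hg hu h.flag h.rot.rot.rot.flag h.2.1
    have t2 := corner hp hg hu h.rot.flag h.flag h.rot.2.1
    have t3 := corner hp hg hu h.rot.rot.flag h.rot.flag h.rot.rot.2.1
    have t4 := corner hp hg hu h.rot.rot.rot.flag h.rot.rot.flag h.rot.rot.rot.2.1
    have rel := (rect_rel h.2.2.1 g).1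
    have s1 := h1.symm; have s2 := h2.symm; have s3 := h3.symm
    have s4 := h4.symm; have s5 := h5.symm; have s6 := h6.symm
    rw [Finset.sum_insert (by simp [*]),
      Finset.sum_insert (by simp [*]), Finset.sum_insert (by simp [*]), Finset.sum_singleton,
      Finset.sum_insert (by simp [*]),
      Finset.sum_insert (by simp [*]), Finset.sum_insert (by simp [*]), Finset.sum_singleton]
    simp only [t1, t2, t3, t4, inner_neg_left, neg_pos]
    clear t1 t2 t3 t4 s1 s2 s3 s4 s5 s6
    generalize ⟪g, cr w x⟫ = s1 at *
    generalize ⟪g, cr x y⟫ = s2 at *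
    generalize ⟪g, cr y z⟫ = s3 at *
    generalize ⟪g, cr z w⟫ = s4 at *
    rcases n1.lt_or_gt with i1 | i1 <;> rcases n2.lt_or_gt with i2 | i2 <;>
      rcases n3.lt_or_gt with i3 | i3 <;> rcases n4.lt_or_gt with i4 | i4 <;>
      first
      | (exfalso; linarith)
      | simp [i1, i2, i3, i4, i1.le, i2.le, i3.le, i4.le, i1.not_gt, i2.not_gt, i3.not_gt, i4.not_gt]

theorem exists_generic (V : Finset (Euc 3)) :
    ∃ g : Euc 3, ∀ u, IsF V u → ∀ u', IsF V u' → u ≠ u' → ⟪g, u⟫ ≠ ⟪g, u'⟫ := by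
  obtain ⟨g, hg⟩ := Module.Dual.exists_forall_ne_zero_of_forall_exists (K := ℝ) (M := Euc 3)
    (ι := {p : FF V × FF V // p.1 ≠ p.2})
    (fun p => (innerSL ℝ ((p.1.1 : Euc 3) - (p.1.2 : Euc 3))).toLinearMap)
    (by
      rintro ⟨⟨u, u'⟩, hne⟩
      refine ⟨(u : Euc 3) - u', ?_⟩
      simp only [ContinuousLinearMap.coe_coe, innerSL_apply_apply]
      rw [ne_eq, inner_self_eq_zero, sub_eq_zero]
      intro h
      exact hne (Subtype.ext h))
  refine ⟨g, fun u hu u' hu' hne h => ?_⟩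
  have := hg ⟨(⟨u, mem_FF.2 hu⟩, ⟨u', mem_FF.2 hu'⟩), by
    intro h; exact hne (congrArg Subtype.val h)⟩
  apply this
  simp only [ContinuousLinearMap.coe_coe, innerSL_apply_apply]
  rw [inner_sub_left, real_inner_comm, h, real_inner_comm, sub_self]

theorem FL_disj {V : Finset (Euc 3)} :
    (FF V : Set (Euc 3)).PairwiseDisjoint (FL V) := by
  intro u hu u' hu' hne
  rw [Function.onFun, Finset.disjoint_left]
  rintro ⟨a, b⟩ h h'
  rw [mem_FL] at h h'
  rw [Finset.mem_coe, mem_FF] at hu hu'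
  obtain ⟨c, hc, hd⟩ := h.third hu
  obtain ⟨c', hc', hd'⟩ := h'.third hu'
  exact hne (K_unique hu.1 hu'.1 h.1 h.2.1 h'.1 h'.2.1 hc hc' hd hd')

theorem KL_disj {V : Finset (Euc 3)} :
    (FF V : Set (Euc 3)).PairwiseDisjoint (KL V) := by
  intro u hu u' hu' hne
  rw [Function.onFun, Finset.disjoint_left]
  rintro ⟨a, b⟩ h h'
  rw [mem_KL] at h h'
  rw [Finset.mem_coe, mem_FF] at hu hu'
  obtain ⟨h1, h2, c, hc, hd⟩ := h
  obtain ⟨h1', h2', c', hc', hd'⟩ := h'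
  exact hne (K_unique hu.1 hu'.1 h1 h2 h1' h2' hc hc' hd hd')

theorem top_sum {V : Finset (Euc 3)} {g : Euc 3} (hne : (FF V).Nonempty)
    (hg : ∀ u, IsF V u → ∀ u', IsF V u' → u ≠ u' → ⟪g, u⟫ ≠ ⟪g, u'⟫) :
    ∑ u ∈ FF V, (if Top V g u then (1 : ℤ) else 0) = 1 := by
  obtain ⟨u0, hu0, hmax⟩ := Finset.exists_max_image (FF V) (fun u => ⟪g, u⟫) hne
  have key : ∀ u ∈ FF V, (Top V g u ↔ u = u0) := by
    intro u hu
    constructor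
    · intro h
      by_contra hn
      exact hg u (mem_FF.1 hu) u0 (mem_FF.1 hu0) hn (le_antisymm (hmax u hu) (h u0 (mem_FF.1 hu0)))
    · rintro rfl u' hu'
      exact hmax u' (mem_FF.2 hu')
  rw [Finset.sum_congr rfl (g := fun u => if u = u0 then (1 : ℤ) else 0)]
  · simp [hu0]
  · intro u hu
    simp only [key u hu]

theorem topAt_sum {V : Finset (Euc 3)} {g : Euc 3}
    (hcov : ∀ v ∈ V, ∃ u, IsF V u ∧ v ∈ T V u)
    (hg : ∀ u, IsF V u → ∀ u', IsF V u' → u ≠ u' → ⟪g, u⟫ ≠ ⟪g, u'⟫) :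
    ∑ u ∈ FF V, ((T V u).filter fun v => TopAt V g u v).card = V.card := by
  rw [← Finset.card_biUnion]
  · congr 1
    ext v
    simp only [Finset.mem_biUnion, Finset.mem_filter]
    constructor
    · rintro ⟨u, _, h, _⟩
      exact (mem_T.1 h).1
    · intro hv
      obtain ⟨u1, h1, h2⟩ := hcov v hv
      obtain ⟨u0, hu0, hmax⟩ := Finset.exists_max_image ((FF V).filter fun u => v ∈ T V u)
        (fun u => ⟪g, u⟫) ⟨u1, by simp [mem_FF, h1, h2]⟩
      simp only [Finset.mem_filter, mem_FF] at hu0 hmax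
      exact ⟨u0, mem_FF.2 hu0.1, hu0.2, fun u' h h' => hmax u' ⟨h, h'⟩⟩
  · intro u hu u' hu' hne
    rw [Function.onFun, Finset.disjoint_left]
    intro v h h'
    rw [Finset.mem_coe, mem_FF] at hu hu'
    simp only [Finset.mem_filter] at h h'
    exact hg u hu u' hu' hne (le_antisymm (h'.2 u hu h.1) (h.2 u' hu' h'.1))

theorem down_sum {V : Finset (Euc 3)} (hp : ∀ d : Euc 3, d ≠ 0 → ∃ v ∈ V, 0 < ⟪d, v⟫)
    {g : Euc 3}
    (hg : ∀ u, IsF V u → ∀ u', IsF V u' → u ≠ u' → ⟪g, u⟫ ≠ ⟪g, u'⟫) :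
    2 * ∑ u ∈ FF V, ((FL V u).filter fun p => 0 < ⟪g, cr p.1 p.2⟫).card
      = ∑ u ∈ FF V, (FL V u).card := by
  have hD := Finset.card_biUnion (s := FF V) (t := FL V) FL_disj
  have hd : ∑ u ∈ FF V, ((FL V u).filter fun p => 0 < ⟪g, cr p.1 p.2⟫).card
      = (((FF V).biUnion (FL V)).filter fun p => 0 < ⟪g, cr p.1 p.2⟫).card := by
    rw [Finset.filter_biUnion, Finset.card_biUnion]
    intro u hu u' hu' hne
    exact Finset.disjoint_filter_filter (FL_disj hu hu' hne)
  rw [← hD, hd, ← Finset.card_filter_add_card_filter_not (s := (FF V).biUnion (FL V))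
    (fun p => 0 < ⟪g, cr p.1 p.2⟫), two_mul]
  congr 1
  have hsw : ∀ p ∈ (FF V).biUnion (FL V), p.swap ∈ (FF V).biUnion (FL V) ∧
      ⟪g, cr p.1 p.2⟫ ≠ 0 := by
    rintro ⟨a, b⟩ h
    simp only [Finset.mem_biUnion, mem_FF, Prod.swap_prod_mk] at h ⊢
    obtain ⟨u, hu, h⟩ := h
    rw [mem_FL] at h
    obtain ⟨t, _, hu', hf'⟩ := h.reverse hp hu
    exact ⟨⟨_, hu', mem_FL.2 hf'⟩, down_ne hp hg hu h⟩
  apply Finset.card_bij (fun p _ => p.swap)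
  · intro p hp'
    simp only [Finset.mem_filter] at hp' ⊢
    refine ⟨(hsw p hp'.1).1, ?_⟩
    rw [Prod.fst_swap, Prod.snd_swap, cr_anti, inner_neg_right]
    linarith
  · intro p _ q _ h
    exact Prod.swap_injective h
  · intro p hp'
    simp only [Finset.mem_filter] at hp'
    refine ⟨p.swap, ?_, Prod.swap_swap p⟩
    simp only [Finset.mem_filter]
    refine ⟨(hsw p hp'.1).1, ?_⟩
    rw [Prod.fst_swap, Prod.snd_swap, cr_anti, inner_neg_right]
    have := lt_of_le_of_ne (not_lt.1 hp'.2) (hsw p hp'.1).2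
    linarith

theorem euler {V : Finset (Euc 3)} (hp : ∀ d : Euc 3, d ≠ 0 → ∃ v ∈ V, 0 < ⟪d, v⟫)
    (hne : (FF V).Nonempty) (hcov : ∀ v ∈ V, ∃ u, IsF V u ∧ v ∈ T V u)
    (hgood : ∀ u, IsF V u → Good V u) :
    2 * (FF V).card + 2 * V.card = 4 + ∑ u ∈ FF V, (FL V u).card := by
  obtain ⟨g, hg⟩ := exists_generic V
  have h1 : ∑ u ∈ FF V, ((1 : ℤ) - ((FL V u).filter fun p => 0 < ⟪g, cr p.1 p.2⟫).card
      + ((T V u).filter fun v => TopAt V g u v).card) = ∑ u ∈ FF V,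
      ((if Top V g u then (1 : ℤ) else 0) + (if Top V (-g) u then 1 else 0)) :=
    Finset.sum_congr rfl fun u hu => euler_local hp hg (mem_FF.1 hu) (hgood u (mem_FF.1 hu))
  rw [Finset.sum_add_distrib, Finset.sum_add_distrib, Finset.sum_sub_distrib,
    top_sum hne hg, top_sum hne (neg_hg hg)] at h1
  have h2 := down_sum hp hg
  have h3 := topAt_sum hcov hg
  rw [← Nat.cast_sum, ← Nat.cast_sum, h3] at h1
  simp only [Finset.sum_const, nsmul_eq_mul, mul_one] at h1
  omega

theorem lemM {v G u1 u2 u3 x1 x2 x3 : Euc 3} (hv : v ≠ 0) (hG : G ≠ 0) (hGv : ⟪v, G⟫ = 0)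
    (g1 : ⟪G, x1⟫ = 0) (g2 : ⟪G, x2⟫ = 0) (g3 : ⟪G, x3⟫ = 0)
    (v1 : ⟪v, x1⟫ < 0) (v2 : ⟪v, x2⟫ < 0) (v3 : ⟪v, x3⟫ < 0)
    (h11 : ⟪u1, x1⟫ = 0) (h22 : ⟪u2, x2⟫ = 0) (h33 : ⟪u3, x3⟫ = 0)
    (h12 : ⟪u1, x2⟫ < 0) (h13 : ⟪u1, x3⟫ < 0) (h23 : ⟪u2, x3⟫ < 0) (h32 : ⟪u3, x2⟫ < 0)
    (h21 : ⟪u2, x1⟫ ≤ 0) (h31 : ⟪u3, x1⟫ ≤ 0) : False := by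
  have hd : dt v G (cr v G) ≠ 0 := by
    unfold dt
    rw [cr_self_inner, hGv]
    have a1 : ⟪v, v⟫ ≠ 0 := by rwa [ne_eq, inner_self_eq_zero]
    have a2 : ⟪G, G⟫ ≠ 0 := by rwa [ne_eq, inner_self_eq_zero]
    simp [a1, a2, hv, hG]
  set y1 := ⟪v, x1⟫ with hy1
  set y2 := ⟪v, x2⟫ with hy2
  set y3 := ⟪v, x3⟫ with hy3
  set t1 := ⟪cr v G, x1⟫ with ht1
  set t2 := ⟪cr v G, x2⟫ with ht2
  set t3 := ⟪cr v G, x3⟫ with ht3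
  set A := y2 * t3 - y3 * t2 with hA
  set B := y3 * t1 - y1 * t3 with hB
  set C := y1 * t2 - y2 * t1 with hC
  have hz : A • x1 + B • x2 + C • x3 = 0 := by
    apply eq_zero_of_three hd <;> rw [real_inner_comm] <;>
      simp only [inner_add_right, real_inner_smul_right, g1, g2, g3, ← hy1, ← hy2, ← hy3,
        ← ht1, ← ht2, ← ht3] <;> simp only [hA, hB, hC] <;> ring
  have e1 : B * ⟪u1, x2⟫ + C * ⟪u1, x3⟫ = 0 := by
    have := congrArg (fun z => ⟪u1, z⟫) hz
    simpa [inner_add_right, real_inner_smul_right, h11] using this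
  have e2 : A * ⟪u2, x1⟫ + C * ⟪u2, x3⟫ = 0 := by
    have := congrArg (fun z => ⟪u2, z⟫) hz
    simpa [inner_add_right, real_inner_smul_right, h22] using this
  have e3 : A * ⟪u3, x1⟫ + B * ⟪u3, x2⟫ = 0 := by
    have := congrArg (fun z => ⟪u3, z⟫) hz
    simpa [inner_add_right, real_inner_smul_right, h33] using this
  rcases lt_trichotomy B 0 with hb | hb | hb
  · have hc : 0 < C := by
      by_contra! hc
      linarith [mul_pos_of_neg_of_neg hb h12, mul_nonneg_of_nonpos_of_nonpos hc h13.le]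
    have ha : 0 < A := by
      by_contra! ha
      linarith [mul_pos_of_neg_of_neg hb h32, mul_nonneg_of_nonpos_of_nonpos ha h31]
    linarith [mul_neg_of_pos_of_neg hc h23, mul_nonpos_of_nonneg_of_nonpos ha.le h21]
  · have hz' : y3 • x1 - y1 • x3 = 0 := by
      apply eq_zero_of_three hd <;> rw [real_inner_comm] <;>
        simp only [inner_sub_right, real_inner_smul_right, g1, g3, ← hy1, ← hy3,
          ← ht1, ← ht3]
      · ring
      · ring
      · exact hb
    have := congrArg (fun z => ⟪u1, z⟫) hz'
    simp only [inner_sub_right, real_inner_smul_right, h11, inner_zero_right] at this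
    linarith [mul_pos_of_neg_of_neg v1 h13]
  · have hc : C < 0 := by
      by_contra! hc
      linarith [mul_neg_of_pos_of_neg hb h12, mul_nonpos_of_nonneg_of_nonpos hc h13.le]
    have ha : A < 0 := by
      by_contra! ha
      linarith [mul_neg_of_pos_of_neg hb h32, mul_nonpos_of_nonneg_of_nonpos ha h31]
    linarith [mul_pos_of_neg_of_neg hc h23, mul_nonneg_of_nonpos_of_nonpos ha.le h21]

def Obt (V : Finset (Euc 3)) (v u p q : Euc 3) : Prop :=
  Pol V u ∧ v ∈ T V u ∧ p ∈ T V u ∧ q ∈ T V u ∧ dt v p q ≠ 0 ∧ ⟪p - v, q - v⟫ ≤ 0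

theorem Obt.symm {V : Finset (Euc 3)} {v u p q : Euc 3} (h : Obt V v u p q) : Obt V v u q p := by
  obtain ⟨h1, h2, h3, h4, h5, h6⟩ := h
  exact ⟨h1, h2, h4, h3, by rw [dt_swap']; exact neg_ne_zero.2 h5, by rwa [real_inner_comm]⟩

theorem unit_neg {V : Finset (Euc 3)} (hV : ∀ v ∈ V, ⟪v, v⟫ = 1) {v p : Euc 3} (hv : v ∈ V)
    (hp : p ∈ V) (hne : p ≠ v) : ⟪v, p - v⟫ < 0 := by
  have h : 0 < ⟪p - v, p - v⟫ := by
    rw [real_inner_self_pos]; exact sub_ne_zero.2 hne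
  rw [inner_sub_left, inner_sub_right, inner_sub_right, hV p hp, hV v hv, real_inner_comm p v] at h
  rw [inner_sub_right, hV v hv]
  rw [real_inner_comm] at h ⊢
  linarith [real_inner_comm p v]

theorem Obt.ne {V : Finset (Euc 3)} {v u p q : Euc 3} (h : Obt V v u p q) : p ≠ v ∧ q ≠ v := by
  obtain ⟨h1, h2, h3, h4, h5, h6⟩ := h
  refine ⟨?_, ?_⟩ <;> rintro rfl <;> simp [dt_l, dt_s] at h5

theorem tight_le {V : Finset (Euc 3)} {v u p : Euc 3} (hu : Pol V u) (hv : v ∈ T V u)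
    (hp : p ∈ V) : ⟪u, p - v⟫ ≤ 0 := by
  rw [inner_sub_right, (mem_T.1 hv).2]; linarith [hu p hp]

theorem Obt.mid {V : Finset (Euc 3)} (hV : ∀ v ∈ V, ⟪v, v⟫ = 1) {v u p q G : Euc 3}
    (h : Obt V v u p q) (hG : ⟪G, p - v⟫ * ⟪G, q - v⟫ < 0) :
    ∃ x, ⟪G, x⟫ = 0 ∧ ⟪v, x⟫ < 0 ∧ ⟪u, x⟫ = 0 ∧
      ∀ u', Pol V u' → v ∈ T V u' → u' ≠ u → ⟪u', x⟫ < 0 := by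
  wlog hpos : 0 < ⟪G, p - v⟫ generalizing p q
  · apply this h.symm (by rwa [mul_comm])
    rcases mul_neg_iff.1 hG with h1 | h1
    · exact absurd h1.1 hpos
    · exact h1.2
  have hq : ⟪G, q - v⟫ < 0 := by
    rcases mul_neg_iff.1 hG with h1 | h1
    · exact h1.2
    · linarith
  obtain ⟨hp', hq'⟩ := h.ne
  obtain ⟨h1, h2, h3, h4, h5, h6⟩ := h
  have hvV := (mem_T.1 h2).1
  have hpV := (mem_T.1 h3).1
  have hqV := (mem_T.1 h4).1
  refine ⟨(-⟪G, q - v⟫) • (p - v) + ⟪G, p - v⟫ • (q - v), ?_, ?_, ?_, ?_⟩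
  · simp only [inner_add_right, real_inner_smul_right]; ring
  · rw [inner_add_right, real_inner_smul_right, real_inner_smul_right]
    have a1 := unit_neg hV hvV hpV hp'
    have a2 := unit_neg hV hvV hqV hq'
    have := mul_neg_of_pos_of_neg (neg_pos.2 hq) a1
    have := mul_neg_of_pos_of_neg hpos a2
    linarith
  · rw [inner_add_right, real_inner_smul_right, real_inner_smul_right, inner_sub_right u,
      inner_sub_right u, (mem_T.1 h2).2, (mem_T.1 h3).2, (mem_T.1 h4).2]
    ring
  · intro u' hu' hv' hne
    rw [inner_add_right, real_inner_smul_right, real_inner_smul_right]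
    have a1 := tight_le hu' hv' hpV
    have a2 := tight_le hu' hv' hqV
    have b1 := mul_nonpos_of_nonneg_of_nonpos (neg_pos.2 hq).le a1
    have b2 := mul_nonpos_of_nonneg_of_nonpos hpos.le a2
    rcases (add_nonpos b1 b2).lt_or_eq with h | h
    · exact h
    · exfalso
      have c1 : -⟪G, q - v⟫ * ⟪u', p - v⟫ = 0 := by linarith
      have c2 : ⟪G, p - v⟫ * ⟪u', q - v⟫ = 0 := by linarith
      have c1' := (mul_eq_zero.1 c1).resolve_left (by linarith)
      have c2' := (mul_eq_zero.1 c2).resolve_left (by linarith)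
      rw [inner_sub_right, (mem_T.1 hv').2] at c1' c2'
      apply hne
      apply eq_of_three h5
      · rw [(mem_T.1 h2).2, (mem_T.1 hv').2]
      · rw [(mem_T.1 h3).2]; linarith
      · rw [(mem_T.1 h4).2]; linarith

/-- one boundary ray and two strictly interior ones. -/
theorem lemM' {V : Finset (Euc 3)} (hV : ∀ v ∈ V, ⟪v, v⟫ = 1) {v G u1 p u2 p2 q2 u3 p3 q3 x1 : Euc 3}
    (hG : G ≠ 0) (hGv : ⟪v, G⟫ = 0) (hv1 : v ∈ T V u1) (hu1 : Pol V u1)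
    (g1 : ⟪G, x1⟫ = 0) (v1 : ⟪v, x1⟫ < 0) (h11 : ⟪u1, x1⟫ = 0)
    (hx : ∀ u', Pol V u' → v ∈ T V u' → ⟪u', x1⟫ ≤ 0)
    (o2 : Obt V v u2 p2 q2) (o3 : Obt V v u3 p3 q3)
    (n12 : u1 ≠ u2) (n13 : u1 ≠ u3) (n23 : u2 ≠ u3)
    (k2 : ⟪G, p2 - v⟫ * ⟪G, q2 - v⟫ < 0) (k3 : ⟪G, p3 - v⟫ * ⟪G, q3 - v⟫ < 0) : False := by
  obtain ⟨x2, g2, v2, h22, s2⟩ := o2.mid hV k2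
  obtain ⟨x3, g3, v3, h33, s3⟩ := o3.mid hV k3
  have hv0 : v ≠ 0 := by
    rintro rfl
    simp at v1
  exact lemM hv0 hG hGv g1 g2 g3 v1 v2 v3 h11 h22 h33 (s2 u1 hu1 hv1 n12) (s3 u1 hu1 hv1 n13)
    (s3 u2 o2.1 o2.2.1 n23) (s2 u3 o3.1 o3.2.1 n23.symm) (hx u2 o2.1 o2.2.1) (hx u3 o3.1 o3.2.1)

theorem four {V : Finset (Euc 3)} (hV : ∀ v ∈ V, ⟪v, v⟫ = 1)
    {v u1 p1 q1 u2 p2 q2 u3 p3 q3 u4 p4 q4 : Euc 3}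
    (o1 : Obt V v u1 p1 q1) (o2 : Obt V v u2 p2 q2) (o3 : Obt V v u3 p3 q3) (o4 : Obt V v u4 p4 q4)
    (n12 : u1 ≠ u2) (n13 : u1 ≠ u3) (n14 : u1 ≠ u4) (n23 : u2 ≠ u3) (n24 : u2 ≠ u4)
    (n34 : u3 ≠ u4) : False := by
  have hvV := (mem_T.1 o1.2.1).1
  have hp1V := (mem_T.1 o1.2.2.1).1
  have hvv := hV v hvV
  obtain ⟨G2, hG2⟩ : ∃ G2 : Euc 3, G2 = (p1 - v) - ⟪v, p1 - v⟫ • v := ⟨_, rfl⟩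
  have hvG2 : ⟪v, G2⟫ = 0 := by
    rw [hG2, inner_sub_right, real_inner_smul_right, hvv]; ring
  have hp1 : p1 - v = G2 + ⟪v, p1 - v⟫ • v := by rw [hG2]; abel
  have hG2ne : G2 ≠ 0 := by
    intro h0
    apply o1.2.2.2.2.1
    have : p1 = (1 + ⟪v, p1 - v⟫) • v := by
      rw [h0, zero_add] at hp1
      rw [add_smul, one_smul, ← hp1]; abel
    rw [this]
    simp [dt, inner3]; ring
  obtain ⟨G1, hG1⟩ : ∃ G1 : Euc 3, G1 = cr v G2 := ⟨_, rfl⟩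
  have hvG1 : ⟪v, G1⟫ = 0 := by rw [hG1, real_inner_comm, cr_inner_l]
  have hG1ne : G1 ≠ 0 := by
    intro h0
    have := cr_self_inner v G2
    rw [← hG1, h0, hvv, hvG2] at this
    rw [inner_zero_left] at this
    have h2 : ⟪G2, G2⟫ = 0 := by linarith
    exact hG2ne (inner_self_eq_zero.1 h2)
  have hG1p : ⟪G1, p1 - v⟫ = 0 := by
    rw [hp1, inner_add_right, real_inner_smul_right, hG1, cr_inner_l, cr_inner_r]; ring
  have hpos : 0 < ⟪G2, G2⟫ := real_inner_self_pos.2 hG2ne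
  have key : ∀ u p q, Obt V v u p q → ⟪G1, p - v⟫ * ⟪G1, q - v⟫ + ⟪G2, p - v⟫ * ⟪G2, q - v⟫ < 0 := by
    intro u p q o
    have g := gram v G2 (p - v) (q - v)
    unfold dt at g
    rw [← hG1, hvv, hvG2, real_inner_comm G2 (p - v), real_inner_comm v (p - v)] at g
    have a1 := unit_neg hV hvV (mem_T.1 o.2.2.1).1 o.ne.1
    have a2 := unit_neg hV hvV (mem_T.1 o.2.2.2.1).1 o.ne.2
    have a3 := mul_pos_of_neg_of_neg a1 a2
    have a4 := o.2.2.2.2.2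
    have a5 := mul_pos hpos a3
    have a6 := mul_nonpos_of_nonneg_of_nonpos hpos.le a4
    linarith
  have key' : ∀ u p q, Obt V v u p q → ¬ (⟪G1, p - v⟫ * ⟪G1, q - v⟫ < 0) →
      ⟪G2, p - v⟫ * ⟪G2, q - v⟫ < 0 := by
    intro u p q o h
    have := key u p q o
    linarith
  have k1 := key' u1 p1 q1 o1 (by rw [hG1p]; simp)
  obtain ⟨x1, g1, v1, h11, s1⟩ := o1.mid hV k1
  have s1' : ∀ u', Pol V u' → v ∈ T V u' → ⟪u', x1⟫ ≤ 0 := by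
    intro u' hu' hv'
    by_cases h : u' = u1
    · rw [h, h11]
    · exact (s1 u' hu' hv' h).le
  have M1 := fun {u2 p2 q2 u3 p3 q3} => @lemM' V hV v G1 u1 0 u2 p2 q2 u3 p3 q3 (p1 - v) hG1ne hvG1 o1.2.1 o1.1 hG1p
    (unit_neg hV hvV hp1V o1.ne.1)
    (by rw [inner_sub_right, (mem_T.1 o1.2.1).2, (mem_T.1 o1.2.2.1).2, sub_self])
    (fun u' hu' hv' => tight_le hu' hv' hp1V)
  have M2 := fun {u2 p2 q2 u3 p3 q3} => @lemM' V hV v G2 u1 0 u2 p2 q2 u3 p3 q3 x1 hG2ne hvG2 o1.2.1 o1.1 g1 v1 h11 s1'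
  have k2 := key' _ _ _ o2
  have k3 := key' _ _ _ o3
  have k4 := key' _ _ _ o4
  by_cases c2 : ⟪G1, p2 - v⟫ * ⟪G1, q2 - v⟫ < 0 <;> by_cases c3 : ⟪G1, p3 - v⟫ * ⟪G1, q3 - v⟫ < 0 <;>
    by_cases c4 : ⟪G1, p4 - v⟫ * ⟪G1, q4 - v⟫ < 0
  · exact M1 o2 o3 n12 n13 n23 c2 c3
  · exact M1 o2 o3 n12 n13 n23 c2 c3
  · exact M1 o2 o4 n12 n14 n24 c2 c4
  · exact M2 o3 o4 n13 n14 n34 (k3 c3) (k4 c4)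
  · exact M1 o3 o4 n13 n14 n34 c3 c4
  · exact M2 o2 o4 n12 n14 n24 (k2 c2) (k4 c4)
  · exact M2 o2 o3 n12 n13 n23 (k2 c2) (k3 c3)
  · exact M2 o2 o3 n12 n13 n23 (k2 c2) (k3 c3)

theorem Rect.obt {V : Finset (Euc 3)} {u w x y z v : Euc 3} (hu : IsF V u) (h : Rect V u w x y z)
    (hv : v ∈ T V u) : ∃ p q, Obt V v u p q := by
  have key : ∀ w x y z, Rect V u w x y z → ∃ p q, Obt V w u p q := by
    intro w x y z h
    exact ⟨x, z, hu.1, by simp [h.1], by simp [h.1], by simp [h.1], h.2.1.ne', h.2.2.2.le⟩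
  rw [h.1] at hv
  simp only [Finset.mem_insert, Finset.mem_singleton] at hv
  rcases hv with rfl | rfl | rfl | rfl
  · exact key _ _ _ _ h
  · exact key _ _ _ _ h.rot
  · exact key _ _ _ _ h.rot.rot
  · exact key _ _ _ _ h.rot.rot.rot

def IsR (V : Finset (Euc 3)) (u : Euc 3) : Prop := ∃ w x y z, Rect V u w x y z

theorem Tri.angle {V : Finset (Euc 3)} (hV : ∀ v ∈ V, ⟪v, v⟫ = 1)
    (h3 : ∀ v ∈ V, ((FF V).filter fun u => IsR V u ∧ v ∈ T V u).card = 3)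
    {u a b c : Euc 3} (hu : IsF V u) (h : Tri V u a b c) : 0 ≤ ⟪c - a, c - b⟫ := by
  by_contra! hcon
  have o : Obt V c u a b := by
    refine ⟨hu.1, by simp [h.1], by simp [h.1], by simp [h.1], ?_, ?_⟩
    · rw [← dt_rot c a b]; exact h.2.ne'
    · rw [← neg_sub c a, ← neg_sub c b, inner_neg_neg]; exact hcon.le
  have hc : c ∈ V := (mem_T.1 o.2.1).1
  obtain ⟨r1, r2, r3, n12, n13, n23, he⟩ := Finset.card_eq_three.1 (h3 c hc)
  have key : ∀ r ∈ ((FF V).filter fun u => IsR V u ∧ c ∈ T V u), u ≠ r ∧ ∃ p q, Obt V c r p q := by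
    intro r hr
    simp only [Finset.mem_filter, mem_FF] at hr
    obtain ⟨hf, ⟨w, x, y, z, hr⟩, hcr⟩ := hr
    refine ⟨?_, hr.obt hf hcr⟩
    rintro rfl
    have := h.cards.1
    have := hr.cards.1
    omega
  obtain ⟨m1, p1, q1, o1⟩ := key r1 (by rw [he]; simp)
  obtain ⟨m2, p2, q2, o2⟩ := key r2 (by rw [he]; simp)
  obtain ⟨m3, p3, q3, o3⟩ := key r3 (by rw [he]; simp)
  exact four hV o o1 o2 o3 m1 m2 m3 n12 n13 n23

theorem cap_eq {V : Finset (Euc 3)} (hV : ∀ v ∈ V, ⟪v, v⟫ = 1) {v a b : Euc 3} (hv : v ∈ V) :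
    ⟪v - a, v - b⟫ = 1 + ⟪a, b⟫ - ⟪a + b, v⟫ := by
  rw [inner_sub_left, inner_sub_right, inner_sub_right, hV v hv, inner_add_left,
    real_inner_comm v b]
  ring

theorem one_add_pos {V : Finset (Euc 3)} (hV : ∀ v ∈ V, ⟪v, v⟫ = 1) {a b : Euc 3} (ha : a ∈ V)
    (hb : b ∈ V) (hne : b ≠ -a) : 0 < 1 + ⟪a, b⟫ := by
  have h : 0 < ⟪a + b, a + b⟫ := by
    rw [real_inner_self_pos]
    intro h
    exact hne (eq_neg_of_add_eq_zero_right h)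
  rw [inner_add_left, inner_add_right, inner_add_right, hV a ha, hV b hb, real_inner_comm a b] at h
  linarith

theorem K.neg {V : Finset (Euc 3)} {u a b : Euc 3} (h : K V u a b) : b ≠ -a := by
  rintro rfl
  have h1 := (mem_T.1 h.1).2
  have h2 := (mem_T.1 h.2.1).2
  rw [inner_neg_right, h1] at h2
  norm_num at h2

theorem cap_inner {V : Finset (Euc 3)} (hV : ∀ v ∈ V, ⟪v, v⟫ = 1) {a b u0 : Euc 3} (ha : a ∈ V)
    (hb : b ∈ V) (hne : b ≠ -a) (h0 : (1 + ⟪a, b⟫) • u0 = a + b) : ⟪u0, a⟫ = 1 ∧ ⟪u0, b⟫ = 1 := by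
  have hp := one_add_pos hV ha hb hne
  constructor
  · have := congrArg (fun z => ⟪z, a⟫) h0
    simp only [real_inner_smul_left, inner_add_left, hV a ha] at this
    rw [real_inner_comm a b] at this
    nlinarith
  · have := congrArg (fun z => ⟪z, b⟫) h0
    simp only [real_inner_smul_left, inner_add_left, hV b hb] at this
    nlinarith

theorem wg_of_pol {V : Finset (Euc 3)} (hV : ∀ v ∈ V, ⟪v, v⟫ = 1) {u a b u0 : Euc 3}
    (hk : K V u a b) (h0 : (1 + ⟪a, b⟫) • u0 = a + b) (hpol : Pol V u0) :
    IsWeakGabrielEdge V a b := by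
  have ha := (mem_T.1 hk.1).1
  have hb := (mem_T.1 hk.2.1).1
  refine ⟨ha, hb, ?_, hk.neg, ?_⟩
  · rintro rfl
    exact notk_self hk
  · intro v hv
    have hp := one_add_pos hV ha hb hk.neg
    rw [cap_eq hV hv, ← h0, real_inner_smul_left]
    nlinarith [hpol v hv]

theorem k_of_wg {V : Finset (Euc 3)} (hV : ∀ v ∈ V, ⟪v, v⟫ = 1)
    (hp : ∀ d : Euc 3, d ≠ 0 → ∃ v ∈ V, 0 < ⟪d, v⟫) {a b : Euc 3}
    (h : IsWeakGabrielEdge V a b) : ∃ u, IsF V u ∧ K V u a b := by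
  obtain ⟨ha, hb, hne, hneg, hcap⟩ := h
  have hpos := one_add_pos hV ha hb hneg
  obtain ⟨u0, h0⟩ : ∃ u0 : Euc 3, (1 + ⟪a, b⟫) • u0 = a + b :=
    ⟨(1 + ⟪a, b⟫)⁻¹ • (a + b), by rw [smul_inv_smul₀ hpos.ne']⟩
  obtain ⟨h1, h2⟩ := cap_inner hV ha hb hneg h0
  have hpol : Pol V u0 := by
    intro v hv
    have := hcap v hv
    rw [cap_eq hV hv, ← h0, real_inner_smul_left] at this
    by_contra! hc
    nlinarith
  have hcr : cr a b ≠ 0 := by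
    intro hc
    have e := cr_self_inner a b
    rw [hc, inner_zero_left, hV a ha, hV b hb] at e
    have h3 : 0 < ⟪a - b, a - b⟫ := real_inner_self_pos.2 (sub_ne_zero.2 hne)
    rw [inner_sub_left, inner_sub_right, inner_sub_right, hV a ha, hV b hb,
      real_inner_comm a b] at h3
    nlinarith
  obtain ⟨t, _, hpol', c, hc, hcd⟩ := neighbor hp hpol hcr
  have ha' : a ∈ T V (u0 + t • cr a b) := by
    rw [mem_T, inner_add_left, real_inner_smul_left, cr_inner_l, h1]; simp [ha]
  have hb' : b ∈ T V (u0 + t • cr a b) := by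
    rw [mem_T, inner_add_left, real_inner_smul_left, cr_inner_r, h2]; simp [hb]
  exact ⟨_, ⟨hpol', a, ha', b, hb', c, hc, hcd⟩, ha', hb', c, hc, hcd⟩

theorem flag_good {V : Finset (Euc 3)} (hV : ∀ v ∈ V, ⟪v, v⟫ = 1)
    (h3 : ∀ v ∈ V, ((FF V).filter fun u => IsR V u ∧ v ∈ T V u).card = 3)
    {u a b : Euc 3} (hu : IsF V u) (hgood : Good V u) (hf : Flag V u a b) :
    ∃ c ∈ T V u, 0 < dt a b c ∧ 0 ≤ ⟪c - a, c - b⟫ := by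
  rw [← mem_FL] at hf
  rcases hgood with ⟨p, q, r, h⟩ | ⟨w, x, y, z, h⟩
  · have key : ∀ p q r, Tri V u p q r → ∃ c ∈ T V u, 0 < dt p q c ∧ 0 ≤ ⟪c - p, c - q⟫ := by
      intro p q r h
      exact ⟨r, by simp [h.1], h.2, h.angle hV h3 hu⟩
    rw [h.FL_eq] at hf
    simp only [Finset.mem_insert, Finset.mem_singleton, Prod.mk.injEq] at hf
    rcases hf with ⟨rfl, rfl⟩ | ⟨rfl, rfl⟩ | ⟨rfl, rfl⟩
    · exact key _ _ _ h
    · exact key _ _ _ h.rot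
    · exact key _ _ _ h.rot.rot
  · have key : ∀ w x y z, Rect V u w x y z → ∃ c ∈ T V u, 0 < dt w x c ∧ 0 ≤ ⟪c - w, c - x⟫ := by
      intro w x y z h
      refine ⟨z, by simp [h.1], h.2.1, ?_⟩
      have e : z - x = (z - w) - (x - w) := by abel
      rw [e, inner_sub_right, real_inner_comm (x - w) (z - w), h.2.2.2, sub_zero]
      exact real_inner_self_nonneg
    rw [h.FL_eq] at hf
    simp only [Finset.mem_insert, Finset.mem_singleton, Prod.mk.injEq] at hf
    rcases hf with ⟨rfl, rfl⟩ | ⟨rfl, rfl⟩ | ⟨rfl, rfl⟩ | ⟨rfl, rfl⟩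
    · exact key _ _ _ _ h
    · exact key _ _ _ _ h.rot
    · exact key _ _ _ _ h.rot.rot
    · exact key _ _ _ _ h.rot.rot.rot

theorem wg_of_flag {V : Finset (Euc 3)} (hV : ∀ v ∈ V, ⟪v, v⟫ = 1)
    (hp : ∀ d : Euc 3, d ≠ 0 → ∃ v ∈ V, 0 < ⟪d, v⟫)
    (h3 : ∀ v ∈ V, ((FF V).filter fun u => IsR V u ∧ v ∈ T V u).card = 3)
    (hgood : ∀ u, IsF V u → Good V u)
    {u a b : Euc 3} (hu : IsF V u) (hf : Flag V u a b) : IsWeakGabrielEdge V a b := by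
  obtain ⟨c, hc, hd, hcap⟩ := flag_good hV h3 hu (hgood u hu) hf
  have hk : K V u a b := ⟨hf.1, hf.2.1, c, hc, hd⟩
  obtain ⟨t, ht, hu', hf'⟩ := hf.reverse hp hu
  obtain ⟨c', hc', hd', hcap'⟩ := flag_good hV h3 hu' (hgood _ hu') hf'
  have ha := (mem_T.1 hk.1).1
  have hb := (mem_T.1 hk.2.1).1
  have hpos := one_add_pos hV ha hb hk.neg
  obtain ⟨u0, h0⟩ : ∃ u0 : Euc 3, (1 + ⟪a, b⟫) • u0 = a + b :=
    ⟨(1 + ⟪a, b⟫)⁻¹ • (a + b), by rw [smul_inv_smul₀ hpos.ne']⟩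
  obtain ⟨h1, h2⟩ := cap_inner hV ha hb hk.neg h0
  have hcV := (mem_T.1 hc).1
  have hcV' := (mem_T.1 hc').1
  obtain ⟨s, hs⟩ := line (h := u0 - u) (cr_ne_of_dt hd.ne')
    (by rw [inner_sub_left, h1, (mem_T.1 hf.1).2, sub_self])
    (by rw [inner_sub_left, h2, (mem_T.1 hf.2.1).2, sub_self])
  have hu0 : u0 = u + s • cr a b := by rw [← hs]; abel
  have c1 : ⟪u0, c⟫ ≤ 1 := by
    rw [cap_eq hV hcV, ← h0, real_inner_smul_left] at hcap
    by_contra! hc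
    nlinarith
  have c2 : ⟪u0, c'⟫ ≤ 1 := by
    rw [real_inner_comm, cap_eq hV hcV', ← h0, real_inner_smul_left] at hcap'
    by_contra! hc
    nlinarith
  have e1 := (mem_T.1 hc).2
  have e2 := (mem_T.1 hc').2
  rw [inner_sub_left, real_inner_smul_left] at e2
  rw [hu0, inner_add_left, real_inner_smul_left] at c1 c2
  rw [dt_swap] at hd'
  change 0 < ⟪cr a b, c⟫ at hd
  change 0 < -⟪cr a b, c'⟫ at hd'
  have s0 : s ≤ 0 := by
    by_contra! hh
    nlinarith [mul_pos hh hd]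
  have s1 : 0 ≤ s + t := by
    by_contra! hh
    nlinarith [mul_pos (neg_pos.2 hh) hd']
  apply wg_of_pol hV hk h0
  intro v hv
  have p1 := hu.1 v hv
  have p2 := hu'.1 v hv
  rw [inner_sub_left, real_inner_smul_left] at p2
  rw [hu0, inner_add_left, real_inner_smul_left]
  have q1 := mul_le_mul_of_nonneg_left p1 s1
  have q2 := mul_le_mul_of_nonneg_left p2 (neg_nonneg.2 s0)
  by_contra! hh
  have := mul_lt_mul_of_pos_left hh ht
  nlinarith

theorem Rect.wg_diag {V : Finset (Euc 3)} (hV : ∀ v ∈ V, ⟪v, v⟫ = 1)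
    {u w x y z : Euc 3} (hu : IsF V u) (h : Rect V u w x y z) : IsWeakGabrielEdge V w y := by
  have hT : ∀ p ∈ T V u, p ∈ V ∧ ⟪u, p⟫ = 1 := fun p hp => mem_T.1 hp
  rw [h.1] at hT
  obtain ⟨hw, hw'⟩ := hT w (by simp)
  obtain ⟨hx, hx'⟩ := hT x (by simp)
  obtain ⟨hy, hy'⟩ := hT y (by simp)
  obtain ⟨hz, hz'⟩ := hT z (by simp)
  refine wg_of_pol hV h.k' (u0 := u) ?_ hu.1
  apply eq_of_three h.2.1.ne'
  · rw [real_inner_smul_left, hw', inner_add_left, hV w hw, real_inner_comm]; ring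
  · have := cap_eq hV hx (a := w) (b := y)
    have e : x - y = -(z - w) := by
      rw [neg_sub, sub_eq_sub_iff_add_eq_add, ← h.2.2.1]
    rw [e, inner_neg_right, h.2.2.2] at this
    rw [real_inner_smul_left, hx']; linarith
  · have := cap_eq hV hz (a := w) (b := y)
    have e : z - y = -(x - w) := by
      rw [neg_sub, sub_eq_sub_iff_add_eq_add, h.2.2.1, add_comm]
    rw [e, inner_neg_right, real_inner_comm, h.2.2.2] at this
    rw [real_inner_smul_left, hz']; linarith

theorem wg_iff {V : Finset (Euc 3)} (hV : ∀ v ∈ V, ⟪v, v⟫ = 1)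
    (hp : ∀ d : Euc 3, d ≠ 0 → ∃ v ∈ V, 0 < ⟪d, v⟫)
    (h3 : ∀ v ∈ V, ((FF V).filter fun u => IsR V u ∧ v ∈ T V u).card = 3)
    (hgood : ∀ u, IsF V u → Good V u) {a b : Euc 3} :
    IsWeakGabrielEdge V a b ↔ ∃ u, IsF V u ∧ K V u a b := by
  refine ⟨k_of_wg hV hp, ?_⟩
  rintro ⟨u, hu, hk⟩
  have W := fun {a b} => @wg_of_flag V hV hp h3 hgood u a b hu
  rw [← mem_KL] at hk
  rcases hgood u hu with ⟨p, q, r, h⟩ | ⟨w, x, y, z, h⟩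
  · rw [h.KL_eq] at hk
    simp only [Finset.mem_insert, Finset.mem_singleton, Prod.mk.injEq] at hk
    rcases hk with ⟨rfl, rfl⟩ | ⟨rfl, rfl⟩ | ⟨rfl, rfl⟩
    · exact W h.flag
    · exact W h.rot.flag
    · exact W h.rot.rot.flag
  · rw [h.KL_eq] at hk
    simp only [Finset.mem_insert, Finset.mem_singleton, Prod.mk.injEq] at hk
    rcases hk with ⟨rfl, rfl⟩ | ⟨rfl, rfl⟩ | ⟨rfl, rfl⟩ | ⟨rfl, rfl⟩ | ⟨rfl, rfl⟩ | ⟨rfl, rfl⟩ |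
      ⟨rfl, rfl⟩ | ⟨rfl, rfl⟩
    · exact W h.flag
    · exact W h.rot.flag
    · exact W h.rot.rot.flag
    · exact W h.rot.rot.rot.flag
    · exact h.wg_diag hV hu
    · exact h.rot.wg_diag hV hu
    · exact h.rot.rot.wg_diag hV hu
    · exact h.rot.rot.rot.wg_diag hV hu

theorem wg_card {V : Finset (Euc 3)} (hV : ∀ v ∈ V, ⟪v, v⟫ = 1)
    (hp : ∀ d : Euc 3, d ≠ 0 → ∃ v ∈ V, 0 < ⟪d, v⟫)
    (h3 : ∀ v ∈ V, ((FF V).filter fun u => IsR V u ∧ v ∈ T V u).card = 3)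
    (hgood : ∀ u, IsF V u → Good V u) :
    ((V ×ˢ V).filter fun pq => IsWeakGabrielEdge V pq.1 pq.2).card
      = ∑ u ∈ FF V, (KL V u).card := by
  rw [← Finset.card_biUnion KL_disj]
  congr 1
  ext ⟨a, b⟩
  simp only [Finset.mem_filter, Finset.mem_product, Finset.mem_biUnion, mem_KL, mem_FF]
  rw [wg_iff hV hp h3 hgood]
  constructor
  · exact fun h => h.2
  · rintro ⟨u, hu, hk⟩
    exact ⟨⟨(mem_T.1 hk.1).1, (mem_T.1 hk.2.1).1⟩, u, hu, hk⟩

theorem count {V : Finset (Euc 3)} (hV : ∀ v ∈ V, ⟪v, v⟫ = 1)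
    (hp : ∀ d : Euc 3, d ≠ 0 → ∃ v ∈ V, 0 < ⟪d, v⟫)
    (h3 : ∀ v ∈ V, ((FF V).filter fun u => IsR V u ∧ v ∈ T V u).card = 3)
    (hgood : ∀ u, IsF V u → Good V u) :
    (numWeakGabriel V : ℝ) = 15 / 4 * V.card - 6 := by
  have hcov : ∀ v ∈ V, ∃ u, IsF V u ∧ v ∈ T V u := by
    intro v hv
    have : ((FF V).filter fun u => IsR V u ∧ v ∈ T V u).Nonempty := by
      rw [← Finset.card_pos, h3 v hv]; norm_num
    obtain ⟨u, hu⟩ := this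
    simp only [Finset.mem_filter, mem_FF] at hu
    exact ⟨u, hu.1, hu.2.2⟩
  have hne : (FF V).Nonempty := by
    obtain ⟨v, hv, _⟩ := hp (!₂[1, 0, 0]) (by
      intro h
      have := congrArg (fun z : Euc 3 => z 0) h
      simp at this)
    obtain ⟨u, hu, _⟩ := hcov v hv
    exact ⟨u, mem_FF.2 hu⟩
  have he := euler hp hne hcov hgood
  have hw := wg_card hV hp h3 hgood
  set R := ((FF V).filter fun u => IsR V u) with hR
  have f1 : ∀ u ∈ FF V, (FL V u).card = 3 + if IsR V u then 1 else 0 := by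
    intro u hu
    split_ifs with h
    · obtain ⟨w, x, y, z, h⟩ := h
      rw [h.cards.2.1]
    · rcases hgood u (mem_FF.1 hu) with ⟨p, q, r, h'⟩ | h'
      · rw [h'.cards.2.1]
      · exact absurd h' h
  have f2 : ∀ u ∈ FF V, (KL V u).card = 3 + 5 * if IsR V u then 1 else 0 := by
    intro u hu
    split_ifs with h
    · obtain ⟨w, x, y, z, h⟩ := h
      rw [h.cards.2.2]
    · rcases hgood u (mem_FF.1 hu) with ⟨p, q, r, h'⟩ | h'
      · rw [h'.cards.2.2]
      · exact absurd h' h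
  rw [Finset.sum_congr rfl f1, Finset.sum_add_distrib, ← Finset.card_filter, ← hR,
    Finset.sum_const, smul_eq_mul] at he
  rw [Finset.sum_congr rfl f2, Finset.sum_add_distrib, ← Finset.mul_sum, ← Finset.card_filter,
    ← hR, Finset.sum_const, smul_eq_mul] at hw
  have f3 : 4 * R.card = 3 * V.card := by
    have e := Finset.sum_card_bipartiteAbove_eq_sum_card_bipartiteBelow (s := R) (t := V)
      (fun u v => v ∈ T V u)
    rw [Finset.sum_congr rfl (g := fun _ => 4), Finset.sum_congr (s₁ := V) rfl (g := fun _ => 3)] at e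
    · simp only [Finset.sum_const, smul_eq_mul] at e
      omega
    · intro v hv
      refine Eq.trans ?_ (h3 v hv)
      congr 1
      ext u
      simp [Finset.bipartiteBelow, hR, and_assoc]
    · intro u hu
      simp only [hR, Finset.mem_filter] at hu
      obtain ⟨_, w, x, y, z, h⟩ := hu
      rw [← h.cards.1]
      congr 1
      ext v
      simp only [Finset.bipartiteAbove, Finset.mem_filter]
      exact ⟨fun h => h.2, fun h => ⟨(mem_T.1 h).1, h⟩⟩
  have hn : 4 * numWeakGabriel V + 24 = 15 * V.card := by
    unfold numWeakGabriel
    rw [hw]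
    omega
  have : (4 : ℝ) * numWeakGabriel V + 24 = 15 * V.card := by exact_mod_cast hn
  linarith

theorem lin (u : Euc 3) : IsLinearMap ℝ (fun x : Euc 3 => ⟪u, x⟫) :=
  ⟨fun x y => inner_add_right u x y, fun c x => real_inner_smul_right u x c⟩

def Fm (V : Finset (Euc 3)) (u : Euc 3) : Set (Euc 3) :=
  {p ∈ convexHull ℝ (V : Set (Euc 3)) | ∀ x ∈ convexHull ℝ (V : Set (Euc 3)), ⟪x, u⟫ ≤ ⟪p, u⟫}

theorem pol_hull {V : Finset (Euc 3)} {u p : Euc 3} (hu : Pol V u)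
    (h : p ∈ convexHull ℝ (V : Set (Euc 3))) : ⟪u, p⟫ ≤ 1 := by
  have : convexHull ℝ (V : Set (Euc 3)) ⊆ {x | ⟪u, x⟫ ≤ 1} :=
    convexHull_min (fun v hv => hu v hv) (convex_halfSpace_le (lin u) 1)
  exact this h

theorem mem_Fm {V : Finset (Euc 3)} {u p : Euc 3} (hu : Pol V u) (hT : (T V u).Nonempty) :
    p ∈ Fm V u ↔ p ∈ convexHull ℝ (V : Set (Euc 3)) ∧ ⟪u, p⟫ = 1 := by
  obtain ⟨t, ht⟩ := hT
  rw [mem_T] at ht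
  constructor
  · rintro ⟨h1, h2⟩
    refine ⟨h1, le_antisymm (pol_hull hu h1) ?_⟩
    have := h2 t (subset_convexHull ℝ _ ht.1)
    rw [real_inner_comm u t, real_inner_comm u p, ht.2] at this
    exact this
  · rintro ⟨h1, h2⟩
    refine ⟨h1, fun x hx => ?_⟩
    rw [real_inner_comm u x, real_inner_comm u p, h2]
    exact pol_hull hu hx

theorem Fm_eq {V : Finset (Euc 3)} {u : Euc 3} (hu : Pol V u) (hT : (T V u).Nonempty) :
    Fm V u = convexHull ℝ (T V u : Set (Euc 3)) := by
  ext p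
  rw [mem_Fm hu hT]
  constructor
  · rintro ⟨h1, h2⟩
    rw [Finset.mem_convexHull'] at h1 ⊢
    obtain ⟨w, hw0, hw1, hwp⟩ := h1
    have hz : ∀ v ∈ V, w v * (1 - ⟪u, v⟫) = 0 := by
      rw [← Finset.sum_eq_zero_iff_of_nonneg]
      · have : ∑ v ∈ V, w v * ⟪u, v⟫ = 1 := by
          rw [← h2, ← hwp, inner_sum]
          exact Finset.sum_congr rfl fun v _ => (real_inner_smul_right _ _ _).symm
        simp only [mul_sub, mul_one, Finset.sum_sub_distrib, this, hw1, sub_self]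
      · intro v hv
        exact mul_nonneg (hw0 v hv) (by linarith [hu v hv])
    have hz' : ∀ v ∈ V, v ∉ T V u → w v = 0 := by
      intro v hv hvT
      refine (mul_eq_zero.1 (hz v hv)).resolve_right ?_
      intro h
      exact hvT (mem_T.2 ⟨hv, by linarith⟩)
    have hsub : T V u ⊆ V := Finset.filter_subset _ _
    refine ⟨w, fun y hy => hw0 y (hsub hy), ?_, ?_⟩
    · rw [Finset.sum_subset hsub hz', hw1]
    · rw [Finset.sum_subset hsub, hwp]
      intro v hv hvT
      rw [hz' v hv hvT, zero_smul]
  · intro h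
    constructor
    · exact convexHull_mono (fun v hv => (mem_T.1 hv).1) h
    · have : convexHull ℝ (T V u : Set (Euc 3)) ⊆ {x | ⟪u, x⟫ = 1} :=
        convexHull_min (fun v hv => (mem_T.1 hv).2) (convex_hyperplane (lin u) 1)
      exact this h

theorem T_sub {V : Finset (Euc 3)} {u : Euc 3}
    (hext : ∀ v ∈ V, v ∈ Set.extremePoints ℝ (convexHull ℝ (V : Set (Euc 3))))
    (hu : Pol V u) {S : Set (Euc 3)} (hS : Fm V u = convexHull ℝ S) {t : Euc 3} (ht : t ∈ T V u) :
    t ∈ S := by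
  apply extremePoints_convexHull_subset (𝕜 := ℝ)
  rw [← hS]
  apply inter_extremePoints_subset_extremePoints_of_subset
    (A := convexHull ℝ (V : Set (Euc 3)))
  · intro p hp
    exact hp.1
  · refine ⟨?_, hext t (mem_T.1 ht).1⟩
    rw [Fm_eq hu ⟨t, ht⟩]
    exact subset_convexHull ℝ _ ht

theorem corner_mem {V : Finset (Euc 3)} {u w x y z : Euc 3} (hu : Pol V u) (hT : (T V u).Nonempty)
    (hsub : ∀ t ∈ T V u, t = w ∨ t = x ∨ t = y ∨ t = z)
    (hS : Fm V u = convexHull ℝ {w, x, y, z}) (hwx : w ≠ x) (hwz : w ≠ z)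
    (hs : w + y = x + z) (ho : ⟪x - w, z - w⟫ = 0) : w ∈ T V u := by
  by_contra hw
  have h1 : w ∈ convexHull ℝ (T V u : Set (Euc 3)) := by
    rw [← Fm_eq hu hT, hS]
    exact subset_convexHull ℝ _ (by simp)
  have e : w - y = -((x - w) + (z - w)) := by
    have : y = x + z - w := by rw [← hs]; abel
    rw [this]; abel
  have px : 0 < ⟪x - w, x - w⟫ := real_inner_self_pos.2 (sub_ne_zero.2 hwx.symm)
  have pz : 0 < ⟪z - w, z - w⟫ := real_inner_self_pos.2 (sub_ne_zero.2 hwz.symm)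
  have ho' : ⟪z - w, x - w⟫ = 0 := by rw [real_inner_comm]; exact ho
  have h2 : convexHull ℝ (T V u : Set (Euc 3)) ⊆ {p | ⟪w - y, p⟫ < ⟪w - y, w⟫} := by
    apply convexHull_min _ (convex_halfSpace_lt (lin (w - y)) _)
    intro t ht
    have key : ⟪w - y, t - w⟫ < 0 → ⟪w - y, t⟫ < ⟪w - y, w⟫ := by
      rw [inner_sub_right]; intro h; linarith
    apply key
    rw [Finset.mem_coe] at ht
    rcases hsub t ht with rfl | rfl | rfl | rfl
    · exact absurd ht hw
    · rw [e, inner_neg_left, inner_add_left, ho']; linarith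
    · have e' : t - w = -(w - t) := by abel
      rw [e', e, inner_neg_right, inner_neg_neg]
      simp only [inner_add_left, inner_add_right, ho, ho']; linarith
    · rw [e, inner_neg_left, inner_add_left, ho]; linarith
  have := h2 h1
  simp at this

theorem rect_of {V : Finset (Euc 3)} {u : Euc 3}
    (hext : ∀ v ∈ V, v ∈ Set.extremePoints ℝ (convexHull ℝ (V : Set (Euc 3))))
    (hu : Pol V u) (hT : (T V u).Nonempty) (hr : IsRectangle (Fm V u)) : IsR V u ∧ IsF V u := by
  obtain ⟨w, x, y, z, hwx, hwy, hwz, hxy, hxz, hyz, hs, ho, hS⟩ := hr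
  have hsub : ∀ t ∈ T V u, t = w ∨ t = x ∨ t = y ∨ t = z := by
    intro t ht
    simpa using T_sub hext hu hS ht
  have ey : y = x + z - w := by rw [← hs]; abel
  have hw := corner_mem hu hT hsub hS hwx hwz hs ho
  have hx : x ∈ T V u := by
    refine corner_mem (w := x) (x := w) (y := z) (z := y) hu hT ?_ ?_ hwx.symm hxy hs.symm ?_
    · intro t ht; have := hsub t ht; tauto
    · rw [hS]; congr 1; ext t; simp; tauto
    · have : y - x = z - w := by rw [ey]; abel
      rw [this, ← neg_sub x w, inner_neg_left, ho, neg_zero]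
  have hy : y ∈ T V u := by
    refine corner_mem (w := y) (x := x) (y := w) (z := z) hu hT ?_ ?_ hxy.symm hyz ?_ ?_
    · intro t ht; have := hsub t ht; tauto
    · rw [hS]; congr 1; ext t; simp; tauto
    · rw [← hs, add_comm]
    · have e1 : x - y = -(z - w) := by rw [ey]; abel
      have e2 : z - y = -(x - w) := by rw [ey]; abel
      rw [e1, e2, inner_neg_neg, real_inner_comm, ho]
  have hz : z ∈ T V u := by
    refine corner_mem (w := z) (x := w) (y := x) (z := y) hu hT ?_ ?_ hwz.symm hyz.symm ?_ ?_
    · intro t ht; have := hsub t ht; tauto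
    · rw [hS]; congr 1; ext t; simp; tauto
    · rw [hs, add_comm]
    · have : y - z = x - w := by rw [ey]; abel
      rw [this, ← neg_sub z w, inner_neg_left, real_inner_comm, ho, neg_zero]
  have hTe : T V u = {w, x, y, z} := by
    ext t
    simp only [Finset.mem_insert, Finset.mem_singleton]
    refine ⟨hsub t, ?_⟩
    rintro (rfl | rfl | rfl | rfl) <;> assumption
  have hd : dt w x z ≠ 0 := by
    intro h0
    have hcr : cr (x - w) (z - w) ≠ 0 := by
      intro hc
      have e := cr_self_inner (x - w) (z - w)
      rw [hc, inner_zero_left, ho] at e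
      have px : 0 < ⟪x - w, x - w⟫ := real_inner_self_pos.2 (sub_ne_zero.2 hwx.symm)
      have pz : 0 < ⟪z - w, z - w⟫ := real_inner_self_pos.2 (sub_ne_zero.2 hwz.symm)
      nlinarith [mul_pos px pz]
    obtain ⟨t, ht⟩ := line (h := u) hcr
      (by rw [inner_sub_right, (mem_T.1 hx).2, (mem_T.1 hw).2, sub_self])
      (by rw [inner_sub_right, (mem_T.1 hz).2, (mem_T.1 hw).2, sub_self])
    have h1 := (mem_T.1 hw).2
    have h2 : ⟪cr (x - w) (z - w), w⟫ = dt w x z := by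
      simp only [dt, inner3, cr0, cr1, cr2, PiLp.sub_apply]; ring
    rw [ht, real_inner_smul_left, h2, h0, mul_zero] at h1
    norm_num at h1
  rcases lt_or_gt_of_ne hd with hd | hd
  · have hd' : 0 < dt w z x := by rw [dt_swap']; linarith
    refine ⟨⟨w, z, y, x, ?_, hd', by rw [hs, add_comm], by rw [real_inner_comm]; exact ho⟩,
      hu, w, hw, z, hz, x, hx, hd'⟩
    rw [hTe]; ext t; simp; tauto
  · exact ⟨⟨w, x, y, z, hTe, hd, hs, ho⟩, hu, w, hw, x, hx, z, hz, hd⟩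

theorem IsR.rectangle {V : Finset (Euc 3)} {u : Euc 3} (hu : IsF V u) (h : IsR V u) :
    IsRectangle (Fm V u) := by
  obtain ⟨w, x, y, z, h⟩ := h
  obtain ⟨h1, h2, h3, h4, h5, h6⟩ := h.ne
  refine ⟨w, x, y, z, h1, h2, h3, h4, h5, h6, h.2.2.1, h.2.2.2, ?_⟩
  rw [Fm_eq hu.1 ⟨w, by simp [h.1]⟩, h.1]
  congr 1
  simp

theorem IsF.nonempty {V : Finset (Euc 3)} {u : Euc 3} (hu : IsF V u) : (T V u).Nonempty := by
  obtain ⟨_, a, ha, _⟩ := hu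
  exact ⟨a, ha⟩

theorem IsF.twoDim {V : Finset (Euc 3)} {u : Euc 3} (hu : IsF V u) :
    IsTwoDimExpFace (convexHull ℝ (V : Set (Euc 3))) (Fm V u) := by
  have hne := hu.nonempty
  obtain ⟨hp, a, ha, b, hb, c, hc, hd⟩ := hu
  have hu0 : u ≠ 0 := by
    rintro rfl
    have := (mem_T.1 ha).2
    simp at this
  refine ⟨⟨u, hu0, rfl⟩, ?_⟩
  have hmem : ∀ t ∈ T V u, t ∈ Fm V u := by
    intro t ht
    rw [Fm_eq hp hne]
    exact subset_convexHull ℝ _ ht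
  apply le_antisymm
  · have : Fact (Module.finrank ℝ (Euc 3) = 2 + 1) := ⟨by simp⟩
    rw [← Submodule.finrank_orthogonal_span_singleton (𝕜 := ℝ) (n := 2) hu0]
    apply Submodule.finrank_mono
    rw [vectorSpan_def, Submodule.span_le]
    rintro _ ⟨p, h1, q, h2, rfl⟩
    rw [SetLike.mem_coe, Submodule.mem_orthogonal_singleton_iff_inner_right]
    rw [mem_Fm hp hne] at h1 h2
    simp only [vsub_eq_sub]
    rw [inner_sub_right, h1.2, h2.2, sub_self]
  · have hli : LinearIndependent ℝ ![b - a, c - a] := by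
      rw [LinearIndependent.pair_iff]
      intro s t h
      have e1 := congrArg (fun z => ⟪cr a b, z⟫) h
      have e2 := congrArg (fun z => ⟪cr c a, z⟫) h
      simp only [inner_add_right, real_inner_smul_right, inner_sub_right, cr_inner_l, cr_inner_r,
        inner_zero_right] at e1 e2
      change s * (0 - 0) + t * (dt a b c - 0) = 0 at e1
      change s * (dt c a b - 0) + t * (0 - 0) = 0 at e2
      rw [← dt_rot c a b] at e2
      simp only [sub_zero, mul_zero, zero_add, add_zero, mul_eq_zero, hd.ne', or_false] at e1 e2
      exact ⟨e2, e1⟩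
    have := finrank_span_eq_card hli
    rw [Fintype.card_fin] at this
    refine this.symm.le.trans ?_
    apply Submodule.finrank_mono
    rw [Submodule.span_le]
    rintro _ ⟨i, rfl⟩
    fin_cases i
    · exact vsub_mem_vectorSpan ℝ (hmem b hb) (hmem a ha)
    · exact vsub_mem_vectorSpan ℝ (hmem c hc) (hmem a ha)

theorem good_of {V : Finset (Euc 3)}
    (hext : ∀ v ∈ V, v ∈ Set.extremePoints ℝ (convexHull ℝ (V : Set (Euc 3))))
    (hfaces : ∀ F : Set (Euc 3), IsTwoDimExpFace (convexHull ℝ (V : Set (Euc 3))) F →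
      IsRectangle F ∨ IsTriangle F) (u : Euc 3) (hu : IsF V u) : Good V u := by
  rcases hfaces _ hu.twoDim with h | h
  · exact Or.inr (rect_of hext hu.1 hu.nonempty h).1
  · left
    obtain ⟨p, q, r, _, hS⟩ := h
    have hsub : T V u ⊆ {p, q, r} := by
      intro t ht
      simpa using T_sub hext hu.1 hS ht
    obtain ⟨hp, a, ha, b, hb, c, hc, hd⟩ := hu
    refine ⟨a, b, c, ?_, hd⟩
    symm
    apply Finset.eq_of_subset_of_card_le
    · intro t ht
      simp only [Finset.mem_insert, Finset.mem_singleton] at ht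
      rcases ht with rfl | rfl | rfl <;> assumption
    · have h1 : (T V u).card ≤ 3 := (Finset.card_le_card hsub).trans Finset.card_le_three
      have h2 : ({a, b, c} : Finset (Euc 3)).card = 3 := by
        have n1 : a ≠ b := by rintro rfl; simp [dt_s] at hd
        have n2 : a ≠ c := by rintro rfl; simp [dt_l] at hd
        have n3 : b ≠ c := by rintro rfl; simp [dt_r] at hd
        exact Finset.card_eq_three.2 ⟨a, b, c, n1, n2, n3, rfl⟩
      omega

theorem Fm_inj {V : Finset (Euc 3)} {u u' : Euc 3} (hu : IsF V u) (hu' : IsF V u')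
    (h : Fm V u = Fm V u') : u = u' := by
  have key : ∀ t ∈ T V u, ⟪u, t⟫ = ⟪u', t⟫ := by
    intro t ht
    have h1 : t ∈ Fm V u := by
      rw [Fm_eq hu.1 hu.nonempty]; exact subset_convexHull ℝ _ ht
    rw [h, mem_Fm hu'.1 hu'.nonempty] at h1
    rw [h1.2, (mem_T.1 ht).2]
  obtain ⟨_, a, ha, b, hb, c, hc, hd⟩ := hu
  exact eq_of_three hd.ne' (key a ha) (key b hb) (key c hc)

theorem three_of {V : Finset (Euc 3)}
    (hp : ∀ d : Euc 3, d ≠ 0 → ∃ v ∈ V, 0 < ⟪d, v⟫)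
    (hext : ∀ v ∈ V, v ∈ Set.extremePoints ℝ (convexHull ℝ (V : Set (Euc 3))))
    (hrect : ∀ v ∈ V,
      {F : Set (Euc 3) | IsTwoDimExpFace (convexHull ℝ (V : Set (Euc 3))) F ∧
        IsRectangle F ∧ v ∈ F}.ncard = 3) :
    ∀ v ∈ V, ((FF V).filter fun u => IsR V u ∧ v ∈ T V u).card = 3 := by
  intro v hv
  refine Eq.trans ?_ (hrect v hv)
  rw [← Set.ncard_coe_finset, ← Set.ncard_image_of_injOn (f := Fm V)]
  · congr 1
    ext F
    simp only [Set.mem_image, Finset.mem_coe, Finset.mem_filter, mem_FF, Set.mem_setOf_eq]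
    constructor
    · rintro ⟨u, ⟨hu, hr, hvT⟩, rfl⟩
      refine ⟨hu.twoDim, hr.rectangle hu, ?_⟩
      rw [Fm_eq hu.1 hu.nonempty]
      exact subset_convexHull ℝ _ hvT
    · rintro ⟨⟨⟨u, hu0, rfl⟩, _⟩, hr, hvF⟩
      obtain ⟨v0, hv0, hpos⟩ := hp u hu0
      have hM : 0 < ⟪v, u⟫ := by
        have := hvF.2 v0 (subset_convexHull ℝ _ hv0)
        rw [real_inner_comm] at hpos
        linarith
      have hF : Fm V (⟪v, u⟫⁻¹ • u) = {p ∈ convexHull ℝ (V : Set (Euc 3)) |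
          ∀ x ∈ convexHull ℝ (V : Set (Euc 3)), ⟪x, u⟫ ≤ ⟪p, u⟫} := by
        unfold Fm
        simp only [real_inner_smul_right, mul_le_mul_iff_right₀ (inv_pos.2 hM)]
      have hpol : Pol V (⟪v, u⟫⁻¹ • u) := by
        intro x hx
        have := hvF.2 x (subset_convexHull ℝ _ hx)
        rw [real_inner_smul_left, real_inner_comm x u, ← div_eq_inv_mul, div_le_one hM]
        exact this
      have hvT : v ∈ T V (⟪v, u⟫⁻¹ • u) := by
        rw [mem_T, real_inner_smul_left, real_inner_comm v u]
        exact ⟨hv, inv_mul_cancel₀ hM.ne'⟩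
      rw [← hF] at hr
      obtain ⟨h1, h2⟩ := rect_of hext hpol ⟨v, hvT⟩ hr
      exact ⟨_, ⟨h2, h1, hvT⟩, hF⟩
  · intro u hu u' hu' h
    simp only [Finset.mem_coe, Finset.mem_filter, mem_FF] at hu hu'
    exact Fm_inj hu.1 hu'.1 h

end WG

/-- If `V ⊆ S²` has the origin in the interior of its convex hull, every point of `V` is a
vertex of `conv V`, every 2-dimensional exposed face of `conv V` is a rectangle or a
triangle, and every point of `V` lies on exactly 3 rectangular faces, then the weak Gabriel
graph of `V` has exactly `(15/4)|V| - 6` edges. -/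
theorem weakGabriel_equality (V : Finset (Euc 3)) (hV : ∀ v ∈ V, ‖v‖ = 1)
    (ho : (0 : Euc 3) ∈ interior (convexHull ℝ (V : Set (Euc 3))))
    (hext : ∀ v ∈ V, v ∈ Set.extremePoints ℝ (convexHull ℝ (V : Set (Euc 3))))
    (hfaces : ∀ F : Set (Euc 3), IsTwoDimExpFace (convexHull ℝ (V : Set (Euc 3))) F →
      IsRectangle F ∨ IsTriangle F)
    (hrect : ∀ v ∈ V,
      {F : Set (Euc 3) | IsTwoDimExpFace (convexHull ℝ (V : Set (Euc 3))) F ∧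
        IsRectangle F ∧ v ∈ F}.ncard = 3) :
    (numWeakGabriel V : ℝ) = 15 / 4 * V.card - 6 := by
  have hV' : ∀ v ∈ V, ⟪v, v⟫ = 1 := by
    intro v hv
    rw [real_inner_self_eq_norm_sq, hV v hv]; norm_num
  have hp : ∀ d : Euc 3, d ≠ 0 → ∃ v ∈ V, 0 < ⟪d, v⟫ := fun d hd => WG.exists_pos ho hd
  exact WG.count hV' hp (WG.three_of hp hext hrect) (WG.good_of hext hfaces)
end
end
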